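/- Let S ⊆ C_n be finite, a ∈ Sym TT_n, let C_n[a] be the commutative subring of TT_n generated by C_n and a, and let P be an ordering of C_n[a] containing S ∪ Ω_n. Then: (1) if a(X) is positive semidefinite for all X ∈ K_S, then a ∈ P; (2) if a(X) is positive definite for all X ∈ K_S, then a ∈ P and a ∉ −P; (3) if a(X) = 0 for all X ∈ K_S, then a ∈ P ∩ (−P). -/

import Mathlib

noncomputable section

open Matrix

/-- The polynomial ring ℝ[ξ] in the g·n² commuting variables ξ_{jıȷ}. -/
abbrev PolyRing (n g : ℕ) : Type := MvPolynomial (Fin g × Fin n × Fin n) ℝ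

/-- n×n matrices over ℝ[ξ]. -/
abbrev MatP (n g : ℕ) : Type := Matrix (Fin n) (Fin n) (PolyRing n g)

/-- The generic matrices Ξ_j = (ξ_{jıȷ})_{ıȷ}. -/
def genMat (n g : ℕ) (j : Fin g) : MatP n g :=
  Matrix.of fun a b => MvPolynomial.X (j, a, b)

/-- The set of generic matrices together with their transposes. -/
def genSet (n g : ℕ) : Set (MatP n g) :=
  Set.range (genMat n g) ∪ Set.range (fun j => (genMat n g j)ᵀ)

/-- The trace ring TT_n: the ℝ-subalgebra of M_n(ℝ[ξ]) generated by the Ξ_j, their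
transposes, and the scalar matrices tr(w)·1 for all products w of the Ξ_j, Ξ_jᵀ. -/
def traceRing (n g : ℕ) : Subalgebra ℝ (MatP n g) :=
  Algebra.adjoin ℝ
    (genSet n g ∪
      {m | ∃ w ∈ Submonoid.closure (genSet n g), m = (Matrix.trace w) • (1 : MatP n g)})

/-- The center C_n of the trace ring: the scalar matrices in TT_n. -/
def centerSet (n g : ℕ) : Set (MatP n g) :=
  {c | c ∈ traceRing n g ∧ ∃ p : PolyRing n g, c = p • (1 : MatP n g)}

/-- Evaluation of a matrix of polynomials at a g-tuple X of n×n real matrices. -/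
def evalMat (n g : ℕ) (X : Fin g → Matrix (Fin n) (Fin n) ℝ) (h : MatP n g) :
    Matrix (Fin n) (Fin n) ℝ :=
  h.map (MvPolynomial.eval fun v => X v.1 v.2.1 v.2.2)

/-- The semialgebraic set K_S determined by S. -/
def KSet (n g : ℕ) (S : Set (MatP n g)) : Set (Fin g → Matrix (Fin n) (Fin n) ℝ) :=
  {X | ∀ s ∈ S, (evalMat n g X s).PosSemidef}

/-- Cyclic quadratic module in Sym TT_n. -/
def IsCyclicQM (n g : ℕ) (Q : Set (MatP n g)) : Prop :=
  (∀ q ∈ Q, q ∈ traceRing n g ∧ qᵀ = q) ∧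
  (1 : MatP n g) ∈ Q ∧
  (∀ a ∈ Q, ∀ b ∈ Q, a + b ∈ Q) ∧
  (∀ h ∈ traceRing n g, ∀ q ∈ Q, h * q * hᵀ ∈ Q) ∧
  (∀ q ∈ Q, (Matrix.trace q) • (1 : MatP n g) ∈ Q)

/-- Cyclic preordering: a cyclic quadratic module whose intersection with the center
is closed under multiplication. -/
def IsCyclicPreordering (n g : ℕ) (T : Set (MatP n g)) : Prop :=
  IsCyclicQM n g T ∧
  ∀ a ∈ T ∩ centerSet n g, ∀ b ∈ T ∩ centerSet n g, a * b ∈ T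

/-- The smallest cyclic preordering T_S^tr containing S. -/
def TtrS (n g : ℕ) (S : Set (MatP n g)) : Set (MatP n g) :=
  {a | ∀ T : Set (MatP n g), IsCyclicPreordering n g T → S ⊆ T → a ∈ T}

/-- Ω_n: finite sums of finite products of elements tr(hhᵀ)·1 with h ∈ TT_n. -/
def OmegaSet (n g : ℕ) : Set (MatP n g) :=
  (AddSubmonoid.closure
    ((Submonoid.closure
        {c : MatP n g | ∃ h ∈ traceRing n g,
          c = (Matrix.trace (h * hᵀ)) • (1 : MatP n g)} : Submonoid (MatP n g)) :
      Set (MatP n g)) : AddSubmonoid (MatP n g))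

/-- P is an ordering of the subring Λ: P is closed under addition and multiplication,
P ∪ (−P) = Λ, and P ∩ (−P) is a prime ideal of Λ. -/
def IsOrderingOf (n g : ℕ) (Λ : Subring (MatP n g)) (P : Set (MatP n g)) : Prop :=
  P ⊆ (Λ : Set (MatP n g)) ∧
  (∀ x ∈ P, ∀ y ∈ P, x + y ∈ P) ∧
  (∀ x ∈ P, ∀ y ∈ P, x * y ∈ P) ∧
  (∀ x ∈ Λ, x ∈ P ∨ -x ∈ P) ∧
  (∀ x ∈ Λ, ∀ y : MatP n g, y ∈ P → -y ∈ P →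
    (x * y ∈ P ∧ -(x * y) ∈ P) ∧ (y * x ∈ P ∧ -(y * x) ∈ P)) ∧
  ¬((1 : MatP n g) ∈ P ∧ -(1 : MatP n g) ∈ P) ∧
  (∀ x ∈ Λ, ∀ y ∈ Λ, (x * y ∈ P ∧ -(x * y) ∈ P) →
    (x ∈ P ∧ -x ∈ P) ∨ (y ∈ P ∧ -y ∈ P))

section RealClosure

open Polynomial

/-- Sums of nonnegative multiples of squares of polynomials. -/
def weightedSquares (R : Type*) [Field R] [LinearOrder R] : AddSubmonoid R[X] :=
  AddSubmonoid.closure {x | ∃ t : R, ∃ q : R[X], 0 ≤ t ∧ x = C t * (q * q)}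

/-- Every irreducible polynomial defining a formally real extension of `R` is linear. -/
def HasNoRealExtension (R : Type*) [Field R] [LinearOrder R] : Prop :=
  ∀ p : R[X], Irreducible p → p.natDegree ≠ 1 → ∃ s ∈ weightedSquares R, p ∣ 1 + s

/-- Sums of squares of elements of `L` with weights in `W`. -/
def subfieldSquares {Ω : Type*} [Field Ω] (W : Submonoid Ω) (L : Subfield Ω) : AddSubmonoid Ω :=
  AddSubmonoid.closure {x | ∃ w ∈ W, ∃ l ∈ L, x = w * (l * l)}

section Squares

variable {Ω : Type*} [Field Ω] {W : Submonoid Ω} {L : Subfield Ω}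

theorem mul_sq_mem_subfieldSquares {w l : Ω} (hw : w ∈ W) (hl : l ∈ L) :
    w * (l * l) ∈ subfieldSquares W L :=
  AddSubmonoid.subset_closure ⟨w, hw, l, hl, rfl⟩

theorem sq_mem_subfieldSquares {l : Ω} (hl : l ∈ L) : l * l ∈ subfieldSquares W L := by
  simpa using mul_sq_mem_subfieldSquares W.one_mem hl

theorem weight_mem_subfieldSquares {w : Ω} (hw : w ∈ W) : w ∈ subfieldSquares W L := by
  simpa using mul_sq_mem_subfieldSquares hw L.one_mem

theorem subfieldSquares_mul_mem {x y : Ω} (hx : x ∈ subfieldSquares W L)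
    (hy : y ∈ subfieldSquares W L) : x * y ∈ subfieldSquares W L := by
  induction hx using AddSubmonoid.closure_induction with
  | mem x hx =>
    obtain ⟨w, hw, l, hl, rfl⟩ := hx
    induction hy using AddSubmonoid.closure_induction with
    | mem y hy =>
      obtain ⟨w', hw', l', hl', rfl⟩ := hy
      have := mul_sq_mem_subfieldSquares (W.mul_mem hw hw') (L.mul_mem hl hl')
      convert this using 1
      ring
    | zero => simp
    | add a b _ _ ha hb => rw [mul_add]; exact add_mem ha hb
  | zero => simp
  | add a b _ _ ha hb => rw [add_mul]; exact add_mem ha hb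

theorem subfieldSquares_le (hWL : (W : Set Ω) ⊆ L) {x : Ω} (hx : x ∈ subfieldSquares W L) :
    x ∈ L := by
  induction hx using AddSubmonoid.closure_induction with
  | mem x hx =>
    obtain ⟨w, hw, l, hl, rfl⟩ := hx
    exact L.mul_mem (hWL hw) (L.mul_mem hl hl)
  | zero => exact L.zero_mem
  | add a b _ _ ha hb => exact L.add_mem ha hb

theorem eq_zero_of_mem_of_neg_mem_subfieldSquares (hWL : (W : Set Ω) ⊆ L)
    (hreal : (-1 : Ω) ∉ subfieldSquares W L) {x : Ω} (hx : x ∈ subfieldSquares W L)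
    (hx' : -x ∈ subfieldSquares W L) : x = 0 := by
  by_contra h0
  apply hreal
  have h1 : x⁻¹ ∈ L := L.inv_mem (subfieldSquares_le hWL hx)
  have h2 := subfieldSquares_mul_mem (subfieldSquares_mul_mem hx hx')
    (sq_mem_subfieldSquares (W := W) h1)
  convert h2 using 1
  field_simp

theorem exists_maximal_real_subfield (L : Subfield Ω) (hreal : (-1 : Ω) ∉ subfieldSquares W L) :
    ∃ M : Subfield Ω, L ≤ M ∧ Maximal (fun K => (-1 : Ω) ∉ subfieldSquares W K) M := by
  refine zorn_le_nonempty₀ {K : Subfield Ω | (-1 : Ω) ∉ subfieldSquares W K} ?_ L hreal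
  intro c hc hchain y hy
  refine ⟨sSup c, ?_, fun z hz => le_sSup hz⟩
  have hne : c.Nonempty := ⟨y, hy⟩
  have key : ∀ x ∈ subfieldSquares W (sSup c), ∃ K ∈ c, x ∈ subfieldSquares W K := by
    intro x hx
    induction hx using AddSubmonoid.closure_induction with
    | mem x hx =>
      obtain ⟨w, hw, l, hl, rfl⟩ := hx
      rw [Subfield.mem_sSup_of_directedOn hne hchain.directedOn] at hl
      obtain ⟨K, hK, hl⟩ := hl
      exact ⟨K, hK, mul_sq_mem_subfieldSquares hw hl⟩
    | zero => exact ⟨y, hy, zero_mem _⟩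
    | add a b _ _ ha hb =>
      obtain ⟨K, hK, ha⟩ := ha
      obtain ⟨K', hK', hb⟩ := hb
      have mono : ∀ {A B : Subfield Ω}, A ≤ B → subfieldSquares W A ≤ subfieldSquares W B := by
        intro A B hAB
        apply AddSubmonoid.closure_mono
        rintro _ ⟨w, hw, l, hl, rfl⟩
        exact ⟨w, hw, l, hAB hl, rfl⟩
      rcases hchain.total hK hK' with h | h
      · exact ⟨K', hK', add_mem (mono h ha) hb⟩
      · exact ⟨K, hK, add_mem ha (mono h hb)⟩
  intro h
  obtain ⟨K, hK, h⟩ := key _ h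
  exact hc hK h

theorem exists_eq_aeval_of_mem_adjoin {α : Ω} (hα : IsIntegral L α) {x : Ω}
    (hx : x ∈ IntermediateField.adjoin L {α}) : ∃ q : L[X], x = aeval α q := by
  have h : x ∈ (IntermediateField.adjoin L {α}).toSubalgebra := hx
  rw [IntermediateField.adjoin_simple_toSubalgebra_of_isAlgebraic hα.isAlgebraic,
    Algebra.adjoin_singleton_eq_range_aeval] at h
  obtain ⟨q, hq⟩ := h
  exact ⟨q, hq.symm⟩

theorem neg_one_mem_of_maximal
    (hmax : Maximal (fun K => (-1 : Ω) ∉ subfieldSquares W K) L) {α : Ω} (hα : α ∉ L) :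
    (-1 : Ω) ∈ subfieldSquares W (IntermediateField.adjoin L {α}).toSubfield := by
  by_contra h
  have hle : L ≤ (IntermediateField.adjoin L {α}).toSubfield := by
    intro x hx
    exact (IntermediateField.adjoin L {α}).algebraMap_mem ⟨x, hx⟩
  exact hα (hmax.2 h hle (IntermediateField.mem_adjoin_simple_self L α))

theorem mem_or_neg_mem_of_maximal [IsAlgClosed Ω] (hWL : (W : Set Ω) ⊆ L)
    (hmax : Maximal (fun K => (-1 : Ω) ∉ subfieldSquares W K) L) {x : Ω} (hx : x ∈ L) :
    x ∈ subfieldSquares W L ∨ -x ∈ subfieldSquares W L := by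
  obtain ⟨α, hα⟩ := IsAlgClosed.exists_pow_nat_eq x (n := 2) two_pos
  by_cases hαL : α ∈ L
  · left
    rw [← hα, sq]
    exact sq_mem_subfieldSquares hαL
  right
  set x' : L := ⟨x, hx⟩
  have hroot : aeval α (X ^ 2 - C x' : L[X]) = 0 := by
    have : algebraMap L Ω x' = x := rfl
    simp [hα, this]
  have hmonic : (X ^ 2 - C x' : L[X]).Monic := monic_X_pow_sub_C _ two_ne_zero
  have hαint : IsIntegral L α := ⟨_, hmonic, by simpa [aeval_def] using hroot⟩
  have hlin : ∀ y ∈ IntermediateField.adjoin L {α}, ∃ b ∈ L, ∃ c ∈ L, y = b + c * α := by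
    intro y hy
    obtain ⟨q, rfl⟩ := exists_eq_aeval_of_mem_adjoin hαint hy
    have hdeg : (q %ₘ (X ^ 2 - C x')).natDegree ≤ 1 := by
      have := natDegree_modByMonic_lt q hmonic (by
        intro h
        have := congrArg natDegree h
        simp at this)
      rw [natDegree_X_pow_sub_C] at this
      omega
    obtain ⟨c, b, hcb⟩ := exists_eq_X_add_C_of_natDegree_le_one hdeg
    refine ⟨b, b.2, c, c.2, ?_⟩
    rw [← aeval_modByMonic_eq_self_of_root hroot, hcb]
    have : ∀ z : L, algebraMap L Ω z = z := fun _ => rfl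
    simp [this, add_comm]
  have hdec : ∀ y ∈ subfieldSquares W (IntermediateField.adjoin L {α}).toSubfield,
      ∃ B ∈ subfieldSquares W L, ∃ D ∈ subfieldSquares W L, ∃ d ∈ L,
        y = B + x * D + d * α := by
    intro y hy
    induction hy using AddSubmonoid.closure_induction with
    | mem y hy =>
      obtain ⟨w, hw, l, hl, rfl⟩ := hy
      obtain ⟨b, hb, c, hc, rfl⟩ := hlin l hl
      refine ⟨_, mul_sq_mem_subfieldSquares hw hb, _, mul_sq_mem_subfieldSquares hw hc,
        w * (b * c + b * c), L.mul_mem (hWL hw) (L.add_mem (L.mul_mem hb hc) (L.mul_mem hb hc)),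
        ?_⟩
      rw [← hα]
      ring
    | zero => exact ⟨0, zero_mem _, 0, zero_mem _, 0, zero_mem _, by simp⟩
    | add a b _ _ ha hb =>
      obtain ⟨B, hB, D, hD, d, hd, rfl⟩ := ha
      obtain ⟨B', hB', D', hD', d', hd', rfl⟩ := hb
      exact ⟨_, add_mem hB hB', _, add_mem hD hD', _, add_mem hd hd', by ring⟩
  obtain ⟨B, hB, D, hD, d, hd, h⟩ := hdec _ (neg_one_mem_of_maximal hmax hαL)
  have hBL := subfieldSquares_le hWL hB
  have hDL := subfieldSquares_le hWL hD
  have hd0 : d = 0 := by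
    by_contra hd0
    apply hαL
    have : α = (-1 - B - x * D) * d⁻¹ := by
      rw [h]; field_simp; ring
    rw [this]
    exact L.mul_mem (L.sub_mem (L.sub_mem (L.neg_mem L.one_mem) hBL) (L.mul_mem hx hDL))
      (L.inv_mem hd)
  rw [hd0, zero_mul, add_zero] at h
  have hD0 : D ≠ 0 := by
    rintro rfl
    apply hmax.1
    rw [h, mul_zero, add_zero]
    exact hB
  have hx2 : -x = (1 + B) * D * (D⁻¹ * D⁻¹) := by
    have : (1 : Ω) + B = - x * D := by linear_combination -h
    rw [this]; field_simp
  rw [hx2]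
  refine subfieldSquares_mul_mem (subfieldSquares_mul_mem (add_mem ?_ hB) hD)
    (sq_mem_subfieldSquares (L.inv_mem hDL))
  exact weight_mem_subfieldSquares W.one_mem

end Squares

/-- The cone of weighted sums of squares in a maximal real subfield. -/
def subfieldCone {Ω : Type*} [Field Ω] {W : Submonoid Ω} {L : Subfield Ω}
    (hWL : (W : Set Ω) ⊆ L) (hreal : (-1 : Ω) ∉ subfieldSquares W L) : RingCone L where
  carrier := {x | (x : Ω) ∈ subfieldSquares W L}
  mul_mem' := fun ha hb => subfieldSquares_mul_mem ha hb
  one_mem' := weight_mem_subfieldSquares W.one_mem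
  add_mem' := fun ha hb => (subfieldSquares W L).add_mem ha hb
  zero_mem' := zero_mem (subfieldSquares W L)
  eq_zero_of_mem_of_neg_mem' := fun ha hb =>
    Subtype.ext (eq_zero_of_mem_of_neg_mem_subfieldSquares hWL hreal ha hb)

theorem exists_real_field_of_subfield {Ω : Type} [Field Ω] [IsAlgClosed Ω] (W : Submonoid Ω)
    (L : Subfield Ω) (hWL : (W : Set Ω) ⊆ L) (hreal : (-1 : Ω) ∉ subfieldSquares W L) :
    ∃ (R : Type) (_ : Field R) (_ : LinearOrder R) (_ : IsStrictOrderedRing R) (f : L →+* R),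
      HasNoRealExtension R ∧ ∀ w : L, (w : Ω) ∈ W → 0 ≤ f w := by
  classical
  obtain ⟨M, hLM, hmax⟩ := exists_maximal_real_subfield L hreal
  have hWM : (W : Set Ω) ⊆ M := hWL.trans hLM
  let cone := subfieldCone hWM hmax.1
  have : HasMemOrNegMem cone := ⟨fun a => mem_or_neg_mem_of_maximal hWM hmax a.2⟩
  let ord : LinearOrder M := LinearOrder.mkOfAddGroupCone cone
  have : IsOrderedRing M := IsOrderedRing.mkOfCone cone
  have : IsStrictOrderedRing M := IsOrderedRing.toIsStrictOrderedRing M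
  have hnonneg : ∀ x : M, 0 ≤ x ↔ (x : Ω) ∈ subfieldSquares W M := by
    intro x
    change (x - 0) ∈ cone ↔ _
    rw [sub_zero]
    rfl
  refine ⟨M, inferInstance, ord, inferInstance, Subfield.inclusion hLM, ?_, ?_⟩
  · intro p hp hdeg
    obtain ⟨α, hα⟩ := IsAlgClosed.exists_aeval_eq_zero Ω p (degree_pos_of_irreducible hp).ne'
    have hαM : α ∉ M := by
      intro h
      apply hdeg
      have h1 : p.IsRoot ⟨α, h⟩ := by
        have h2 : aeval (algebraMap M Ω ⟨α, h⟩) p = 0 := hα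
        rw [aeval_algebraMap_apply] at h2
        exact (map_eq_zero (algebraMap M Ω)).1 h2
      exact natDegree_eq_of_degree_eq_some (degree_eq_one_of_irreducible_of_root hp h1)
    have hαint : IsIntegral M α := (show IsAlgebraic M α from ⟨p, hp.ne_zero, hα⟩).isIntegral
    have key : ∀ y ∈ subfieldSquares W (IntermediateField.adjoin M {α}).toSubfield,
        ∃ s ∈ weightedSquares M, y = aeval α s := by
      intro y hy
      induction hy using AddSubmonoid.closure_induction with
      | mem y hy =>
        obtain ⟨w, hw, l, hl, rfl⟩ := hy
        obtain ⟨q, rfl⟩ := exists_eq_aeval_of_mem_adjoin hαint hl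
        refine ⟨C ⟨w, hWM hw⟩ * (q * q), AddSubmonoid.subset_closure ⟨_, q, ?_, rfl⟩, ?_⟩
        · rw [hnonneg]
          exact weight_mem_subfieldSquares hw
        · have : algebraMap M Ω ⟨w, hWM hw⟩ = w := rfl
          simp [this]
      | zero => exact ⟨0, zero_mem _, by simp⟩
      | add a b _ _ ha hb =>
        obtain ⟨s, hs, rfl⟩ := ha
        obtain ⟨t, ht, rfl⟩ := hb
        exact ⟨s + t, add_mem hs ht, by simp⟩
    obtain ⟨s, hs, h⟩ := key _ (neg_one_mem_of_maximal hmax hαM)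
    refine ⟨s, hs, ?_⟩
    have h0 : aeval α (1 + s) = 0 := by
      rw [map_add, ← h]; simp
    exact (hp.dvd_iff.1 ((minpoly.dvd M α hα)) |>.resolve_left
      (minpoly.not_isUnit M α)).dvd.trans (minpoly.dvd M α h0)
  · intro w hw
    rw [hnonneg]
    exact weight_mem_subfieldSquares hw

/-- An ordering of a commutative ring is induced by a homomorphism to an ordered field without
formally real algebraic extensions. -/
theorem exists_real_field_of_ordering {Λ : Type} [CommRing Λ] (P : Set Λ)
    (hadd : ∀ x ∈ P, ∀ y ∈ P, x + y ∈ P) (hmul : ∀ x ∈ P, ∀ y ∈ P, x * y ∈ P)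
    (htot : ∀ x, x ∈ P ∨ -x ∈ P)
    (hideal : ∀ x y, y ∈ P → -y ∈ P → x * y ∈ P ∧ -(x * y) ∈ P)
    (hone : ¬((1 : Λ) ∈ P ∧ -(1 : Λ) ∈ P))
    (hprime : ∀ x y, (x * y ∈ P ∧ -(x * y) ∈ P) → (x ∈ P ∧ -x ∈ P) ∨ (y ∈ P ∧ -y ∈ P)) :
    ∃ (R : Type) (_ : Field R) (_ : LinearOrder R) (_ : IsStrictOrderedRing R) (f : Λ →+* R),
      HasNoRealExtension R ∧ ∀ x, x ∈ P ↔ 0 ≤ f x := by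
  have hsq : ∀ x, x * x ∈ P := by
    intro x
    rcases htot x with h | h
    · exact hmul _ h _ h
    · simpa using hmul _ h _ h
  have h1 : (1 : Λ) ∈ P := by simpa using hsq 1
  have h0 : (0 : Λ) ∈ P := by simpa using hsq 0
  let I : Ideal Λ :=
    { carrier := {x | x ∈ P ∧ -x ∈ P}
      add_mem' := fun {a b} ha hb => ⟨hadd _ ha.1 _ hb.1, by
        rw [neg_add]; exact hadd _ ha.2 _ hb.2⟩
      zero_mem' := ⟨h0, by simpa using h0⟩
      smul_mem' := fun c x hx => hideal c x hx.1 hx.2 }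
  have hI : ∀ x, x ∈ I ↔ x ∈ P ∧ -x ∈ P := fun _ => Iff.rfl
  have : I.IsPrime := by
    refine Ideal.isPrime_iff.2 ⟨fun h => hone ((hI 1).1 (h ▸ Submodule.mem_top)), ?_⟩
    intro x y h
    exact hprime x y h
  let K := FractionRing (Λ ⧸ I)
  let Ω := AlgebraicClosure K
  let j : Λ →+* K := (algebraMap (Λ ⧸ I) K).comp (Ideal.Quotient.mk I)
  have hj0 : ∀ x, j x = 0 ↔ x ∈ I := by
    intro x
    change algebraMap (Λ ⧸ I) K (Ideal.Quotient.mk I x) = 0 ↔ _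
    rw [FaithfulSMul.algebraMap_eq_zero_iff, Ideal.Quotient.eq_zero_iff_mem]
  let k : K →+* Ω := algebraMap K Ω
  let W : Submonoid Ω :=
    { carrier := {x | ∃ p ∈ P, x = k (j p)}
      one_mem' := ⟨1, h1, by simp⟩
      mul_mem' := by
        rintro _ _ ⟨p, hp, rfl⟩ ⟨q, hq, rfl⟩
        exact ⟨p * q, hmul _ hp _ hq, by simp⟩ }
  have hfrac : ∀ x : K, ∃ a b : Λ, b ∉ I ∧ j b * x = j a := by
    intro x
    obtain ⟨a, b, hb, rfl⟩ := IsFractionRing.div_surjective (A := Λ ⧸ I) x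
    obtain ⟨a, rfl⟩ := Ideal.Quotient.mk_surjective a
    obtain ⟨b, rfl⟩ := Ideal.Quotient.mk_surjective b
    have hb0 : b ∉ I := by
      rw [← Ideal.Quotient.eq_zero_iff_mem]
      exact nonZeroDivisors.ne_zero hb
    have : j b ≠ 0 := by rwa [Ne, hj0]
    exact ⟨a, b, hb0, mul_div_cancel₀ _ this⟩
  have key : ∀ y ∈ subfieldSquares W k.fieldRange,
      ∃ p ∈ P, ∃ b : Λ, b ∉ I ∧ k (j b) * k (j b) * y = k (j p) := by
    intro y hy
    induction hy using AddSubmonoid.closure_induction with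
    | mem y hy =>
      obtain ⟨w, ⟨p, hp, rfl⟩, l, ⟨x, rfl⟩, rfl⟩ := hy
      obtain ⟨a, b, hb, hx⟩ := hfrac x
      refine ⟨p * (a * a), hmul _ hp _ (hsq a), b, hb, ?_⟩
      simp only [map_mul, ← hx]
      ring
    | zero => exact ⟨0, h0, 1, fun h => hone ((hI 1).1 h), by simp⟩
    | add x y _ _ hx hy =>
      obtain ⟨p, hp, b, hb, hx⟩ := hx
      obtain ⟨q, hq, c, hc, hy⟩ := hy
      refine ⟨c * c * p + b * b * q, hadd _ (hmul _ (hsq c) _ hp) _ (hmul _ (hsq b) _ hq),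
        b * c, fun h => (Ideal.IsPrime.mem_or_mem ‹I.IsPrime› h).elim hb hc, ?_⟩
      simp only [map_mul, map_add, ← hx, ← hy]
      ring
  obtain ⟨R, iF, iO, iS, f, hR, hf⟩ := exists_real_field_of_subfield W k.fieldRange
    (by rintro _ ⟨p, _, rfl⟩; exact ⟨j p, rfl⟩) (by
      intro h
      obtain ⟨p, hp, b, hb, h⟩ := key _ h
      have h2 : j (p + b * b) = 0 := by
        apply k.injective
        simp only [map_add, map_mul, ← h, map_zero]
        ring
      rw [hj0] at h2
      have h3 : -(b * b) ∈ P := by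
        have := hadd _ hp _ h2.2
        simpa using this
      have h4 : b * b ∈ I := ⟨hsq b, h3⟩
      exact (Ideal.IsPrime.mem_or_mem ‹I.IsPrime› h4).elim hb hb)
  let F : Λ →+* R := f.comp (k.rangeRestrictField.comp j)
  have hF : ∀ x ∈ P, 0 ≤ F x := by
    intro x hx
    exact hf _ ⟨x, hx, rfl⟩
  refine ⟨R, iF, iO, iS, F, hR, fun x => ⟨hF x, fun h => ?_⟩⟩
  rcases htot x with hx | hx
  · exact hx
  · have h3 := hF _ hx
    have h4 : F x = 0 := le_antisymm (by simpa using h3) h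
    have h5 : j x = 0 := (map_eq_zero (f.comp k.rangeRestrictField)).1 h4
    exact ((hI x).1 ((hj0 x).1 h5)).1

end RealClosure

section IntermediateValue

open Polynomial

/-- Polynomials over `R` satisfy the intermediate value property. -/
def PolynomialIVT (R : Type*) [Field R] [LinearOrder R] : Prop :=
  ∀ (p : R[X]) (a b : R), a < b → p.eval a * p.eval b < 0 → ∃ c, a < c ∧ c < b ∧ p.eval c = 0

variable {R : Type*} [Field R] [LinearOrder R]

theorem exists_reduced_weightedSquare (p : R[X]) (hp : 0 < p.natDegree) {s : R[X]}
    (hs : s ∈ weightedSquares R) :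
    ∃ t ∈ weightedSquares R, t.natDegree ≤ 2 * (p.natDegree - 1) ∧ p ∣ s - t := by
  induction hs using AddSubmonoid.closure_induction with
  | mem x hx =>
    obtain ⟨t, q, ht, rfl⟩ := hx
    refine ⟨C t * ((q % p) * (q % p)), AddSubmonoid.subset_closure ⟨t, q % p, ht, rfl⟩, ?_, ?_⟩
    · have h := natDegree_mod_lt q hp.ne'
      refine (natDegree_C_mul_le _ _).trans (natDegree_mul_le.trans ?_)
      omega
    · have h : q = p * (q / p) + q % p := (EuclideanDomain.div_add_mod q p).symm
      set r := q % p
      rw [h]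
      exact ⟨C t * (q / p) * (p * (q / p) + 2 * r), by ring⟩
  | zero => exact ⟨0, zero_mem _, by simp, by simp⟩
  | add a b _ _ ha hb =>
    obtain ⟨s, hs, hsd, hsp⟩ := ha
    obtain ⟨t, ht, htd, htp⟩ := hb
    exact ⟨s + t, add_mem hs ht, (natDegree_add_le _ _).trans (max_le hsd htd), by
      rw [add_sub_add_comm]; exact dvd_add hsp htp⟩

variable [IsStrictOrderedRing R]

theorem eval_weightedSquares_nonneg {s : R[X]} (hs : s ∈ weightedSquares R) (x : R) :
    0 ≤ s.eval x := by
  induction hs using AddSubmonoid.closure_induction with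
  | mem y hy =>
    obtain ⟨t, q, ht, rfl⟩ := hy
    simpa using mul_nonneg ht (mul_self_nonneg _)
  | zero => simp
  | add a b _ _ ha hb => rw [eval_add]; exact add_nonneg ha hb

theorem HasNoRealExtension.polynomialIVT (hR : HasNoRealExtension R) : PolynomialIVT R := by
  intro p
  induction hd : p.natDegree using Nat.strong_induction_on generalizing p with
  | _ d ih =>
  intro a b hab hlt
  have hp0 : p ≠ 0 := by
    rintro rfl
    simp at hlt
  have hpd : 0 < p.natDegree := by
    by_contra h
    rw [not_lt, Nat.le_zero] at h
    rw [eq_C_of_natDegree_eq_zero h] at hlt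
    simp only [eval_C] at hlt
    exact absurd hlt (not_lt.2 (mul_self_nonneg _))
  have hu : ¬ IsUnit p := fun h => by
    rw [natDegree_eq_zero_of_isUnit h] at hpd
    exact absurd hpd (lt_irrefl _)
  by_cases hirr : Irreducible p
  · by_cases h1 : p.natDegree = 1
    · obtain ⟨c, e, hce⟩ := exists_eq_X_add_C_of_natDegree_le_one h1.le
      have hc : c ≠ 0 := by
        rintro rfl
        rw [hce] at hpd
        simp at hpd
      rw [hce] at hlt ⊢
      simp only [eval_add, eval_mul, eval_C, eval_X] at hlt ⊢
      have h2 : c * a + e = c * (a - -e / c) := by field_simp; ring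
      have h3 : c * b + e = c * (b - -e / c) := by field_simp; ring
      rw [h2, h3] at hlt
      set r := -e / c with hr
      have h4 : (a - r) * (b - r) < 0 := by
        by_contra h
        push Not at h
        have := mul_nonneg (mul_self_nonneg c) h
        linarith
      refine ⟨r, ?_, ?_, ?_⟩
      · by_contra h
        push Not at h
        have := mul_nonneg (sub_nonneg.2 h) (sub_nonneg.2 (h.trans hab.le))
        linarith
      · by_contra h
        push Not at h
        have := mul_nonneg_of_nonpos_of_nonpos (sub_nonpos.2 (hab.le.trans h)) (sub_nonpos.2 h)
        linarith
      · rw [hr]; field_simp; ring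
    · obtain ⟨s, hs, hdvd⟩ := hR p hirr h1
      obtain ⟨t, ht, htd, hst⟩ := exists_reduced_weightedSquare p hpd hs
      have hdvd' : p ∣ 1 + t := by
        have := dvd_sub hdvd hst
        rwa [show 1 + s - (s - t) = 1 + t by ring] at this
      obtain ⟨h, hh⟩ := hdvd'
      have hpos : ∀ x, 0 < p.eval x * h.eval x := by
        intro x
        rw [← eval_mul, ← hh, eval_add, eval_one]
        have := eval_weightedSquares_nonneg ht x
        linarith
      have hh0 : h ≠ 0 := by
        rintro rfl
        simpa using hpos 0
      have hhd : h.natDegree < d := by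
        have h2 : (1 + t).natDegree ≤ 2 * (p.natDegree - 1) :=
          (natDegree_add_le _ _).trans (max_le (by simp) htd)
        rw [hh, natDegree_mul hp0 hh0] at h2
        omega
      obtain ⟨c, -, -, hc⟩ := ih _ hhd h rfl a b hab (by
        have := mul_pos (hpos a) (hpos b)
        by_contra hcon
        push Not at hcon
        nlinarith [mul_nonneg_of_nonpos_of_nonpos hlt.le (neg_nonpos.2 hcon)])
      have := hpos c
      rw [hc, mul_zero] at this
      exact absurd this (lt_irrefl _)
  · rw [irreducible_iff] at hirr
    push Not at hirr
    obtain ⟨q, r, hqr, hq, hr⟩ := hirr hu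
    have hq0 : q ≠ 0 := by rintro rfl; simp at hqr; exact hp0 hqr
    have hr0 : r ≠ 0 := by rintro rfl; simp at hqr; exact hp0 hqr
    have hdeg : p.natDegree = q.natDegree + r.natDegree := by rw [hqr, natDegree_mul hq0 hr0]
    have hqd : 0 < q.natDegree := Nat.pos_of_ne_zero fun h => hq (by
      rw [eq_C_of_natDegree_eq_zero h] at hq0 ⊢
      exact isUnit_C.2 (isUnit_iff_ne_zero.2 (by simpa using hq0)))
    have hrd : 0 < r.natDegree := Nat.pos_of_ne_zero fun h => hr (by
      rw [eq_C_of_natDegree_eq_zero h] at hr0 ⊢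
      exact isUnit_C.2 (isUnit_iff_ne_zero.2 (by simpa using hr0)))
    have hsign : q.eval a * q.eval b < 0 ∨ r.eval a * r.eval b < 0 := by
      by_contra hcon
      push Not at hcon
      have := mul_nonneg hcon.1 hcon.2
      rw [hqr, eval_mul, eval_mul] at hlt
      linarith [show q.eval a * r.eval a * (q.eval b * r.eval b) =
        q.eval a * q.eval b * (r.eval a * r.eval b) by ring]
    rcases hsign with h | h
    · obtain ⟨c, h1, h2, h3⟩ := ih _ (by omega) q rfl a b hab h
      exact ⟨c, h1, h2, by rw [hqr, eval_mul, h3, zero_mul]⟩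
    · obtain ⟨c, h1, h2, h3⟩ := ih _ (by omega) r rfl a b hab h
      exact ⟨c, h1, h2, by rw [hqr, eval_mul, h3, mul_zero]⟩

theorem PolynomialIVT.exists_sq (hR : PolynomialIVT R) {x : R} (hx : 0 ≤ x) :
    ∃ y, 0 ≤ y ∧ y * y = x := by
  rcases hx.eq_or_lt with rfl | hx
  · exact ⟨0, le_rfl, by simp⟩
  obtain ⟨c, h1, -, h3⟩ := hR (X * X - C x) 0 (1 + x) (by linarith) (by
    simp only [eval_sub, eval_mul, eval_X, eval_C]
    have : 0 < x * (1 + x + x * x) := by positivity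
    linarith)
  refine ⟨c, h1.le, ?_⟩
  simpa [sub_eq_zero] using h3

theorem PolynomialIVT.mul_pos_of_ne_zero (hR : PolynomialIVT R) {p : R[X]} {u v x y : R}
    (hp : ∀ x, u < x → x < v → p.eval x ≠ 0) (hux : u < x) (hxv : x < v) (huy : u < y)
    (hyv : y < v) : 0 < p.eval x * p.eval y := by
  by_contra hcon
  have hlt : p.eval x * p.eval y < 0 :=
    lt_of_le_of_ne (not_lt.1 hcon) (mul_ne_zero (hp x hux hxv) (hp y huy hyv))
  rcases lt_trichotomy x y with h | rfl | h
  · obtain ⟨c, h1, h2, h3⟩ := hR p x y h hlt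
    exact hp c (hux.trans h1) (h2.trans hyv) h3
  · exact absurd hlt (not_lt.2 (mul_self_nonneg _))
  · obtain ⟨c, h1, h2, h3⟩ := hR p y x h (by rwa [mul_comm])
    exact hp c (huy.trans h1) (h2.trans hxv) h3

theorem PolynomialIVT.rolle_zero (hR : PolynomialIVT R) {p : R[X]} {a b : R} (hab : a < b)
    (ha : p.eval a = 0) (hb : p.eval b = 0) : ∃ c, a < c ∧ c < b ∧ p.derivative.eval c = 0 := by
  classical
  by_cases hp : p = 0
  · obtain ⟨c, h1, h2⟩ := exists_between hab
    exact ⟨c, h1, h2, by simp [hp]⟩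
  set Z := p.roots.toFinset.filter (a < ·) with hZ
  have hmem : ∀ x, x ∈ Z ↔ p.eval x = 0 ∧ a < x := by
    intro x
    simp [hZ, hp]
  have hZne : Z.Nonempty := ⟨b, (hmem b).2 ⟨hb, hab⟩⟩
  obtain ⟨hc, hac⟩ := (hmem _).1 (Z.min'_mem hZne)
  have hmin : ∀ x ∈ Z, Z.min' hZne ≤ x := fun x hx => Z.min'_le x hx
  generalize Z.min' hZne = c at hc hac hmin
  have hcb : c ≤ b := hmin b ((hmem b).2 ⟨hb, hab⟩)
  obtain ⟨p₁, hp₁, hnd⟩ := exists_eq_pow_rootMultiplicity_mul_and_not_dvd p hp a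
  have hp₁0 : p₁ ≠ 0 := by rintro rfl; simp at hnd
  have hp₁a : p₁.eval a ≠ 0 := fun h => hnd (dvd_iff_isRoot.2 h)
  obtain ⟨q, hq, hnd'⟩ := exists_eq_pow_rootMultiplicity_mul_and_not_dvd p₁ hp₁0 c
  have hqc : q.eval c ≠ 0 := fun h => hnd' (dvd_iff_isRoot.2 h)
  have hqa : q.eval a ≠ 0 := fun h => hp₁a (by rw [hq, eval_mul, h, mul_zero])
  obtain ⟨m, hm⟩ : ∃ m, p.rootMultiplicity a = m + 1 :=
    Nat.exists_eq_succ_of_ne_zero ((rootMultiplicity_pos hp).2 ha).ne'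
  have hp₁c : p₁.eval c = 0 := by
    rw [hp₁, eval_mul, eval_pow, eval_sub, eval_X, eval_C] at hc
    exact (mul_eq_zero.1 hc).resolve_left (pow_ne_zero _ (sub_ne_zero.2 hac.ne'))
  obtain ⟨n, hn⟩ : ∃ n, p₁.rootMultiplicity c = n + 1 :=
    Nat.exists_eq_succ_of_ne_zero ((rootMultiplicity_pos hp₁0).2 hp₁c).ne'
  rw [hm] at hp₁
  rw [hn] at hq
  rw [hq] at hp₁
  have hqpos : 0 < q.eval a * q.eval c := by
    by_contra hcon
    obtain ⟨x, h1, h2, h3⟩ := hR q a c hac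
      (lt_of_le_of_ne (not_lt.1 hcon) (mul_ne_zero hqa hqc))
    exact absurd (hmin x ((hmem x).2 ⟨by rw [hp₁]; simp [h3], h1⟩)) (not_le.2 h2)
  set r : R[X] := (m + 1 : R[X]) * (X - C c) * q + (n + 1 : R[X]) * (X - C a) * q +
    (X - C a) * (X - C c) * q.derivative with hr
  have hder : p.derivative = (X - C a) ^ m * (X - C c) ^ n * r := by
    conv_lhs => rw [hp₁]
    simp only [derivative_mul, derivative_pow, derivative_sub, derivative_X, derivative_C, hr,
      Nat.add_sub_cancel, map_natCast]
    push_cast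
    ring
  obtain ⟨x, h1, h2, h3⟩ := hR r a c hac (by
    have h1 : r.eval a = -((m + 1) * (c - a) * q.eval a) := by simp [hr]; ring
    have h2 : r.eval c = (n + 1) * (c - a) * q.eval c := by simp [hr]
    rw [h1, h2]
    have h3 : (0 : R) < (m + 1) * (n + 1) * ((c - a) * (c - a)) * (q.eval a * q.eval c) := by
      have := sub_pos.2 hac
      positivity
    linarith)
  exact ⟨x, h1, h2.trans_le hcb, by rw [hder, eval_mul, h3, mul_zero]⟩

theorem PolynomialIVT.mean_value (hR : PolynomialIVT R) (p : R[X]) {a b : R} (hab : a < b) :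
    ∃ c, a < c ∧ c < b ∧ p.eval b - p.eval a = p.derivative.eval c * (b - a) := by
  have h0 : b - a ≠ 0 := sub_ne_zero.2 hab.ne'
  obtain ⟨c, h1, h2, h3⟩ := hR.rolle_zero
    (p := p - C (p.eval a) - C ((p.eval b - p.eval a) / (b - a)) * (X - C a)) hab
    (by simp) (by simp [h0])
  refine ⟨c, h1, h2, ?_⟩
  simp [sub_eq_zero] at h3
  rw [h3, div_mul_cancel₀ _ h0]

theorem PolynomialIVT.eval_lt_eval (hR : PolynomialIVT R) {p : R[X]} {u v x y : R}
    (hp : ∀ x, u < x → x < v → 0 < p.derivative.eval x) (hux : u ≤ x) (hxy : x < y)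
    (hyv : y ≤ v) : p.eval x < p.eval y := by
  obtain ⟨c, h1, h2, h3⟩ := hR.mean_value p hxy
  have := mul_pos (hp c (hux.trans_lt h1) (h2.trans_le hyv)) (sub_pos.2 hxy)
  linarith

theorem PolynomialIVT.mul_neg_of_root (hR : PolynomialIVT R) {p : R[X]} {u v z : R}
    (hp : ∀ x, u < x → x < v → p.derivative.eval x ≠ 0) (huz : u < z) (hzv : z < v)
    (hz : p.eval z = 0) : p.eval u * p.eval v < 0 := by
  obtain ⟨c, h1, h2, h3⟩ := hR.mean_value p huz
  obtain ⟨d, h4, h5, h6⟩ := hR.mean_value p hzv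
  have h7 := hR.mul_pos_of_ne_zero hp h1 (h2.trans hzv) (huz.trans h4) h5
  rw [hz] at h3 h6
  have h8 : p.eval u * p.eval v =
      -(p.derivative.eval c * p.derivative.eval d * ((z - u) * (v - z))) := by
    linear_combination (-p.eval v) * h3 - (p.derivative.eval c * (z - u)) * h6
  rw [h8, neg_lt_zero]
  exact mul_pos h7 (mul_pos (sub_pos.2 huz) (sub_pos.2 hzv))

theorem Real.polynomialIVT : PolynomialIVT ℝ := by
  intro p a b hab hlt
  have hcont : ContinuousOn (fun x => p.eval x) (Set.Icc a b) := p.continuous.continuousOn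
  rcases mul_neg_iff.1 hlt with ⟨h1, h2⟩ | ⟨h1, h2⟩
  · obtain ⟨c, hc, h⟩ := intermediate_value_Ioo' hab.le hcont ⟨h2, h1⟩
    exact ⟨c, hc.1, hc.2, h⟩
  · obtain ⟨c, hc, h⟩ := intermediate_value_Ioo hab.le hcont ⟨h1, h2⟩
    exact ⟨c, hc.1, hc.2, h⟩

section TwoFields

variable {F : Type*} [Field F] [LinearOrder F] [IsStrictOrderedRing F]

theorem sign_eval_eq_of_derivative_pos (hR : PolynomialIVT R) (hF : PolynomialIVT F)
    {p : R[X]} {q : F[X]} {u v : R} {u' v' : F}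
    (hq : ∀ x, u' < x → x < v' → 0 < q.derivative.eval x)
    (hu : SignType.sign (p.eval u) = SignType.sign (q.eval u'))
    (hv : SignType.sign (p.eval v) = SignType.sign (q.eval v'))
    (hp0 : ∀ x, u < x → x < v → p.eval x ≠ 0) {x : R} {x' : F} (hux : u < x) (hxv : x < v)
    (hux' : u' < x') (hxv' : x' < v') :
    SignType.sign (p.eval x) = SignType.sign (q.eval x') := by
  rcases (hp0 x hux hxv).lt_or_gt with h | h
  · have h1 : p.eval v ≤ 0 := by
      by_contra hcon
      obtain ⟨c, h1, h2, h3⟩ := hR p x v hxv (mul_neg_of_neg_of_pos h (not_le.1 hcon))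
      exact hp0 c (hux.trans h1) h2 h3
    have h2 : q.eval v' ≤ 0 := by
      rw [← sign_nonpos_iff, ← hv, sign_nonpos_iff]
      exact h1
    have h3 := (hF.eval_lt_eval hq hux'.le hxv' le_rfl).trans_le h2
    rw [sign_neg h, sign_neg h3]
  · have h1 : 0 ≤ p.eval u := by
      by_contra hcon
      obtain ⟨c, h1, h2, h3⟩ := hR p u x hux (mul_neg_of_neg_of_pos (not_le.1 hcon) h)
      exact hp0 c h1 (h2.trans hxv) h3
    have h2 : 0 ≤ q.eval u' := by
      rw [← sign_nonneg_iff, ← hu, sign_nonneg_iff]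
      exact h1
    have h3 := h2.trans_lt (hF.eval_lt_eval hq le_rfl hux' hxv'.le)
    rw [sign_pos h, sign_pos h3]

/-- Thom-type lemma: polynomials whose derivatives have matching signs at the end points of
intervals, the first ones having no roots inside, have matching signs on the intervals. -/
theorem sign_eval_eq_of_derivatives (hR : PolynomialIVT R) (hF : PolynomialIVT F)
    {u v : R} {u' v' : F} (huv : u < v) (p : R[X]) (q : F[X])
    (hu : ∀ k, SignType.sign ((derivative^[k] p).eval u) =
      SignType.sign ((derivative^[k] q).eval u'))
    (hv : ∀ k, SignType.sign ((derivative^[k] p).eval v) =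
      SignType.sign ((derivative^[k] q).eval v'))
    (h0 : ∀ k, derivative^[k] p = 0 → derivative^[k] q = 0)
    (hp : ∀ k, derivative^[k] p ≠ 0 → ∀ x, u < x → x < v → (derivative^[k] p).eval x ≠ 0)
    {x : R} {x' : F} (hux : u < x) (hxv : x < v) (hux' : u' < x') (hxv' : x' < v') :
    SignType.sign (p.eval x) = SignType.sign (q.eval x') := by
  induction hd : p.natDegree using Nat.strong_induction_on generalizing p q x x' with
  | _ d ih =>
  by_cases hd0 : d = 0
  · have hpd : p.natDegree = 0 := hd.trans hd0
    have h1 : derivative^[1] p = 0 := by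
      rw [Function.iterate_one, eq_C_of_natDegree_eq_zero hpd, derivative_C]
    have h2 := h0 1 h1
    rw [Function.iterate_one] at h2
    have h3 := derivative_eq_zero.1 h2
    have h4 := hu 0
    simp only [Function.iterate_zero, id] at h4
    rw [eq_C_of_natDegree_eq_zero hpd, eq_C_of_natDegree_eq_zero h3] at h4 ⊢
    simpa using h4
  have hp'0 : p.derivative ≠ 0 := fun h =>
    hd0 (hd ▸ derivative_eq_zero.1 h)
  have hp0 : p ≠ 0 := by rintro rfl; simp at hp'0
  have key : ∀ y y', u < y → y < v → u' < y' → y' < v' →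
      SignType.sign (p.derivative.eval y) = SignType.sign (q.derivative.eval y') := by
    intro y y' h1 h2 h3 h4
    exact ih _ (hd ▸ natDegree_derivative_lt (hd ▸ hd0)) p.derivative q.derivative
      (fun k => by simpa using hu (k + 1)) (fun k => by simpa using hv (k + 1))
      (fun k => by simpa using h0 (k + 1)) (fun k => by simpa using hp (k + 1)) h1 h2 h3 h4 rfl
  have hp'ne : ∀ x, u < x → x < v → p.derivative.eval x ≠ 0 := by simpa using hp 1 hp'0
  obtain ⟨y, hy1, hy2⟩ := exists_between huv
  have hpne : ∀ x, u < x → x < v → p.eval x ≠ 0 := hp 0 hp0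
  have hu0 := hu 0
  have hv0 := hv 0
  simp only [Function.iterate_zero, id] at hu0 hv0
  rcases (hp'ne y hy1 hy2).lt_or_gt with h | h
  · have h1 : ∀ x, u < x → x < v → p.derivative.eval x < 0 := fun x h1 h2 =>
      neg_of_mul_pos_right (hR.mul_pos_of_ne_zero hp'ne hy1 hy2 h1 h2) h.le
    have h2 : ∀ x, u' < x → x < v' → q.derivative.eval x < 0 := fun x h1 h2 => by
      rw [← sign_eq_neg_one_iff, ← key y x hy1 hy2 h1 h2, sign_neg h]
    have := sign_eval_eq_of_derivative_pos hR hF (p := -p) (q := -q) (u := u) (v := v)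
      (u' := u') (v' := v') (x := x) (x' := x') (by simpa using h2)
      (by simpa [Left.sign_neg] using hu0) (by simpa [Left.sign_neg] using hv0)
      (by simpa using hpne) hux hxv hux' hxv'
    simpa [Left.sign_neg] using this
  · have h1 : ∀ x, u < x → x < v → 0 < p.derivative.eval x := fun x h1 h2 =>
      pos_of_mul_pos_right (hR.mul_pos_of_ne_zero hp'ne hy1 hy2 h1 h2) h.le
    have h2 : ∀ x, u' < x → x < v' → 0 < q.derivative.eval x := fun x h1 h2 => by
      rw [← sign_eq_one_iff, ← key y x hy1 hy2 h1 h2, sign_pos h]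
    exact sign_eval_eq_of_derivative_pos hR hF h2 hu0 hv0 hpne hux hxv hux' hxv'

end TwoFields

end IntermediateValue

section Specialization

open Polynomial

/-- Extend a tuple by one element. -/
def consOption {ι F : Type} (z : F) (l : ι → F) : Option ι → F := fun o => o.elim z l

@[simp] theorem consOption_none {ι F : Type} (z : F) (l : ι → F) : consOption z l none = z := rfl

@[simp] theorem consOption_some {ι F : Type} (z : F) (l : ι → F) (i : ι) :
    consOption z l (some i) = l i := rfl

@[simp] theorem consOption_comp_some {ι F : Type} (z : F) (l : ι → F) :
    consOption z l ∘ some = l := rfl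

variable {ι κ F R : Type} [Field F] [Algebra ℝ F] [Field R] [Algebra ℝ R]

/-- Evaluation of real polynomials at a tuple of elements of an `ℝ`-field. -/
def evalHom (l : ι → F) : MvPolynomial ι ℝ →+* F :=
  MvPolynomial.eval₂Hom (algebraMap ℝ F) l

@[simp] theorem evalHom_C (l : ι → F) (r : ℝ) : evalHom l (MvPolynomial.C r) = algebraMap ℝ F r := by
  simp [evalHom]

@[simp] theorem evalHom_X (l : ι → F) (i : ι) : evalHom l (MvPolynomial.X i) = l i := by
  simp [evalHom]

theorem evalHom_rename (k : ι → κ) (l : κ → F) (p : MvPolynomial ι ℝ) :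
    evalHom l (MvPolynomial.rename k p) = evalHom (l ∘ k) p := by
  simp [evalHom, MvPolynomial.eval₂_rename]

theorem evalHom_bind₁ (f : ι → MvPolynomial κ ℝ) (l : κ → F) (p : MvPolynomial ι ℝ) :
    evalHom l (MvPolynomial.bind₁ f p) = evalHom (fun i => evalHom l (f i)) p := by
  induction p using MvPolynomial.induction_on with
  | C a => simp
  | add p q hp hq => simp [hp, hq]
  | mul_X p i hp => simp [hp]

theorem evalHom_option (l : Option ι → F) (p : MvPolynomial (Option ι) ℝ) :
    evalHom l p =
      ((MvPolynomial.optionEquivLeft ℝ ι p).map (evalHom (l ∘ some))).eval (l none) := by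
  induction p using MvPolynomial.induction_on with
  | C a => simp
  | add p q hp hq => simp [hp, hq]
  | mul_X p i hp =>
    rw [map_mul, map_mul, Polynomial.map_mul, eval_mul, hp]
    cases i <;> simp

theorem evalHom_option_symm (l : Option ι → F) (g : (MvPolynomial ι ℝ)[X]) :
    evalHom l ((MvPolynomial.optionEquivLeft ℝ ι).symm g) =
      (g.map (evalHom (l ∘ some))).eval (l none) := by
  rw [evalHom_option, AlgEquiv.apply_symm_apply]


/-- Any finite set of sign conditions on real polynomials holding at `l` holds at a real point. -/
def RealSpecializable [LinearOrder R] (l : ι → R) : Prop :=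
  ∀ s : Finset (MvPolynomial ι ℝ), ∃ c : ι → ℝ,
    ∀ p ∈ s, SignType.sign (evalHom c p) = SignType.sign (evalHom l p)

theorem RealSpecializable.of_polynomial [LinearOrder R] {l : κ → R} (hl : RealSpecializable l) {l' : ι → R}
    (f : ι → MvPolynomial κ ℝ) (hf : ∀ i, l' i = evalHom l (f i)) : RealSpecializable l' := by
  classical
  intro s
  obtain ⟨c, hc⟩ := hl (s.image (MvPolynomial.bind₁ f))
  refine ⟨fun i => evalHom c (f i), fun p hp => ?_⟩
  have := hc _ (Finset.mem_image_of_mem _ hp)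
  rwa [evalHom_bind₁, evalHom_bind₁, ← funext hf] at this

theorem realSpecializable_consOption [LinearOrder R] {l : ι → R} {z : R}
    (h : ∀ s : Finset (MvPolynomial ι ℝ)[X], ∃ (c : ι → ℝ) (ζ : ℝ), ∀ g ∈ s,
      SignType.sign ((g.map (evalHom c)).eval ζ) = SignType.sign ((g.map (evalHom l)).eval z)) :
    RealSpecializable (consOption z l) := by
  classical
  intro s
  obtain ⟨c, ζ, hc⟩ := h (s.image (MvPolynomial.optionEquivLeft ℝ ι))
  refine ⟨consOption ζ c, fun p hp => ?_⟩
  have := hc _ (Finset.mem_image_of_mem _ hp)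
  rwa [evalHom_option, evalHom_option]

theorem RealSpecializable.exists_interval [LinearOrder R] [IsStrictOrderedRing R] {l : ι → R} {u v : R} (huv : u < v)
    (h : RealSpecializable (consOption v (consOption u l))) (s : Finset (MvPolynomial ι ℝ)[X]) :
    ∃ (c : ι → ℝ) (u' v' : ℝ), u' < v' ∧ ∀ g ∈ s,
      (∀ i, SignType.sign (evalHom c (g.coeff i)) = SignType.sign (evalHom l (g.coeff i))) ∧
      SignType.sign ((g.map (evalHom c)).eval u') = SignType.sign ((g.map (evalHom l)).eval u) ∧
      SignType.sign ((g.map (evalHom c)).eval v') =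
        SignType.sign ((g.map (evalHom l)).eval v) := by
  classical
  let e := (MvPolynomial.optionEquivLeft ℝ ι).symm
  let t₁ := s.image fun g => MvPolynomial.rename some (e g)
  let t₂ := s.image fun g => MvPolynomial.rename (Option.map some) (e g)
  let t₃ := s.biUnion fun g =>
    (Finset.range (g.natDegree + 1)).image fun i => MvPolynomial.rename (some ∘ some) (g.coeff i)
  obtain ⟨c, hc⟩ := h (({MvPolynomial.X none - MvPolynomial.X (some none)} ∪ t₁) ∪ (t₂ ∪ t₃))
  refine ⟨c ∘ some ∘ some, c (some none), c none, ?_, fun g hg => ⟨fun i => ?_, ?_, ?_⟩⟩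
  · have := hc (MvPolynomial.X none - MvPolynomial.X (some none)) (by simp)
    simp only [map_sub, evalHom_X, consOption_none, consOption_some] at this
    rw [sign_pos (sub_pos.2 huv), sign_eq_one_iff] at this
    exact sub_pos.1 this
  · by_cases hi : i ≤ g.natDegree
    · have := hc (MvPolynomial.rename (some ∘ some) (g.coeff i))
        (Finset.mem_union_right _ (Finset.mem_union_right _ (Finset.mem_biUnion.2
          ⟨g, hg, Finset.mem_image.2 ⟨i, Finset.mem_range.2 (Nat.lt_succ_of_le hi), rfl⟩⟩)))
      rw [evalHom_rename, evalHom_rename] at this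
      exact this
    · rw [coeff_eq_zero_of_natDegree_lt (not_le.1 hi)]
      simp
  · have := hc (MvPolynomial.rename some (e g))
      (Finset.mem_union_left _ (Finset.mem_union_right _ (Finset.mem_image_of_mem _ hg)))
    rw [evalHom_rename, evalHom_rename, evalHom_option_symm, evalHom_option_symm] at this
    exact this
  · have := hc (MvPolynomial.rename (Option.map some) (e g))
      (Finset.mem_union_right _ (Finset.mem_union_left _ (Finset.mem_image_of_mem _ hg)))
    rw [evalHom_rename, evalHom_rename, evalHom_option_symm, evalHom_option_symm] at this
    exact this

/-- The element `z` is a root of a polynomial of degree at most `m` over the tuple `l`. -/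
def IsRootOver (l : ι → R) (m : ℕ) (z : R) : Prop :=
  ∃ f : (MvPolynomial ι ℝ)[X], f.natDegree ≤ m ∧ f.map (evalHom l) ≠ 0 ∧
    (f.map (evalHom l)).eval z = 0

theorem IsRootOver.consOption {l : ι → R} {m : ℕ} {z : R} (h : IsRootOver l m z) (u : R) :
    IsRootOver (consOption u l) m z := by
  obtain ⟨f, hf, h1, h2⟩ := h
  have h3 : (f.map (MvPolynomial.rename some : MvPolynomial ι ℝ →ₐ[ℝ] _).toRingHom).map
      (evalHom (_root_.consOption u l)) = f.map (evalHom l) := by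
    rw [Polynomial.map_map]
    congr 1
    ext x
    · simp
    · simp
  exact ⟨_, natDegree_map_le.trans hf, by rwa [h3], by rwa [h3]⟩

theorem exists_pseudo_remainder {A : Type*} [CommRing A] [IsDomain A] (f : A[X])
    (hf : 0 < f.natDegree) (g : A[X]) :
    ∃ (e : ℕ) (q r : A[X]), C (f.leadingCoeff ^ (2 * e)) * g = q * f + r ∧
      r.natDegree < f.natDegree := by
  induction hd : g.natDegree using Nat.strong_induction_on generalizing g with
  | _ d ih =>
  by_cases hlt : d < f.natDegree
  · exact ⟨0, 0, g, by simp, hd ▸ hlt⟩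
  push Not at hlt
  have hg0 : g ≠ 0 := by
    rintro rfl
    simp at hd
    omega
  have hf0 : f ≠ 0 := by
    rintro rfl
    simp at hf
  set a := f.leadingCoeff with ha
  have ha0 : a ≠ 0 := leadingCoeff_ne_zero.2 hf0
  set g' := C (a ^ 2) * g - C (a * g.leadingCoeff) * X ^ (d - f.natDegree) * f with hg'
  have hdeg1 : (C (a ^ 2) * g).degree = d := by
    rw [degree_C_mul (pow_ne_zero _ ha0), degree_eq_natDegree hg0, hd]
  have hglc : g.leadingCoeff ≠ 0 := leadingCoeff_ne_zero.2 hg0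
  have hlt' : g'.degree < d := by
    rw [← hdeg1]
    refine degree_sub_lt_left ?_ (mul_ne_zero (C_ne_zero.2 (pow_ne_zero _ ha0)) hg0) ?_
    · rw [hdeg1, degree_mul, degree_C_mul_X_pow _ (mul_ne_zero ha0 hglc), degree_eq_natDegree hf0]
      norm_cast
      omega
    · rw [leadingCoeff_mul, leadingCoeff_mul, leadingCoeff_mul, leadingCoeff_C, leadingCoeff_C,
        leadingCoeff_X_pow, ← ha]
      ring
  have hnd : g'.natDegree < d := by
    by_cases h0 : g' = 0
    · rw [h0, natDegree_zero]
      omega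
    · rwa [degree_eq_natDegree h0, Nat.cast_lt] at hlt'
  obtain ⟨e, q, r, h1, h2⟩ := ih _ hnd g' rfl
  refine ⟨e + 1, q + C (a ^ (2 * e)) * C (a * g.leadingCoeff) * X ^ (d - f.natDegree), r, ?_, h2⟩
  rw [add_mul, add_assoc, add_comm _ r, ← add_assoc, ← h1, hg', mul_add, pow_add]
  simp only [C_mul, C_pow]
  ring

end Specialization

section AlgebraicStep

open Polynomial

theorem abs_root_le {R : Type*} [Field R] [LinearOrder R] [IsStrictOrderedRing R] {p : R[X]}
    (hp : 0 < p.natDegree) {z : R} (hz : p.eval z = 0) :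
    |z| ≤ 1 + ∑ i ∈ Finset.range p.natDegree, |p.coeff i / p.leadingCoeff| := by
  set S := ∑ i ∈ Finset.range p.natDegree, |p.coeff i / p.leadingCoeff| with hS
  by_contra hcon
  push Not at hcon
  have hS0 : 0 ≤ S := Finset.sum_nonneg fun _ _ => abs_nonneg _
  have hz1 : 1 < |z| := by linarith
  have hlc : p.leadingCoeff ≠ 0 := leadingCoeff_ne_zero.2 (by rintro rfl; simp at hp)
  obtain ⟨m, hm⟩ := Nat.exists_eq_succ_of_ne_zero hp.ne'
  rw [eval_eq_sum_range, Finset.sum_range_succ] at hz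
  have h1 : z ^ p.natDegree = -∑ i ∈ Finset.range p.natDegree,
      p.coeff i / p.leadingCoeff * z ^ i := by
    have : ∑ i ∈ Finset.range p.natDegree, p.coeff i / p.leadingCoeff * z ^ i =
        (∑ i ∈ Finset.range p.natDegree, p.coeff i * z ^ i) / p.leadingCoeff := by
      rw [Finset.sum_div]
      exact Finset.sum_congr rfl fun i _ => by ring
    rw [this, eq_neg_of_add_eq_zero_left hz]
    rw [coeff_natDegree]
    field_simp
  have h2 : |z| ^ p.natDegree ≤ S * |z| ^ m := by
    rw [← abs_pow, h1, abs_neg, hS, Finset.sum_mul]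
    refine (Finset.abs_sum_le_sum_abs _ _).trans (Finset.sum_le_sum fun i hi => ?_)
    rw [abs_mul, abs_pow]
    refine mul_le_mul_of_nonneg_left (pow_le_pow_right₀ hz1.le ?_) (abs_nonneg _)
    have := Finset.mem_range.1 hi
    omega
  rw [hm, pow_succ, mul_comm] at h2
  have := le_of_mul_le_mul_right h2 (pow_pos (zero_lt_one.trans hz1) m)
  linarith

theorem sign_eval_eq_of_pseudo_remainder {F : Type*} [Field F] [LinearOrder F]
    [IsStrictOrderedRing F] {A : Type*} [CommRing A] (φ : A →+* F) {a : A} {e : ℕ}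
    {f g q r : A[X]} (h : C (a ^ (2 * e)) * g = q * f + r) (ha : φ a ≠ 0) {z : F}
    (hz : (f.map φ).eval z = 0) :
    SignType.sign ((g.map φ).eval z) = SignType.sign ((r.map φ).eval z) := by
  have h1 := congrArg (fun p => (p.map φ).eval z) h
  simp only [Polynomial.map_mul, Polynomial.map_add, map_C, eval_mul, eval_add, eval_C, hz,
    mul_zero, zero_add] at h1
  rw [← h1, sign_mul, map_pow, pow_mul, sign_pos (pow_pos (pow_two_pos_of_ne_zero ha) e), one_mul]

/-- Separating an element from a finite set not containing it by consecutive elements. -/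
theorem exists_consecutive {R : Type*} [LinearOrder R] {Z : Finset R} {z a b : R} (hz : z ∉ Z)
    (ha : a ∈ Z) (hb : b ∈ Z) (haz : a < z) (hzb : z < b) :
    ∃ u ∈ Z, ∃ v ∈ Z, u < z ∧ z < v ∧ ∀ x ∈ Z, ¬(u < x ∧ x < v) := by
  have h1 : (Z.filter (· < z)).Nonempty := ⟨a, by simp [ha, haz]⟩
  have h2 : (Z.filter (z < ·)).Nonempty := ⟨b, by simp [hb, hzb]⟩
  obtain ⟨hu, huz⟩ := Finset.mem_filter.1 (Finset.max'_mem _ h1)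
  obtain ⟨hv, hvz⟩ := Finset.mem_filter.1 (Finset.min'_mem _ h2)
  refine ⟨_, hu, _, hv, huz, hvz, fun x hx h => ?_⟩
  rcases lt_trichotomy x z with h3 | rfl | h3
  · exact absurd (Finset.le_max' _ x (by simp [hx, h3])) (not_le.2 h.1)
  · exact hz hx
  · exact absurd (Finset.min'_le _ x (by simp [hx, h3])) (not_le.2 h.2)

variable {ι R : Type} [Field R] [Algebra ℝ R]

theorem IsRootOver.mono {l : ι → R} {m k : ℕ} {z : R} (h : IsRootOver l m z) (hmk : m ≤ k) :
    IsRootOver l k z := by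
  obtain ⟨f, hf, h⟩ := h
  exact ⟨f, hf.trans hmk, h⟩

theorem isRootOver_one_of_mul_eq {l : ι → R} {a b : MvPolynomial ι ℝ} (ha : evalHom l a ≠ 0)
    {w : R} (h : evalHom l a * w = evalHom l b) : IsRootOver l 1 w := by
  refine ⟨C a * X - C b, ?_, ?_, ?_⟩
  · compute_degree
  · intro h0
    have := congrArg (fun p => coeff p 1) h0
    simp [coeff_C] at this
    exact ha this
  · simp [h]

theorem exists_bound_isRootOver [LinearOrder R] [IsStrictOrderedRing R] {l : ι → R} {z : R}
    {f : (MvPolynomial ι ℝ)[X]} (hf : 0 < f.natDegree) (hlc : evalHom l f.leadingCoeff ≠ 0)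
    (hz : (f.map (evalHom l)).eval z = 0) :
    ∃ w, IsRootOver l 1 w ∧ IsRootOver l 1 (-w) ∧ |z| < w := by
  have hdeg : (f.map (evalHom l)).natDegree = f.natDegree :=
    natDegree_map_of_leadingCoeff_ne_zero _ hlc
  have hlc' : (f.map (evalHom l)).leadingCoeff = evalHom l f.leadingCoeff := by
    rw [leadingCoeff, hdeg, coeff_map]
    rfl
  have hle := abs_root_le (hdeg.symm ▸ hf) hz
  rw [hdeg, hlc'] at hle
  have hb : ∀ i, ∃ b, evalHom l f.leadingCoeff *
      |(f.map (evalHom l)).coeff i / evalHom l f.leadingCoeff| = evalHom l b := by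
    intro i
    rcases abs_choice ((f.map (evalHom l)).coeff i / evalHom l f.leadingCoeff) with h | h
    · exact ⟨f.coeff i, by rw [h, coeff_map]; field_simp⟩
    · exact ⟨-f.coeff i, by rw [h, coeff_map, map_neg]; field_simp⟩
  choose b hb using hb
  have key : evalHom l f.leadingCoeff * (2 + ∑ i ∈ Finset.range f.natDegree,
      |(f.map (evalHom l)).coeff i / evalHom l f.leadingCoeff|) =
      evalHom l (2 * f.leadingCoeff + ∑ i ∈ Finset.range f.natDegree, b i) := by
    rw [mul_add, Finset.mul_sum, map_add, map_sum, map_mul, map_ofNat, mul_comm]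
    congr 1
    exact Finset.sum_congr rfl fun i _ => hb i
  refine ⟨_, isRootOver_one_of_mul_eq hlc key, isRootOver_one_of_mul_eq hlc (by
    rw [mul_neg, key, ← map_neg]), by linarith⟩

variable [LinearOrder R] [IsStrictOrderedRing R]

theorem RealSpecializable.consOption_linear {l : ι → R}
    (hl : RealSpecializable l) {z : R} {f : (MvPolynomial ι ℝ)[X]} (hf : f.natDegree = 1)
    (hlc : evalHom l f.leadingCoeff ≠ 0) (hz : (f.map (evalHom l)).eval z = 0) :
    RealSpecializable (consOption z l) := by
  classical
  refine realSpecializable_consOption fun s => ?_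
  choose e q r hr hrd using fun g => exists_pseudo_remainder f (by omega) g
  have hlin : ∀ {K : Type} [Field K] [Algebra ℝ K] (c : ι → K) (x : K),
      (f.map (evalHom c)).eval x = evalHom c f.leadingCoeff * x + evalHom c (f.coeff 0) := by
    intro K _ _ c x
    have h := eq_X_add_C_of_natDegree_le_one hf.le
    conv_lhs => rw [h]
    rw [leadingCoeff, hf]
    simp
  have hconst : ∀ {K : Type} [Field K] [Algebra ℝ K] (c : ι → K) (x : K) g,
      ((r g).map (evalHom c)).eval x = evalHom c ((r g).coeff 0) := by
    intro K _ _ c x g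
    have h : (r g).natDegree = 0 := by
      have := hrd g
      omega
    conv_lhs => rw [eq_C_of_natDegree_eq_zero h]
    simp
  obtain ⟨c, hc⟩ := hl ({f.leadingCoeff} ∪ s.image fun g => (r g).coeff 0)
  have hlcc : evalHom c f.leadingCoeff ≠ 0 := by
    rw [← sign_ne_zero, hc _ (by simp), sign_ne_zero]
    exact hlc
  have hζ : (f.map (evalHom c)).eval (-evalHom c (f.coeff 0) / evalHom c f.leadingCoeff) = 0 := by
    rw [hlin]
    field_simp
    ring
  refine ⟨c, -evalHom c (f.coeff 0) / evalHom c f.leadingCoeff, fun g hg => ?_⟩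
  rw [sign_eval_eq_of_pseudo_remainder _ (hr g) hlcc hζ,
    sign_eval_eq_of_pseudo_remainder _ (hr g) hlc hz, hconst, hconst]
  exact hc _ (Finset.mem_union_right _ (Finset.mem_image_of_mem _ hg))

theorem sign_eval_eq_of_exists_interval (hR : PolynomialIVT R) {l : ι → R} {c : ι → ℝ} {u v : R}
    {u' v' : ℝ} (huv : u < v) (p : (MvPolynomial ι ℝ)[X])
    (h : ∀ k ≤ p.natDegree,
      (∀ i, SignType.sign (evalHom c ((derivative^[k] p).coeff i)) =
        SignType.sign (evalHom l ((derivative^[k] p).coeff i))) ∧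
      SignType.sign (((derivative^[k] p).map (evalHom c)).eval u') =
        SignType.sign (((derivative^[k] p).map (evalHom l)).eval u) ∧
      SignType.sign (((derivative^[k] p).map (evalHom c)).eval v') =
        SignType.sign (((derivative^[k] p).map (evalHom l)).eval v))
    (h0 : ∀ k ≤ p.natDegree, (derivative^[k] p).map (evalHom l) ≠ 0 →
      ∀ x, u < x → x < v → ((derivative^[k] p).map (evalHom l)).eval x ≠ 0)
    {x : R} {x' : ℝ} (hux : u < x) (hxv : x < v) (hux' : u' < x') (hxv' : x' < v') :
    SignType.sign ((p.map (evalHom c)).eval x') = SignType.sign ((p.map (evalHom l)).eval x) := by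
  have hbig : ∀ k, ¬ k ≤ p.natDegree → derivative^[k] p = 0 := fun k hk =>
    iterate_derivative_eq_zero (not_le.1 hk)
  refine (sign_eval_eq_of_derivatives hR Real.polynomialIVT huv (p.map (evalHom l))
    (p.map (evalHom c)) (fun k => ?_) (fun k => ?_) (fun k hk => ?_) (fun k => ?_)
    hux hxv hux' hxv').symm <;>
  simp only [iterate_derivative_map] at *
  · by_cases hk : k ≤ p.natDegree
    · exact (h k hk).2.1.symm
    · simp [hbig k hk]
  · by_cases hk : k ≤ p.natDegree
    · exact (h k hk).2.2.symm
    · simp [hbig k hk]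
  · by_cases hkd : k ≤ p.natDegree
    · ext i
      have h1 := congrArg (fun q => coeff q i) hk
      simp only [coeff_map, coeff_zero] at h1 ⊢
      rw [← sign_eq_zero_iff, (h k hkd).1 i, h1, sign_zero]
    · simp [hbig k hkd]
  · by_cases hk : k ≤ p.natDegree
    · exact h0 k hk
    · simp [hbig k hk]

theorem RealSpecializable.consOption_of_isRootOver (hR : PolynomialIVT R) (m : ℕ) {ι : Type}
    {l : ι → R} (hl : RealSpecializable l) {z : R} (hz : IsRootOver l m z) :
    RealSpecializable (consOption z l) := by
  classical
  induction m using Nat.strong_induction_on generalizing ι z with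
  | _ m ih =>
  by_cases hmin : ∃ k < m, IsRootOver l k z
  · obtain ⟨k, hk, h⟩ := hmin
    exact ih k hk hl h
  push Not at hmin
  obtain ⟨f, hfm, hf0, hfz⟩ := hz
  have hfm' : f.natDegree = m := by
    by_contra h
    exact hmin _ (lt_of_le_of_ne hfm h) ⟨f, le_rfl, hf0, hfz⟩
  have hfpos : 0 < f.natDegree := by
    by_contra h
    rw [not_lt, Nat.le_zero] at h
    rw [eq_C_of_natDegree_eq_zero h] at hf0 hfz
    simp only [map_C, eval_C] at hfz
    simp [hfz] at hf0
  have hlc : evalHom l f.leadingCoeff ≠ 0 := by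
    intro h
    have h1 : f.eraseLead.map (evalHom l) = f.map (evalHom l) := by
      have h2 := congrArg (Polynomial.map (evalHom l)) f.eraseLead_add_C_mul_X_pow
      rwa [Polynomial.map_add, Polynomial.map_mul, map_C, h, C_0, zero_mul, add_zero] at h2
    exact hmin _ (by have := f.eraseLead_natDegree_le; omega)
      ⟨f.eraseLead, f.eraseLead_natDegree_le, by rwa [h1], by rwa [h1]⟩
  by_cases hm1 : m = 1
  · exact hl.consOption_linear (hfm'.trans hm1) hlc hfz
  refine realSpecializable_consOption fun s => ?_
  choose e q r hr hrd using fun g => exists_pseudo_remainder f hfpos g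
  have hsmall : ∀ (p : (MvPolynomial ι ℝ)[X]) (x : R), p.natDegree < m →
      p.map (evalHom l) ≠ 0 → (p.map (evalHom l)).eval x = 0 → IsRootOver l (m - 1) x :=
    fun p x h1 h2 h3 => ⟨p, by omega, h2, h3⟩
  let G := (insert (derivative f) (s.image r)).biUnion fun p =>
    (Finset.range m).image fun k => derivative^[k] p
  have hGd : ∀ p ∈ G, p.natDegree < m := by
    intro p hp
    obtain ⟨p', hp', h⟩ := Finset.mem_biUnion.1 hp
    obtain ⟨k, -, rfl⟩ := Finset.mem_image.1 h
    refine ((natDegree_iterate_derivative _ _).trans (Nat.sub_le _ _)).trans_lt ?_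
    rcases Finset.mem_insert.1 hp' with rfl | hp'
    · exact (natDegree_derivative_lt hfpos.ne').trans_le hfm
    · obtain ⟨g, -, rfl⟩ := Finset.mem_image.1 hp'
      exact (hrd g).trans_le hfm
  have hGr : ∀ g ∈ s, ∀ k ≤ (r g).natDegree, derivative^[k] (r g) ∈ G := by
    intro g hg k hk
    refine Finset.mem_biUnion.2 ⟨r g, Finset.mem_insert_of_mem (Finset.mem_image_of_mem _ hg),
      Finset.mem_image.2 ⟨k, Finset.mem_range.2 ?_, rfl⟩⟩
    have := hrd g
    omega
  have hGf : derivative f ∈ G :=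
    Finset.mem_biUnion.2 ⟨_, Finset.mem_insert_self _ _, Finset.mem_image.2
      ⟨0, Finset.mem_range.2 (by omega), rfl⟩⟩
  obtain ⟨w, hw1, hw2, hzw⟩ := exists_bound_isRootOver hfpos hlc hfz
  let Z := {w, -w} ∪ G.biUnion fun p => (p.map (evalHom l)).roots.toFinset
  have hZroot : ∀ p ∈ G, p.map (evalHom l) ≠ 0 → ∀ x, (p.map (evalHom l)).eval x = 0 → x ∈ Z := by
    intro p hp h0 x hx
    refine Finset.mem_union_right _ (Finset.mem_biUnion.2 ⟨p, hp, ?_⟩)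
    simp [h0, hx]
  have hZalg : ∀ x ∈ Z, IsRootOver l (m - 1) x := by
    intro x hx
    rcases Finset.mem_union.1 hx with hx | hx
    · simp only [Finset.mem_insert, Finset.mem_singleton] at hx
      rcases hx with rfl | rfl
      · exact hw1.mono (by omega)
      · exact hw2.mono (by omega)
    · obtain ⟨p, hp, hx⟩ := Finset.mem_biUnion.1 hx
      simp only [Multiset.mem_toFinset, mem_roots', IsRoot.def] at hx
      exact hsmall p x (hGd p hp) hx.1 hx.2
  obtain ⟨u, hu, v, hv, huz, hzv, huv⟩ := exists_consecutive (Z := Z) (z := z) (a := -w) (b := w)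
    (fun h => hmin _ (by omega) (hZalg z h)) (by simp [Z]) (by simp [Z])
    (neg_lt.1 ((neg_le_abs z).trans_lt hzw)) ((le_abs_self z).trans_lt hzw)
  have hsp := ih (m - 1) (by omega) (ih (m - 1) (by omega) hl (hZalg u hu))
    ((hZalg v hv).consOption u)
  obtain ⟨c, u', v', huv', hc⟩ := hsp.exists_interval (huz.trans hzv) (insert f G)
  have hroots : ∀ p ∈ G, p.map (evalHom l) ≠ 0 → ∀ x, u < x → x < v →
      (p.map (evalHom l)).eval x ≠ 0 := fun p hp h0 x h1 h2 h3 =>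
    huv x (hZroot p hp h0 x h3) ⟨h1, h2⟩
  have hf'0 : (derivative f).map (evalHom l) ≠ 0 := by
    rw [← derivative_map]
    intro h
    have := derivative_eq_zero.1 h
    rw [natDegree_map_of_leadingCoeff_ne_zero _ hlc] at this
    omega
  have hneg := hR.mul_neg_of_root (p := f.map (evalHom l)) (u := u) (v := v)
    (by rw [derivative_map]; exact hroots _ hGf hf'0) huz hzv hfz
  obtain ⟨hfc, hfu, hfv⟩ := hc f (Finset.mem_insert_self _ _)
  have hneg' : (f.map (evalHom c)).eval u' * (f.map (evalHom c)).eval v' < 0 := by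
    rw [← sign_eq_neg_one_iff, sign_mul, hfu, hfv, ← sign_mul, sign_eq_neg_one_iff]
    exact hneg
  obtain ⟨ζ, h1, h2, hζ⟩ := Real.polynomialIVT _ _ _ huv' hneg'
  have hlcc : evalHom c f.leadingCoeff ≠ 0 := by
    rw [← sign_ne_zero, leadingCoeff, hfc, sign_ne_zero]
    exact hlc
  refine ⟨c, ζ, fun g hg => ?_⟩
  rw [sign_eval_eq_of_pseudo_remainder _ (hr g) hlcc hζ,
    sign_eval_eq_of_pseudo_remainder _ (hr g) hlc hfz]
  exact sign_eval_eq_of_exists_interval hR (huz.trans hzv) (r g)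
    (fun k hk => hc _ (Finset.mem_insert_of_mem (hGr g hg k hk)))
    (fun k hk => hroots _ (hGr g hg k hk)) huz hzv h1 h2

theorem RealSpecializable.exists_separating (hR : PolynomialIVT R) {l : ι → R}
    (hl : RealSpecializable l) {Z : Finset R} {m : ℕ} (hZ : ∀ x ∈ Z, IsRootOver l m x) {z : R}
    (hz : z ∉ Z) :
    ∃ y, RealSpecializable (consOption y l) ∧ ∀ x ∈ Z, (x < y ∧ x < z) ∨ (y < x ∧ z < x) := by
  classical
  have hne : ∀ x ∈ Z, x < z ∨ z < x := fun x hx => lt_or_gt_of_ne fun h => hz (h ▸ hx)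
  by_cases h1 : ∃ a ∈ Z, a < z
  · obtain ⟨a, ha, haz⟩ := h1
    by_cases h2 : ∃ b ∈ Z, z < b
    · obtain ⟨b, hb, hzb⟩ := h2
      obtain ⟨u, hu, v, hv, huz, hzv, huv⟩ := exists_consecutive hz ha hb haz hzb
      have h3 := (hl.consOption_of_isRootOver hR m (hZ u hu)).consOption_of_isRootOver hR m
        ((hZ v hv).consOption u)
      refine ⟨(u + v) / 2, h3.of_polynomial (fun o => o.elim (MvPolynomial.C (1 / 2) *
        (MvPolynomial.X (some none) + MvPolynomial.X none)) fun i => MvPolynomial.X (some (some i)))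
        ?_, fun x hx => ?_⟩
      · rintro (_ | i)
        · simp only [consOption_none, consOption_some, Option.elim, map_mul, map_add, evalHom_C,
            evalHom_X, map_div₀, map_one, map_ofNat]
          rw [one_div, div_eq_inv_mul]
        · simp
      · have h4 := huz.trans hzv
        rcases hne x hx with h | h
        · have : x ≤ u := not_lt.1 fun h5 => huv x hx ⟨h5, h.trans hzv⟩
          exact Or.inl ⟨by linarith, h⟩
        · have : v ≤ x := not_lt.1 fun h5 => huv x hx ⟨huz.trans h, h5⟩
          exact Or.inr ⟨by linarith, h⟩
    · push Not at h2
      have hZne : Z.Nonempty := ⟨a, ha⟩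
      have h3 := hl.consOption_of_isRootOver hR m (hZ _ (Z.max'_mem hZne))
      refine ⟨Z.max' hZne + 1, h3.of_polynomial (fun o => o.elim (MvPolynomial.X none + 1)
        fun i => MvPolynomial.X (some i)) ?_, fun x hx => Or.inl ⟨?_, ?_⟩⟩
      · rintro (_ | i) <;> simp
      · linarith [Z.le_max' x hx]
      · exact (hne x hx).resolve_right (not_lt.2 (h2 x hx))
  · push Not at h1
    rcases Z.eq_empty_or_nonempty with rfl | hZne
    · refine ⟨0, hl.of_polynomial (fun o => o.elim 0 fun i => MvPolynomial.X i) ?_, by simp⟩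
      rintro (_ | i) <;> simp
    · have h3 := hl.consOption_of_isRootOver hR m (hZ _ (Z.min'_mem hZne))
      refine ⟨Z.min' hZne - 1, h3.of_polynomial (fun o => o.elim (MvPolynomial.X none - 1)
        fun i => MvPolynomial.X (some i)) ?_, fun x hx => Or.inr ⟨?_, ?_⟩⟩
      · rintro (_ | i) <;> simp
      · linarith [Z.min'_le x hx]
      · exact (hne x hx).resolve_left (not_lt.2 (h1 x hx))

theorem RealSpecializable.consOption_of_transcendental (hR : PolynomialIVT R) {l : ι → R}
    (hl : RealSpecializable l) {z : R} (hz : ∀ m, ¬ IsRootOver l m z) :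
    RealSpecializable (consOption z l) := by
  classical
  refine realSpecializable_consOption fun s => ?_
  let Z := s.biUnion fun p => (p.map (evalHom l)).roots.toFinset
  have hmem : ∀ x, x ∈ Z ↔ ∃ p ∈ s, p.map (evalHom l) ≠ 0 ∧ (p.map (evalHom l)).eval x = 0 := by
    intro x
    simp [Z]
  have hZ : ∀ x ∈ Z, IsRootOver l (s.sup natDegree) x := by
    intro x hx
    obtain ⟨p, hp, h⟩ := (hmem x).1 hx
    exact ⟨p, Finset.le_sup (f := natDegree) hp, h⟩
  obtain ⟨y, hy, hyZ⟩ := hl.exists_separating hR hZ fun h => hz _ (hZ z h)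
  obtain ⟨c, hc⟩ := hy (s.image (MvPolynomial.optionEquivLeft ℝ ι).symm)
  refine ⟨c ∘ some, c none, fun g hg => ?_⟩
  have h1 := hc _ (Finset.mem_image_of_mem _ hg)
  rw [evalHom_option_symm, evalHom_option_symm, consOption_comp_some, consOption_none] at h1
  rw [h1]
  by_cases hg0 : g.map (evalHom l) = 0
  · simp [hg0]
  have hno : ∀ x, (y ≤ x ∧ x ≤ z ∨ z ≤ x ∧ x ≤ y) → (g.map (evalHom l)).eval x ≠ 0 := by
    intro x hx h
    rcases hyZ x ((hmem x).2 ⟨g, hg, hg0, h⟩) with h2 | h2 <;> rcases hx with h3 | h3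
    · exact absurd h2.1 (not_lt.2 h3.1)
    · exact absurd h2.2 (not_lt.2 h3.1)
    · exact absurd h2.2 (not_lt.2 h3.2)
    · exact absurd h2.1 (not_lt.2 h3.2)
  have hy0 : (g.map (evalHom l)).eval y ≠ 0 := hno y (by
    rcases le_total y z with h | h
    · exact Or.inl ⟨le_rfl, h⟩
    · exact Or.inr ⟨h, le_rfl⟩)
  have hz0 : (g.map (evalHom l)).eval z ≠ 0 := hno z (by
    rcases le_total y z with h | h
    · exact Or.inl ⟨h, le_rfl⟩
    · exact Or.inr ⟨le_rfl, h⟩)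
  have hpos : 0 < (g.map (evalHom l)).eval y * (g.map (evalHom l)).eval z := by
    by_contra hcon
    have hlt := lt_of_le_of_ne (not_lt.1 hcon) (mul_ne_zero hy0 hz0)
    rcases lt_trichotomy y z with h | rfl | h
    · obtain ⟨x, h2, h3, h4⟩ := hR _ y z h hlt
      exact hno x (Or.inl ⟨h2.le, h3.le⟩) h4
    · exact absurd hlt (not_lt.2 (mul_self_nonneg _))
    · obtain ⟨x, h2, h3, h4⟩ := hR _ z y h (by rwa [mul_comm])
      exact hno x (Or.inr ⟨h2.le, h3.le⟩) h4
  rcases mul_pos_iff.1 hpos with ⟨h2, h3⟩ | ⟨h2, h3⟩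
  · rw [sign_pos h2, sign_pos h3]
  · rw [sign_neg h2, sign_neg h3]

theorem strictMono_algebraMap_real : StrictMono (algebraMap ℝ R) := by
  intro x y hxy
  obtain ⟨t, ht, h⟩ := Real.polynomialIVT.exists_sq (sub_pos.2 hxy).le
  have h1 : algebraMap ℝ R y - algebraMap ℝ R x = algebraMap ℝ R t * algebraMap ℝ R t := by
    rw [← map_sub, ← map_mul, h]
  have h2 : algebraMap ℝ R t ≠ 0 := by
    rw [Ne, map_eq_zero]
    rintro rfl
    linarith
  have h3 := mul_self_pos.2 h2
  linarith

/-- Every finite tuple in an ordered extension of `ℝ` with the intermediate value property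
specializes to real tuples satisfying prescribed sign conditions. -/
theorem PolynomialIVT.realSpecializable (hR : PolynomialIVT R) (ι : Type) [Finite ι] (l : ι → R) :
    RealSpecializable l := by
  induction ι using Finite.induction_empty_option with
  | of_equiv e ih =>
    refine (ih (l ∘ e)).of_polynomial (fun i => MvPolynomial.X (e.symm i)) fun i => ?_
    simp
  | h_empty =>
    intro s
    refine ⟨PEmpty.elim, fun p _ => ?_⟩
    obtain ⟨a, rfl⟩ := MvPolynomial.C_surjective PEmpty p
    simp only [evalHom_C]
    rcases lt_trichotomy a 0 with h | rfl | h
    · rw [sign_neg (by simpa using h),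
        sign_neg (by simpa using strictMono_algebraMap_real (R := R) h)]
    · simp
    · rw [sign_pos (by simpa using h),
        sign_pos (by simpa using strictMono_algebraMap_real (R := R) h)]
  | h_option ih =>
    have hl : l = consOption (l none) (l ∘ some) := by
      ext (_ | i) <;> rfl
    rw [hl]
    by_cases h : ∃ m, IsRootOver (l ∘ some) m (l none)
    · obtain ⟨m, h⟩ := h
      exact (ih _).consOption_of_isRootOver hR m h
    · push Not at h
      exact (ih _).consOption_of_transcendental hR h

end AlgebraicStep

section SkewDeterminant

/-- The determinant of a skew-symmetric matrix is a square. -/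
theorem isSquare_det_of_skew {F : Type*} [Field F] [NeZero (2 : F)] (m : ℕ) :
    ∀ {ι : Type} [Fintype ι] [DecidableEq ι], Fintype.card ι = m →
      ∀ M : Matrix ι ι F, Mᵀ = -M → IsSquare M.det := by
  induction m using Nat.strong_induction_on with
  | _ m ih =>
  intro ι _ _ hι M hM
  have hM' : ∀ i j, M j i = -M i j := fun i j => congrFun (congrFun hM i) j
  by_cases h0 : M = 0
  · by_cases hne : Nonempty ι
    · rw [h0, det_zero]; exact IsSquare.zero
    · have : IsEmpty ι := not_nonempty_iff.mp hne
      rw [det_isEmpty]; exact IsSquare.one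
  obtain ⟨i, j, hij⟩ : ∃ i j, M i j ≠ 0 := by
    by_contra! h
    exact h0 (Matrix.ext h)
  have hdiag : ∀ i, M i i = 0 := fun i => by
    have h2 : (2 : F) * M i i = 0 := by
      rw [two_mul]; nth_rewrite 1 [hM' i i]; simp
    simpa [NeZero.ne (2 : F)] using h2
  have hne : i ≠ j := by
    rintro rfl
    exact hij (hdiag i)
  have hf : Function.Injective ![i, j] := by
    intro x y
    fin_cases x <;> fin_cases y <;> simp [hne, hne.symm]
  let e : Fin 2 ⊕ {x // x ∉ Set.range ![i, j]} ≃ ι :=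
    ((Equiv.ofInjective _ hf).sumCongr (Equiv.refl _)).trans
      (Equiv.sumCompl fun x => x ∈ Set.range ![i, j])
  let N := M.submatrix e e
  have hN : ∀ x y, N y x = -N x y := fun x y => hM' _ _
  have hdet : M.det = N.det := (det_submatrix_equiv_self e M).symm
  have h11 : N.toBlocks₁₁ = !![0, M i j; -M i j, 0] := by
    ext x y
    fin_cases x <;> fin_cases y <;> simp [N, e, Matrix.toBlocks₁₁, hdiag, hM' i j]
  have hd11 : N.toBlocks₁₁.det = M i j * M i j := by
    rw [h11, det_fin_two_of]; ring
  have hunit : IsUnit N.toBlocks₁₁ := by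
    rw [isUnit_iff_isUnit_det, hd11]
    exact (mul_ne_zero hij hij).isUnit
  let _ := hunit.invertible
  have hcard : Fintype.card {x // x ∉ Set.range ![i, j]} < m := by
    have := Fintype.card_congr e
    rw [Fintype.card_sum, Fintype.card_fin, hι] at this
    omega
  have t11 : N.toBlocks₁₁ᵀ = -N.toBlocks₁₁ := by ext x y; exact hN _ _
  have t12 : N.toBlocks₁₂ᵀ = -N.toBlocks₂₁ := by ext x y; exact hN _ _
  have t21 : N.toBlocks₂₁ᵀ = -N.toBlocks₁₂ := by ext x y; exact hN _ _
  have t22 : N.toBlocks₂₂ᵀ = -N.toBlocks₂₂ := by ext x y; exact hN _ _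
  rw [hdet, ← fromBlocks_toBlocks N, det_fromBlocks₁₁, hd11]
  refine IsSquare.mul ⟨_, rfl⟩ (ih _ hcard rfl _ ?_)
  have hinv : (N.toBlocks₁₁⁻¹)ᵀ = -N.toBlocks₁₁⁻¹ := by
    rw [transpose_nonsing_inv, t11]
    apply inv_eq_left_inv
    rw [neg_mul_neg, ← invOf_eq_nonsing_inv, invOf_mul_self]
  rw [invOf_eq_nonsing_inv, transpose_sub, transpose_mul, transpose_mul, hinv, t12, t21, t22]
  simp [Matrix.mul_assoc]
  abel

theorem det_fromBlocks_zero_neg_one_one_zero {K ι : Type*} [CommRing K] [Fintype ι]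
    [DecidableEq ι] :
    (fromBlocks (0 : Matrix ι ι K) (-1) 1 (0 : Matrix ι ι K)).det = 1 := by
  have : fromBlocks (0 : Matrix ι ι K) (-1) 1 (0 : Matrix ι ι K) =
      fromBlocks 1 (-1) 0 1 * fromBlocks 1 0 1 1 * fromBlocks 1 (-1) 0 1 := by
    simp [fromBlocks_multiply]
  rw [this]
  simp

theorem isSquare_det_one_add_mul {F : Type*} [Field F] [NeZero (2 : F)] {ι : Type} [Fintype ι]
    [DecidableEq ι] {S T : Matrix ι ι F} (hS : Sᵀ = -S) (hT : Tᵀ = -T) :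
    IsSquare (1 + S * T).det := by
  have h : (1 + S * T).det = (fromBlocks T 1 (-1) S).det := by
    have : (fromBlocks T 1 (-1) S) * (fromBlocks (0 : Matrix ι ι F) (-1) 1 (0 : Matrix ι ι F)) =
        fromBlocks 1 (-T) S 1 := by
      simp [fromBlocks_multiply]
    have h2 := congrArg Matrix.det this
    rw [det_mul, det_fromBlocks_zero_neg_one_one_zero, mul_one, det_fromBlocks_one₁₁] at h2
    rw [h2]; simp
  rw [h]
  refine isSquare_det_of_skew _ rfl _ ?_
  rw [fromBlocks_transpose, hS, hT, fromBlocks_neg]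
  simp

open Polynomial in
/-- The reverse characteristic polynomial of a product of skew-symmetric matrices is a square. -/
theorem exists_charpolyRev_eq_sq {K : Type*} [CommRing K] [IsDomain K]
    [IsIntegrallyClosed K[X]] [NeZero (2 : K)]
    {ι : Type} [Fintype ι] [DecidableEq ι] {S T : Matrix ι ι K} (hS : Sᵀ = -S) (hT : Tᵀ = -T) :
    ∃ E : K[X], (S * T).charpolyRev = E * E ∧ E.coeff 0 = 1 := by
  let F := FractionRing K[X]
  have h2 : (2 : F) ≠ 0 := by
    have : (2 : F) = algebraMap K[X] F (C 2) := by simp [map_ofNat]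
    rw [this]
    intro h0
    rw [map_eq_zero_iff _ (IsFractionRing.injective K[X] F), C_eq_zero] at h0
    exact NeZero.ne _ h0
  have : NeZero (2 : F) := ⟨h2⟩
  have hsq : ∃ E : K[X], (S * T).charpolyRev = E * E := by
    let S' : Matrix ι ι F := (-(X : K[X]) • S.map C).map (algebraMap K[X] F)
    let T' : Matrix ι ι F := (T.map C).map (algebraMap K[X] F)
    have hS' : S'ᵀ = -S' := by
      ext x y
      have : S y x = -S x y := congrFun (congrFun hS x) y
      change algebraMap K[X] F (-X * C (S y x)) = -algebraMap K[X] F (-X * C (S x y))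
      rw [this, ← map_neg, C_neg, mul_neg]
    have hT' : T'ᵀ = -T' := by
      ext x y
      have : T y x = -T x y := congrFun (congrFun hT x) y
      simp [T', this]
    obtain ⟨E, hE⟩ := isSquare_det_one_add_mul hS' hT'
    have hmat : 1 + S' * T' = (1 - (X : K[X]) • (S * T).map C).map (algebraMap K[X] F) := by
      have : 1 - (X : K[X]) • (S * T).map C = 1 + (-(X : K[X]) • S.map C) * T.map C := by
        rw [Matrix.map_mul, smul_mul_assoc, neg_smul, sub_eq_add_neg]
      simp only [S', T', this, ← RingHom.mapMatrix_apply (algebraMap K[X] F)]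
      rw [map_add, map_mul, map_one]
    have hdet : algebraMap K[X] F (S * T).charpolyRev = E * E := by
      rw [← hE, hmat, ← RingHom.mapMatrix_apply, ← RingHom.map_det, charpolyRev]
    have hαint : IsIntegral K[X] E := by
      refine ⟨X ^ 2 - C (S * T).charpolyRev, monic_X_pow_sub_C _ two_ne_zero, ?_⟩
      simp [hdet, sq]
    obtain ⟨E₀, rfl⟩ := IsIntegrallyClosed.isIntegral_iff.mp hαint
    refine ⟨E₀, IsFractionRing.injective K[X] F ?_⟩
    rw [hdet, map_mul]
  obtain ⟨E, hE⟩ := hsq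
  have h1 : E.coeff 0 * E.coeff 0 = 1 := by
    rw [← mul_coeff_zero, ← hE, coeff_zero_eq_eval_zero, eval_charpolyRev]
  rcases mul_self_eq_one_iff.mp h1 with h | h
  · exact ⟨E, hE, h⟩
  · exact ⟨-E, by rw [neg_mul_neg, hE], by simp [h]⟩

end SkewDeterminant

section Newton

open Polynomial

variable {ι : Type} [Fintype ι] [DecidableEq ι]

/-- Jacobi's formula for the derivative of the determinant of a polynomial matrix. -/
theorem derivative_det_eq_trace {K : Type*} [CommRing K] (M : Matrix ι ι K[X]) :
    derivative M.det = (M.adjugate * M.map derivative).trace := by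
  have h (i : ι) : (M.adjugate * M.map derivative) i i =
      (M.updateCol i fun k => derivative (M k i)).det := by
    rw [← cramer_apply, cramer_eq_adjugate_mulVec]
    rfl
  simp only [Matrix.trace, Matrix.diag, h]
  simp only [det_apply, derivative_sum]
  rw [Finset.sum_comm]
  refine Finset.sum_congr rfl fun σ _ => ?_
  rw [derivative_smul, derivative_prod_finset, Finset.smul_sum]
  refine Finset.sum_congr rfl fun i _ => ?_
  congr 1
  rw [← Finset.mul_prod_erase _ _ (Finset.mem_univ i), updateCol_self, mul_comm]
  congr 1
  refine Finset.prod_congr rfl fun j hj => ?_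
  rw [updateCol_ne (Finset.ne_of_mem_erase hj)]

theorem coeff_map_adjugate_one_sub_X_smul {K : Type*} [CommRing K] (A : Matrix ι ι K) (k : ℕ) :
    ((1 - (X : K[X]) • A.map C).adjugate.map fun p => p.coeff k) =
      ∑ x ∈ Finset.HasAntidiagonal.antidiagonal k, A.charpolyRev.coeff x.1 • A ^ x.2 := by
  set G := (1 - (X : K[X]) • A.map C).adjugate with hG
  have hmul : G - (X : K[X]) • (G * A.map C) = A.charpolyRev • 1 := by
    rw [charpolyRev, ← adjugate_mul, mul_sub, mul_one, Matrix.mul_smul]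
  have hGA (j : ℕ) : ((G * A.map C).map fun p => p.coeff j) = (G.map fun p => p.coeff j) * A := by
    ext a b
    simp [Matrix.mul_apply, finsetSum_coeff]
  have hcoeff (j : ℕ) : (G.map fun p => p.coeff j) -
      (((X : K[X]) • (G * A.map C)).map fun p => p.coeff j) = A.charpolyRev.coeff j • 1 := by
    ext a b
    have := congrArg (fun M : Matrix ι ι K[X] => (M a b).coeff j) hmul
    by_cases hab : a = b
    · subst hab
      simpa using this
    · simpa [hab] using this
  induction k with
  | zero =>
    have h0 := hcoeff 0
    have : (((X : K[X]) • (G * A.map C)).map fun p => p.coeff 0) = 0 := by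
      ext a b
      simp
    rw [this, sub_zero] at h0
    simp [h0]
  | succ k ih =>
    have h1 := hcoeff (k + 1)
    have : (((X : K[X]) • (G * A.map C)).map fun p => p.coeff (k + 1)) =
        (G.map fun p => p.coeff k) * A := by
      rw [← hGA]
      ext a b
      simp [coeff_X_mul]
    rw [this, ih, sub_eq_iff_eq_add] at h1
    rw [h1, Finset.Nat.sum_antidiagonal_succ', Finset.sum_mul]
    simp [pow_succ]

/-- A polynomial with constant term one satisfying `m F' = -F P`, where `P` is the power series
with coefficients `p`. -/
def IsNewtonPolynomial {K : Type*} [CommRing K] (m : ℕ) (p : ℕ → K) (F : K[X]) : Prop :=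
  F.coeff 0 = 1 ∧
    ∀ k : ℕ, (m : K) * ((k + 1 : ℕ) * F.coeff (k + 1)) =
      -∑ x ∈ Finset.HasAntidiagonal.antidiagonal k, F.coeff x.1 * p x.2

theorem isNewtonPolynomial_charpolyRev {K : Type*} [CommRing K] (A : Matrix ι ι K) :
    IsNewtonPolynomial 1 (fun j => (A ^ (j + 1)).trace) A.charpolyRev := by
  refine ⟨by rw [coeff_zero_eq_eval_zero, eval_charpolyRev], fun k => ?_⟩
  have hd : derivative A.charpolyRev =
      -((1 - (X : K[X]) • A.map C).adjugate * A.map C).trace := by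
    rw [charpolyRev, derivative_det_eq_trace]
    have : (1 - (X : K[X]) • A.map C).map derivative = -A.map C := by
      ext1 a b
      by_cases hab : a = b
      · subst hab; simp
      · simp [hab]
    rw [this, mul_neg, trace_neg]
  have h := congrArg (fun p => p.coeff k) hd
  simp only [coeff_derivative, coeff_neg] at h
  rw [Nat.cast_one, one_mul, mul_comm, Nat.cast_add, Nat.cast_one, h]
  congr 1
  have : ((1 - (X : K[X]) • A.map C).adjugate * A.map C).trace.coeff k =
      (((1 - (X : K[X]) • A.map C).adjugate.map fun p => p.coeff k) * A).trace := by
    simp [Matrix.trace, Matrix.mul_apply, finsetSum_coeff]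
  rw [this, coeff_map_adjugate_one_sub_X_smul, Finset.sum_mul, trace_sum]
  simp [pow_succ]

theorem IsNewtonPolynomial.powerSeries {K : Type*} [CommRing K] {m : ℕ} {p : ℕ → K} {F : K[X]}
    (h : IsNewtonPolynomial m p F) :
    (m : PowerSeries K) * (derivative F : K[X]) = -((F : PowerSeries K) * PowerSeries.mk p) := by
  ext k
  have := h.2 k
  rw [← map_natCast (PowerSeries.C (R := K)), PowerSeries.coeff_C_mul, map_neg,
    PowerSeries.coeff_mul]
  simp only [Polynomial.coeff_coe, PowerSeries.coeff_mk, ← this, coeff_derivative]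
  push_cast
  ring

theorem isNewtonPolynomial_of_powerSeries {K : Type*} [CommRing K] {m : ℕ} {p : ℕ → K} {F : K[X]}
    (h0 : F.coeff 0 = 1) (h : (m : PowerSeries K) * (derivative F : K[X]) =
      -((F : PowerSeries K) * PowerSeries.mk p)) : IsNewtonPolynomial m p F := by
  refine ⟨h0, fun k => ?_⟩
  have := congrArg (PowerSeries.coeff k) h
  rw [← map_natCast (PowerSeries.C (R := K)), PowerSeries.coeff_C_mul, map_neg,
    PowerSeries.coeff_mul] at this
  simp only [Polynomial.coeff_coe, PowerSeries.coeff_mk, coeff_derivative] at this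
  rw [← this]
  push_cast
  ring

theorem IsNewtonPolynomial.of_mul_self {K : Type*} [CommRing K] [IsDomain K] {p : ℕ → K}
    {E : K[X]} (h : IsNewtonPolynomial 1 p (E * E)) (h0 : E.coeff 0 = 1) :
    IsNewtonPolynomial 2 p E := by
  refine isNewtonPolynomial_of_powerSeries h0 ?_
  have h1 := h.powerSeries
  have hE : (E : PowerSeries K) ≠ 0 := by
    intro h2
    have : E = 0 := by exact_mod_cast h2
    simp [this] at h0
  apply mul_left_cancel₀ hE
  rw [derivative_mul] at h1
  push_cast at h1 ⊢
  linear_combination h1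

/-- The coefficients of a Newton polynomial lie in any subalgebra containing the power sums. -/
theorem IsNewtonPolynomial.coeff_mem {R K : Type*} [Field R] [CharZero R] [CommRing K]
    [Algebra R K] {C : Subalgebra R K} {m : ℕ} (hm : m ≠ 0) (t : ℕ → C)
    {E : K[X]} (hE : IsNewtonPolynomial m (fun j => (t j : K)) E) (k : ℕ) : E.coeff k ∈ C := by
  induction k using Nat.strong_induction_on with
  | _ k ih =>
  rcases k with _ | k
  · rw [hE.1]; exact C.one_mem
  have h := hE.2 k
  have hne : (m : R) * ((k + 1 : ℕ) : R) ≠ 0 :=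
    mul_ne_zero (Nat.cast_ne_zero.mpr hm) (Nat.cast_ne_zero.mpr k.succ_ne_zero)
  have h2 : E.coeff (k + 1) = ((m : R) * ((k + 1 : ℕ) : R))⁻¹ •
      -∑ x ∈ Finset.HasAntidiagonal.antidiagonal k, E.coeff x.1 * (t x.2 : K) := by
    rw [← h, eq_inv_smul_iff₀ hne, Algebra.smul_def]
    simp [mul_assoc]
  rw [h2]
  refine C.smul_mem (C.neg_mem (C.sum_mem fun x hx => C.mul_mem (ih _ ?_) (t _).2)) _
  have := Finset.HasAntidiagonal.mem_antidiagonal.mp hx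
  omega

/-- Newton polynomials descend along characters of a subalgebra containing the power sums. -/
theorem IsNewtonPolynomial.exists_map {R K : Type*} [Field R] [CharZero R] [CommRing K]
    [Algebra R K] {C : Subalgebra R K} (Φ : C →ₐ[R] R) {m : ℕ} (hm : m ≠ 0) (t : ℕ → C)
    {E : K[X]} (hE : IsNewtonPolynomial m (fun j => (t j : K)) E) :
    ∃ F : R[X], IsNewtonPolynomial m (fun j => Φ (t j)) F := by
  have hmem := hE.coeff_mem hm
  obtain ⟨q, hq⟩ := (lifts_iff_coeff_lifts (f := (C.val : C →+* K)) E).mpr fun k =>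
    ⟨⟨E.coeff k, hmem k⟩, rfl⟩
  have hqc : ∀ k, ((q.coeff k : C) : K) = E.coeff k := fun k => by
    rw [← hq]; simp
  refine ⟨q.map (Φ : C →+* R), ?_, fun k => ?_⟩
  · have : q.coeff 0 = 1 := Subtype.ext (by rw [hqc, hE.1]; rfl)
    simp [this]
  · have : (m : C) * ((k + 1 : ℕ) * q.coeff (k + 1)) =
        -∑ x ∈ Finset.HasAntidiagonal.antidiagonal k, q.coeff x.1 * t x.2 := by
      apply Subtype.ext
      have h := hE.2 k
      simpa [hqc] using h
    have h2 := congrArg Φ this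
    simpa using h2

theorem exists_nat_eq_of_isNewtonPolynomial {R : Type*} [Field R] [CharZero R] {s : R} {F : R[X]}
    (h : IsNewtonPolynomial 1 (fun _ => s) F) : ∃ N : ℕ, s = N := by
  by_contra! hs
  have h1 := h.powerSeries
  have hP : (1 - PowerSeries.X) * PowerSeries.mk (fun _ : ℕ => s) = PowerSeries.C s := by
    have : PowerSeries.mk (fun _ : ℕ => s) = PowerSeries.C s * PowerSeries.mk 1 := by
      ext k; simp
    rw [this, mul_left_comm, mul_comm (1 - _), PowerSeries.mk_one_mul_one_sub_eq_one, mul_one]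
  have h2 : (1 - X) * derivative F = -(C s * F) := by
    have : ((1 - PowerSeries.X) * ((derivative F : R[X]) : PowerSeries R) : PowerSeries R) =
        -(PowerSeries.C s * (F : PowerSeries R)) := by
      linear_combination (1 - PowerSeries.X) * h1 - (F : PowerSeries R) * hP
    apply Polynomial.coe_injective R
    push_cast
    exact this
  have hne : ∀ k, F.coeff k ≠ 0 := by
    intro k
    induction k with
    | zero => rw [h.1]; exact one_ne_zero
    | succ k ih =>
      intro h0
      have h3 := congrArg (fun p => p.coeff k) h2
      have h4 : (X * derivative F).coeff k = k * F.coeff k := by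
        rcases k with _ | k
        · simp
        · rw [coeff_X_mul, coeff_derivative]; push_cast; ring
      simp only [sub_mul, one_mul, coeff_sub, h4, coeff_neg, coeff_C_mul, coeff_derivative, h0]
        at h3
      have h5 : (s - k) * F.coeff k = 0 := by linear_combination h3
      exact (mul_ne_zero (sub_ne_zero.mpr (hs k)) ih) h5
  exact hne _ (coeff_eq_zero_of_natDegree_lt (Nat.lt_succ_self F.natDegree))

theorem exists_nat_eq_two_mul_of_isNewtonPolynomial {R : Type*} [Field R] [CharZero R] {s : R}
    {m : ℕ} {p : ℕ → R} {F : R[X]} (h : IsNewtonPolynomial m p F) (hp0 : p 0 = 0)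
    (hp1 : p 1 = -s) (hp : ∀ k, p (k + 2) = -p k) : ∃ N : ℕ, s = 2 * m * N := by
  by_contra! hs
  have h1 := h.powerSeries
  have hP : (1 + PowerSeries.X ^ 2) * PowerSeries.mk p = -(PowerSeries.C s * PowerSeries.X) := by
    ext k
    rw [add_mul, one_mul, map_add]
    rcases k with _ | _ | k
    · simp [hp0, PowerSeries.coeff_X_pow_mul']
    · simp [hp1, PowerSeries.coeff_X_pow_mul']
    · simp [hp, PowerSeries.coeff_X_pow_mul']
  have h2 : C (m : R) * ((1 + X ^ 2) * derivative F) = C s * (X * F) := by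
    have : (PowerSeries.C (m : R) * ((1 + PowerSeries.X ^ 2) * ((derivative F : R[X]) : PowerSeries R)) :
        PowerSeries R) = PowerSeries.C s * (PowerSeries.X * (F : PowerSeries R)) := by
      rw [map_natCast]
      linear_combination (1 + PowerSeries.X ^ 2) * h1 - (F : PowerSeries R) * hP
    apply Polynomial.coe_injective R
    push_cast
    exact this
  have hne : ∀ k, F.coeff (2 * k) ≠ 0 := by
    intro k
    induction k with
    | zero => rw [mul_zero, h.1]; exact one_ne_zero
    | succ k ih =>
      intro h0
      have h3 := congrArg (fun p => p.coeff (2 * k + 1)) h2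
      have h4 : (X ^ 2 * derivative F).coeff (2 * k + 1) = (2 * k : ℕ) * F.coeff (2 * k) := by
        rcases k with _ | k
        · simp [coeff_X_pow_mul']
        · have : 2 * (k + 1) + 1 = 2 * k + 1 + 2 := by ring
          rw [this, coeff_X_pow_mul, coeff_derivative]; push_cast; ring_nf
      have h0' : F.coeff (2 * k + 1 + 1) = 0 := h0
      simp only [add_mul, one_mul, coeff_add, h4, coeff_C_mul, coeff_derivative, h0',
        coeff_X_mul] at h3
      have h5 : (s - 2 * m * k) * F.coeff (2 * k) = 0 := by
        push_cast at h3
        linear_combination -h3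
      exact (mul_ne_zero (sub_ne_zero.mpr (hs k)) ih) h5
  exact hne (F.natDegree + 1) (coeff_eq_zero_of_natDegree_lt (by omega))

end Newton

section TraceStarAlgebra

open Polynomial

/-- An algebra with involution and a positive definite trace whose power sums satisfy the
integrality conditions valid for real matrices. -/
structure TraceStarAlgebra (R B : Type) [Field R] [LinearOrder R] [Ring B] [Algebra R B] where
  /-- The involution. -/
  st : B →ₗ[R] B
  /-- The trace. -/
  tr : B →ₗ[R] R
  st_st : ∀ x, st (st x) = x
  st_mul : ∀ x y, st (x * y) = st y * st x
  tr_comm : ∀ x y, tr (x * y) = tr (y * x)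
  tr_st : ∀ x, tr (st x) = tr x
  tr_pos : ∀ x, x ≠ 0 → 0 < tr (x * st x)
  newton : ∀ x, ∃ F : R[X], IsNewtonPolynomial 1 (fun j => tr (x ^ (j + 1))) F
  newton_skew : ∀ x y, st x = -x → st y = -y →
    ∃ F : R[X], IsNewtonPolynomial 2 (fun j => tr ((x * y) ^ (j + 1))) F
  integral : ∀ x : B, IsIntegral R x

namespace TraceStarAlgebra

variable {R B : Type} [Field R] [LinearOrder R] [Ring B] [Algebra R B]
  (T : TraceStarAlgebra R B)

theorem st_one : T.st 1 = 1 := by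
  have h := T.st_mul (T.st 1) 1
  rw [mul_one, T.st_st, mul_one] at h
  exact h.symm

theorem tr_nonneg (x : B) : 0 ≤ T.tr (x * T.st x) := by
  by_cases hx : x = 0
  · simp [hx]
  · exact (T.tr_pos x hx).le

theorem eq_zero_of_st_mul_self {x : B} (h : T.st x * x = 0) : x = 0 := by
  by_contra hx
  have := T.tr_pos x hx
  rw [T.tr_comm, h, map_zero] at this
  exact lt_irrefl _ this

theorem tr_st_mul_self_pos {x : B} (hx : x ≠ 0) : 0 < T.tr (T.st x * x) := by
  rw [T.tr_comm]; exact T.tr_pos x hx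

/-- Symmetric idempotents. -/
structure IsProj (e : B) : Prop where
  st_eq : T.st e = e
  mul_self : e * e = e

variable {T}

theorem IsProj.sub {e f : B} (he : T.IsProj e) (hf : T.IsProj f) (h : e * f = f) :
    T.IsProj (e - f) := by
  have h' : f * e = f := by
    have := congrArg T.st h
    rwa [T.st_mul, he.st_eq, hf.st_eq] at this
  refine ⟨by rw [map_sub, he.st_eq, hf.st_eq], ?_⟩
  rw [mul_sub, sub_mul, sub_mul, he.mul_self, hf.mul_self, h, h']
  abel

theorem IsProj.tr_pos {e : B} (he : T.IsProj e) (h0 : e ≠ 0) : 0 < T.tr e := by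
  have := T.tr_pos e h0
  rwa [he.st_eq, he.mul_self] at this

variable (T)

/-- Minimal nonzero symmetric idempotents. -/
structure IsMinProj (c : B) : Prop extends T.IsProj c where
  ne_zero : c ≠ 0
  eq_of_le : ∀ e, T.IsProj e → c * e = e → e = 0 ∨ e = c

variable {T} [IsStrictOrderedRing R]

theorem IsProj.tr_eq_natCast {e : B} (he : T.IsProj e) : ∃ N : ℕ, T.tr e = N := by
  obtain ⟨F, hF⟩ := T.newton e
  have : ∀ j : ℕ, e ^ (j + 1) = e := fun j => by
    induction j with
    | zero => simp
    | succ j ih => rw [pow_succ, ih, he.mul_self]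
  simp only [this] at hF
  exact exists_nat_eq_of_isNewtonPolynomial hF

theorem exists_isMinProj {z : B} (hz : T.IsProj z) (h0 : z ≠ 0) :
    ∃ c, T.IsMinProj c ∧ z * c = c := by
  classical
  have hex : ∃ N : ℕ, ∃ c, T.IsProj c ∧ z * c = c ∧ c ≠ 0 ∧ T.tr c = N := by
    obtain ⟨N, hN⟩ := hz.tr_eq_natCast
    exact ⟨N, z, hz, hz.mul_self, h0, hN⟩
  obtain ⟨c, hc, hzc, hc0, hN⟩ := Nat.find_spec hex
  refine ⟨c, ⟨hc, hc0, fun e he hce => ?_⟩, hzc⟩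
  by_contra! hne
  have hsub := hc.sub he hce
  have h1 := hsub.tr_pos (sub_ne_zero.mpr hne.2.symm)
  obtain ⟨M, hM⟩ := he.tr_eq_natCast
  refine Nat.find_min hex (m := M) ?_ ⟨e, he, ?_, hne.1, hM⟩
  · rw [map_sub, hN, hM, sub_pos] at h1
    exact_mod_cast h1
  · rw [← hce, ← mul_assoc, hzc]

/-- Symmetric elements of the corner of a minimal symmetric idempotent are scalars. -/
theorem IsMinProj.exists_smul_of_symm (hR : HasNoRealExtension R) {c x : B} (hc : T.IsMinProj c)
    (hx : T.st x = x) (hcx : c * x = x) (hxc : x * c = x) : ∃ r : R, x = r • c := by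
  have hcomm : Commute x c := by rw [Commute, SemiconjBy, hcx, hxc]
  have hcommf : ∀ f : R[X], c * aeval x f = aeval x f * c := fun f => by
    induction f using Polynomial.induction_on' with
    | add p q hp hq => rw [map_add, mul_add, add_mul, hp, hq]
    | monomial k a =>
      rw [aeval_monomial, ← mul_assoc, ← Algebra.commutes, mul_assoc, mul_assoc,
        (hcomm.pow_left k).eq]
  let E : R[X] → B := fun f => aeval x f * c
  have hEmul : ∀ f g, E (f * g) = E f * E g := fun f g => by
    simp only [E]
    rw [map_mul, mul_assoc, mul_assoc, ← mul_assoc c, hcommf, mul_assoc, hc.mul_self]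
  have hEadd : ∀ f g, E (f + g) = E f + E g := fun f g => by simp only [E, map_add, add_mul]
  have hE1 : E 1 = c := by simp [E]
  have hEc : ∀ f, E f * c = E f := fun f => by simp only [E, mul_assoc, hc.mul_self]
  have hcE : ∀ f, c * E f = E f := fun f => by
    simp only [E]; rw [← mul_assoc, hcommf, mul_assoc, hc.mul_self]
  have hEst : ∀ f, T.st (E f) = E f := fun f => by
    simp only [E]
    rw [T.st_mul, hc.st_eq, ← hcommf]
    congr 1
    have hpow : ∀ k, T.st (x ^ k) = x ^ k := fun k => by
      induction k with
      | zero => rw [pow_zero, T.st_one]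
      | succ k ih => rw [pow_succ, T.st_mul, ih, hx, ← pow_succ, pow_succ']
    induction f using Polynomial.induction_on' with
    | add p q hp hq => rw [map_add, map_add, hp, hq]
    | monomial k a => rw [aeval_monomial, ← Algebra.smul_def, map_smul, hpow]
  have hsq : ∀ f, E (f * f) = 0 → E f = 0 := fun f hf => by
    apply T.eq_zero_of_st_mul_self
    rw [hEst, ← hEmul, hf]
  have hcop : ∀ f g, IsCoprime f g → E (f * g) = 0 → E f = 0 ∨ E g = 0 := by
    rintro f g ⟨u, v, huv⟩ hfg
    have hsum : E (u * f) + E (v * g) = c := by rw [← hEadd, huv, hE1]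
    have hzero : E (u * f) * E (v * g) = 0 := by
      rw [← hEmul, mul_mul_mul_comm, hEmul, hfg, mul_zero]
    have hproj : T.IsProj (E (u * f)) := by
      refine ⟨hEst _, ?_⟩
      have := congrArg (fun y => E (u * f) * y) hsum
      simp only [mul_add, hzero, add_zero, hEc] at this
      exact this
    rcases hc.eq_of_le _ hproj (hcE _) with h | h
    · left
      rw [h, zero_add, hEmul] at hsum
      rw [← hEc f, ← hsum, ← hEmul, ← hEmul, mul_left_comm, hEmul, hfg, mul_zero]
    · right
      rw [hEmul] at h
      rw [← hEc g, ← h, ← hEmul, ← hEmul]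
      rw [show g * (u * f) = u * (f * g) by ring, hEmul, hfg, mul_zero]
  classical
  have hex : ∃ N : ℕ, ∃ p : R[X], p ≠ 0 ∧ E p = 0 ∧ p.natDegree = N := by
    obtain ⟨p, hp, hpx⟩ := T.integral x
    refine ⟨_, p, hp.ne_zero, ?_, rfl⟩
    change aeval x p * c = 0
    rw [aeval_def, hpx, zero_mul]
  obtain ⟨p, hp0, hEp, hdeg⟩ := Nat.find_spec hex
  have hmin : ∀ q : R[X], q ≠ 0 → E q = 0 → p.natDegree ≤ q.natDegree := fun q hq0 hq => by
    rw [hdeg]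
    exact Nat.find_min' hex ⟨q, hq0, hq, rfl⟩
  have hnu : ¬ IsUnit p := fun hu => by
    obtain ⟨q, hq⟩ := hu.exists_right_inv
    apply hc.ne_zero
    rw [← hE1, ← hq, hEmul, hEp, zero_mul]
  have hposdeg : ∀ q : R[X], q ≠ 0 → ¬ IsUnit q → 0 < q.natDegree := fun q hq0 hq => by
    by_contra h
    apply hq
    rw [isUnit_iff_degree_eq_zero, degree_eq_natDegree hq0]
    simpa using h
  have hirr : Irreducible p := by
    refine ⟨hnu, fun a b hab => ?_⟩
    by_contra! hn
    have ha0 : a ≠ 0 := by rintro rfl; simp at hab; exact hp0 hab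
    have hb0 : b ≠ 0 := by rintro rfl; simp at hab; exact hp0 hab
    have hda := hposdeg a ha0 hn.1
    have hdb := hposdeg b hb0 hn.2
    have hdp : p.natDegree = a.natDegree + b.natDegree := by rw [hab, natDegree_mul ha0 hb0]
    by_cases hco : IsCoprime a b
    · rcases hcop a b hco (hab ▸ hEp) with h | h
      · have := hmin a ha0 h; omega
      · have := hmin b hb0 h; omega
    · obtain ⟨h, hnh, a', b', rfl, rfl⟩ : ∃ h, ¬ IsUnit h ∧ ∃ a' b', a = h * a' ∧ b = h * b' := by
        obtain ⟨a', ha'⟩ := EuclideanDomain.gcd_dvd_left a b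
        obtain ⟨b', hb'⟩ := EuclideanDomain.gcd_dvd_right a b
        exact ⟨EuclideanDomain.gcd a b, fun hu => hco (EuclideanDomain.gcd_isUnit_iff.mp hu),
          a', b', ha', hb'⟩
      have hh0 : h ≠ 0 := left_ne_zero_of_mul ha0
      have ha'0 := right_ne_zero_of_mul ha0
      have hb'0 := right_ne_zero_of_mul hb0
      have hdh := hposdeg h hh0 hnh
      have hz : E (h * a' * b') = 0 := by
        apply hsq
        rw [show h * a' * b' * (h * a' * b') = a' * b' * p by rw [hab]; ring, hEmul, hEp, mul_zero]
      have := hmin _ (mul_ne_zero ha0 hb'0) hz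
      rw [natDegree_mul ha0 hb'0] at this
      rw [natDegree_mul hh0 hb'0] at hdp
      omega
  have hdeg1 : p.natDegree = 1 := by
    by_contra hd
    obtain ⟨s, hs, q, hq⟩ := hR p hirr hd
    have h1 : E (1 + s) = 0 := by rw [hq, hEmul, hEp, zero_mul]
    have h2 : ∀ s ∈ weightedSquares R, 0 ≤ T.tr (E s) := by
      intro s hs
      induction hs using AddSubmonoid.closure_induction with
      | mem x hx =>
        obtain ⟨t, q, ht, rfl⟩ := hx
        have : E (C t * (q * q)) = t • (E q * T.st (E q)) := by
          rw [hEst, ← hEmul]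
          simp only [E]
          rw [map_mul, aeval_C, mul_assoc, ← Algebra.smul_def]
        rw [this, map_smul, smul_eq_mul]
        exact mul_nonneg ht (T.tr_nonneg _)
      | zero => simp [E]
      | add a b _ _ ha hb => rw [hEadd, map_add]; exact add_nonneg ha hb
    have h3 := congrArg T.tr h1
    rw [hEadd, hE1, map_add, map_zero] at h3
    linarith [h2 s hs, hc.toIsProj.tr_pos hc.ne_zero]
  obtain ⟨a, ha, b, rfl⟩ := natDegree_eq_one.mp hdeg1
  refine ⟨-(b / a), ?_⟩
  have h : a • x + b • c = 0 := by
    have := hEp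
    simp only [E, map_add, map_mul, aeval_C, aeval_X, add_mul, mul_assoc, hxc] at this
    rwa [← Algebra.smul_def, ← Algebra.smul_def] at this
  have hx' : x = a⁻¹ • (a • x) := by rw [smul_smul, inv_mul_cancel₀ ha, one_smul]
  rw [hx', eq_neg_of_add_eq_zero_left h, smul_neg, smul_smul, neg_smul, div_eq_inv_mul]

end TraceStarAlgebra

end TraceStarAlgebra

section DivisionCorner

namespace TraceStarAlgebra

variable {R B : Type} [Field R] [LinearOrder R] [Ring B] [Algebra R B]
  {T : TraceStarAlgebra R B}

/-- An orthogonal basis of unitary elements of the corner `c B c`, of size dividing `tr c`. -/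
structure IsCornerBasis (T : TraceStarAlgebra R B) (c : B) {d : ℕ} (q : Fin d → B) : Prop where
  left : ∀ a, c * q a = q a
  right : ∀ a, q a * c = q a
  mul_st : ∀ a, q a * T.st (q a) = c
  tr_eq : ∀ a b, T.tr (T.st (q a) * q b) = if a = b then T.tr c else 0
  span : ∀ y, c * y = y → y * c = y → y ∈ Submodule.span R (Set.range q)
  dvd : ∃ m : ℕ, T.tr c = d * m
  pos : 0 < d

/-- Skew-symmetric elements of a corner. -/
structure IsSkewIn (T : TraceStarAlgebra R B) (c x : B) : Prop where
  st_eq : T.st x = -x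
  left : c * x = x
  right : x * c = x

theorem IsSkewIn.smul {c x : B} (hx : T.IsSkewIn c x) (r : R) : T.IsSkewIn c (r • x) :=
  ⟨by rw [map_smul, hx.st_eq, smul_neg], by rw [mul_smul_comm, hx.left],
    by rw [smul_mul_assoc, hx.right]⟩

theorem IsSkewIn.sub {c x y : B} (hx : T.IsSkewIn c x) (hy : T.IsSkewIn c y) :
    T.IsSkewIn c (x - y) :=
  ⟨by rw [map_sub, hx.st_eq, hy.st_eq]; abel, by rw [mul_sub, hx.left, hy.left],
    by rw [sub_mul, hx.right, hy.right]⟩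

theorem IsSkewIn.mul {c x y : B} (hx : T.IsSkewIn c x) (hy : T.IsSkewIn c y)
    (h : x * y = -(y * x)) : T.IsSkewIn c (x * y) :=
  ⟨by rw [T.st_mul, hx.st_eq, hy.st_eq, neg_mul_neg, h, neg_neg], by rw [← mul_assoc, hx.left],
    by rw [mul_assoc, hy.right]⟩

variable [IsStrictOrderedRing R]

theorem tr_eq_zero_of_skew {x : B} (hx : T.st x = -x) : T.tr x = 0 := by
  have := T.tr_st x
  rw [hx, map_neg] at this
  linarith

section Corner

variable {c : B}

theorem IsMinProj.exists_anticomm (hR : HasNoRealExtension R) (hc : T.IsMinProj c) {x y : B}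
    (hx : T.IsSkewIn c x) (hy : T.IsSkewIn c y) : ∃ r : R, x * y + y * x = r • c := by
  refine hc.exists_smul_of_symm hR ?_ ?_ ?_
  · rw [map_add, T.st_mul, T.st_mul, hx.st_eq, hy.st_eq, neg_mul_neg, neg_mul_neg, add_comm]
  · rw [mul_add, ← mul_assoc, ← mul_assoc, hx.left, hy.left]
  · rw [add_mul, mul_assoc, mul_assoc, hx.right, hy.right]

theorem IsMinProj.exists_normalize (hR : HasNoRealExtension R) (hc : T.IsMinProj c) {x : B}
    (hx : T.IsSkewIn c x) (hx0 : x ≠ 0) :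
    ∃ r : R, r ≠ 0 ∧ T.IsSkewIn c (r • x) ∧ (r • x) * (r • x) = -c := by
  obtain ⟨s, hs⟩ := hc.exists_smul_of_symm hR (x := T.st x * x)
    (by rw [T.st_mul, T.st_st]) (by rw [hx.st_eq, neg_mul, mul_neg, ← mul_assoc, hx.left])
    (by rw [mul_assoc, hx.right])
  have hpos := T.tr_st_mul_self_pos hx0
  rw [hs, map_smul, smul_eq_mul] at hpos
  have hs0 : 0 < s := pos_of_mul_pos_left hpos (hc.toIsProj.tr_pos hc.ne_zero).le
  obtain ⟨y, hy, hyy⟩ := hR.polynomialIVT.exists_sq hs0.le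
  have hy0 : y ≠ 0 := by rintro rfl; simp at hyy; exact hs0.ne hyy
  refine ⟨y⁻¹, inv_ne_zero hy0, hx.smul _, ?_⟩
  rw [hx.st_eq, neg_mul, neg_eq_iff_eq_neg] at hs
  rw [smul_mul_smul_comm, hs, ← mul_inv, hyy, smul_neg, smul_smul, inv_mul_cancel₀ hs0.ne',
    one_smul]

/-- Subtracting a multiple of `i` makes a skew element anticommute with `i`. -/
theorem IsMinProj.exists_orthogonalize (hR : HasNoRealExtension R) (hc : T.IsMinProj c) {i x : B}
    (hi : T.IsSkewIn c i) (hii : i * i = -c) (hx : T.IsSkewIn c x) :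
    ∃ r : R, (x - r • i) * i = -(i * (x - r • i)) := by
  obtain ⟨r, hr⟩ := hc.exists_anticomm hR hx hi
  refine ⟨-(r / 2), ?_⟩
  rw [eq_neg_iff_add_eq_zero, sub_mul, mul_sub, smul_mul_assoc, mul_smul_comm, hii]
  have : x * i - -(r / 2) • -c + (i * x - -(r / 2) • -c) = (x * i + i * x) - (r / 2 + r / 2) • c := by
    rw [add_smul]; simp only [neg_smul, smul_neg]; abel
  rw [this, hr, add_halves, sub_self]

theorem IsSkewIn.tr_eq_two_mul {i : B} (hi : T.IsSkewIn c i)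
    (hii : i * i = -c) {m : ℕ} {F : Polynomial R}
    (hF : IsNewtonPolynomial m (fun j => T.tr (i ^ (j + 1))) F) :
    ∃ N : ℕ, T.tr c = 2 * m * N := by
  refine exists_nat_eq_two_mul_of_isNewtonPolynomial hF ?_ ?_ fun k => ?_
  · simpa using tr_eq_zero_of_skew hi.st_eq
  · change T.tr (i ^ 2) = _
    rw [pow_two, hii, map_neg]
  · have : i ^ (k + 2 + 1) = -i ^ (k + 1) := by
      rw [pow_succ', pow_succ', ← mul_assoc, hii, pow_succ', neg_mul, ← mul_assoc, hi.left]
    rw [this, map_neg]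

theorem symm_skew_decomposition (hR : HasNoRealExtension R) (hc : T.IsMinProj c) {y : B}
    (hcy : c * y = y) (hyc : y * c = y) : ∃ r : R, ∃ x, T.IsSkewIn c x ∧ y = r • c + x := by
  have h1 : c * T.st y = T.st y := by
    have := congrArg T.st hyc
    rwa [T.st_mul, hc.st_eq] at this
  have h2 : T.st y * c = T.st y := by
    have := congrArg T.st hcy
    rwa [T.st_mul, hc.st_eq] at this
  obtain ⟨r, hr⟩ := hc.exists_smul_of_symm hR (x := y + T.st y)
    (by rw [map_add, T.st_st, add_comm]) (by rw [mul_add, hcy, h1]) (by rw [add_mul, hyc, h2])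
  refine ⟨r / 2, (2⁻¹ : R) • (y - T.st y), IsSkewIn.smul ⟨?_, ?_, ?_⟩ _, ?_⟩
  · rw [map_sub, T.st_st]; abel
  · rw [mul_sub, hcy, h1]
  · rw [sub_mul, hyc, h2]
  · rw [div_eq_inv_mul, mul_smul, ← hr, ← smul_add]
    have : y + T.st y + (y - T.st y) = (2 : R) • y := by rw [two_smul]; abel
    rw [this, smul_smul, inv_mul_cancel₀ two_ne_zero, one_smul]

theorem mem_span_of_skew_mem_span (hR : HasNoRealExtension R) (hc : T.IsMinProj c) {d : ℕ}
    {q : Fin d → B} (h0 : c ∈ Set.range q)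
    (hq : ∀ x, T.IsSkewIn c x → x ∈ Submodule.span R (Set.range q)) {y : B}
    (hcy : c * y = y) (hyc : y * c = y) : y ∈ Submodule.span R (Set.range q) := by
  obtain ⟨r, x, hx, rfl⟩ := symm_skew_decomposition hR hc hcy hyc
  exact add_mem (Submodule.smul_mem _ _ (Submodule.subset_span h0)) (hq x hx)

theorem IsMinProj.exists_isCornerBasis (hR : HasNoRealExtension R) (hc : T.IsMinProj c) :
    ∃ d : ℕ, ∃ q : Fin d → B, T.IsCornerBasis c q := by
  by_cases h1 : ∀ x, T.IsSkewIn c x → x = 0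
  · obtain ⟨N, hN⟩ := hc.toIsProj.tr_eq_natCast
    refine ⟨1, ![c], ?_, ?_, ?_, ?_, fun y => ?_, ⟨N, by simp [hN]⟩, one_pos⟩
    · simp [hc.mul_self]
    · simp [hc.mul_self]
    · simp [hc.mul_self, hc.st_eq]
    · intro a b
      fin_cases a; fin_cases b; simp [hc.mul_self, hc.st_eq]
    · exact mem_span_of_skew_mem_span hR hc ⟨0, rfl⟩ fun x hx => by simp [h1 x hx]
  push Not at h1
  obtain ⟨x, hx, hx0⟩ := h1
  obtain ⟨r, -, hi, hii⟩ := hc.exists_normalize hR hx hx0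
  generalize r • x = i at hi hii
  have hsi : T.st i = -i := hi.st_eq
  have htri : T.tr i = 0 := tr_eq_zero_of_skew hsi
  by_cases h2 : ∀ x, T.IsSkewIn c x → x * i = -(i * x) → x = 0
  · obtain ⟨F, hF⟩ := T.newton i
    obtain ⟨N, hN⟩ := hi.tr_eq_two_mul hii hF
    refine ⟨2, ![c, i], ?_, ?_, ?_, ?_, fun y => ?_, ⟨N, by simp [hN]⟩, two_pos⟩
    · intro a; fin_cases a <;> simp [hc.mul_self, hi.left]
    · intro a; fin_cases a <;> simp [hc.mul_self, hi.right]
    · intro a; fin_cases a <;> simp [hc.mul_self, hc.st_eq, hsi, hii]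
    · intro a b
      fin_cases a <;> fin_cases b <;>
        simp [hc.mul_self, hc.st_eq, hsi, hii, hi.left, hi.right, htri]
    · refine mem_span_of_skew_mem_span hR hc ⟨0, rfl⟩ fun x hx => ?_
      obtain ⟨r, hr⟩ := hc.exists_orthogonalize hR hi hii hx
      rw [sub_eq_zero.mp (h2 _ (hx.sub (hi.smul r)) hr)]
      exact Submodule.smul_mem _ _ (Submodule.subset_span ⟨1, rfl⟩)
  push Not at h2
  obtain ⟨x, hx, hxi, hx0⟩ := h2
  obtain ⟨r, -, hj, hjj⟩ := hc.exists_normalize hR hx hx0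
  have hji : (r • x) * i = -(i * (r • x)) := by
    rw [smul_mul_assoc, mul_smul_comm, hxi, smul_neg]
  generalize r • x = j at hj hjj hji
  have hij : i * j = -(j * i) := by rw [hji, neg_neg]
  have hk := hi.mul hj hij
  have hsj : T.st j = -j := hj.st_eq
  have htrj : T.tr j = 0 := tr_eq_zero_of_skew hsj
  have htrk : T.tr (i * j) = 0 := tr_eq_zero_of_skew hk.st_eq
  have htrk' : T.tr (j * i) = 0 := by rw [T.tr_comm, htrk]
  have hik : i * (i * j) = -j := by rw [← mul_assoc, hii, neg_mul, hj.left]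
  have hki : (i * j) * i = j := by rw [hij, neg_mul, mul_assoc, hii, mul_neg, neg_neg, hj.right]
  have hkj : (i * j) * j = -i := by rw [mul_assoc, hjj, mul_neg, hi.right]
  have hjk : j * (i * j) = i := by rw [hij, mul_neg, ← mul_assoc, hjj, neg_mul, neg_neg, hi.left]
  have hkk : (i * j) * (i * j) = -c := by rw [← mul_assoc, hki, hjj]
  obtain ⟨F, hF⟩ := T.newton_skew i j hsi hsj
  obtain ⟨N, hN⟩ := hk.tr_eq_two_mul hkk hF
  have hlast : ∀ y, T.IsSkewIn c y → y * i = -(i * y) → y * j = -(j * y) →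
      y * (i * j) = -((i * j) * y) → y = 0 := by
    intro y hy hyi hyj hyk
    have h3 : y * (i * j) = (i * j) * y := by
      rw [← mul_assoc, hyi, neg_mul, mul_assoc, hyj, mul_neg, neg_neg, mul_assoc]
    have h4 : (2 : R) • (i * j * y) = 0 := by
      rw [two_smul]
      nth_rewrite 1 [← h3]
      rw [hyk, neg_add_cancel]
    have h5 : i * j * y = 0 := (smul_eq_zero.mp h4).resolve_left two_ne_zero
    have h6 : i * j * (i * j * y) = -y := by rw [← mul_assoc, hkk, neg_mul, hy.left]
    rw [h5, mul_zero] at h6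
    exact neg_eq_zero.mp h6.symm
  refine ⟨4, ![c, i, j, i * j], ?_, ?_, ?_, ?_, fun y => ?_, ⟨N, ?_⟩, four_pos⟩
  · intro a; fin_cases a <;> simp [hc.mul_self, hi.left, hj.left, hk.left]
  · intro a; fin_cases a <;> simp [hc.mul_self, hi.right, hj.right, hk.right]
  · intro a; fin_cases a <;> simp [hc.mul_self, hc.st_eq, hsi, hii, hsj, hjj, hk.st_eq, hkk]
  · intro a b
    fin_cases a <;> fin_cases b <;>
      simp [hc.mul_self, hc.st_eq, hsi, hii, hi.left, hi.right, htri, hsj, hjj, hj.left, hj.right,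
        htrj, hk.st_eq, hkk, hk.left, hk.right, htrk, hik, hki, hkj, hjk, htrk']
  · refine mem_span_of_skew_mem_span hR hc ⟨0, rfl⟩ fun x hx => ?_
    obtain ⟨r, hr⟩ := hc.exists_orthogonalize hR hi hii hx
    obtain ⟨s, hs⟩ := hc.exists_orthogonalize hR hj hjj (hx.sub (hi.smul r))
    obtain ⟨t, ht⟩ := hc.exists_orthogonalize hR hk hkk ((hx.sub (hi.smul r)).sub (hj.smul s))
    have hz := hlast _ (((hx.sub (hi.smul r)).sub (hj.smul s)).sub (hk.smul t))
      (by
        simp only [sub_mul, mul_sub, smul_mul_assoc, mul_smul_comm] at hr ⊢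
        rw [hr, hki, hik, hji]
        simp only [smul_neg]; abel)
      (by
        simp only [sub_mul, mul_sub, smul_mul_assoc, mul_smul_comm] at hs ⊢
        rw [hs, hkj, hjk]
        simp only [smul_neg]; abel) ht
    have hx' : x = r • i + s • j + t • (i * j) := by
      rw [sub_sub, sub_sub] at hz
      rw [sub_eq_zero.mp hz]; abel
    rw [hx']
    refine add_mem (add_mem ?_ ?_) ?_ <;> refine Submodule.smul_mem _ _ (Submodule.subset_span ?_)
    · exact ⟨1, rfl⟩
    · exact ⟨2, rfl⟩
    · exact ⟨3, rfl⟩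
  · rw [hN]; push_cast; ring

end Corner

end TraceStarAlgebra

end DivisionCorner

section TraceRepresentation

namespace TraceStarAlgebra

variable {R B : Type} [Field R] [LinearOrder R] [Ring B] [Algebra R B]

/-- A possibly non-unital orthogonal representation whose trace is the compression of `T.tr`
by `z`. -/
structure CompressedRep (T : TraceStarAlgebra R B) (z : B) (ι : Type) [Fintype ι]
    [DecidableEq ι] where
  /-- The underlying linear map. -/
  toFun : B →ₗ[R] Matrix ι ι R
  map_one : toFun 1 = 1
  map_mul : ∀ x y, toFun (x * y) = toFun x * toFun y
  map_st : ∀ x, toFun (T.st x) = (toFun x)ᵀ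
  trace : ∀ x, (toFun x).trace = T.tr (z * x)

variable {T : TraceStarAlgebra R B}

/-- The direct sum of two compressed representations. -/
theorem CompressedRep.add {p q : B} {ι κ : Type} [Fintype ι] [DecidableEq ι] [Fintype κ]
    [DecidableEq κ] (ρ : T.CompressedRep p ι) (σ : T.CompressedRep q κ) :
    Nonempty (T.CompressedRep (p + q) (ι ⊕ κ)) := by
  refine ⟨⟨⟨⟨fun x => fromBlocks (ρ.toFun x) 0 0 (σ.toFun x), fun x y => ?_⟩, fun r x => ?_⟩,
    ?_, fun x y => ?_, fun x => ?_, fun x => ?_⟩⟩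
  · simp [fromBlocks_add]
  · simp [fromBlocks_smul]
  · simp [ρ.map_one, σ.map_one]
  · simp [ρ.map_mul, σ.map_mul, fromBlocks_multiply]
  · simp [ρ.map_st, σ.map_st, fromBlocks_transpose]
  · rw [add_mul, map_add, ← ρ.trace, ← σ.trace]
    simp [Matrix.trace]

variable [IsStrictOrderedRing R]

/-- A greedy choice of orthogonal partial isometries with initial projection `c`. -/
theorem exists_partial_isometries (hR : HasNoRealExtension R) {c : B} (hc : T.IsMinProj c)
    (N : ℕ) : ∀ f, T.IsProj f → T.tr f = N → ∃ (k : ℕ) (u : Fin k → B),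
      (∀ i j, T.st (u i) * u j = if i = j then c else 0) ∧ (∀ i, f * u i = u i) ∧
      (∀ i, u i * c = u i) ∧ ∀ x, f * x * c = ∑ i, u i * T.st (u i) * (x * c) := by
  induction N using Nat.strong_induction_on with
  | _ N ih =>
  intro f hf hN
  by_cases h0 : ∀ x, f * x * c = 0
  · exact ⟨0, Fin.elim0, fun i => i.elim0, fun i => i.elim0, fun i => i.elim0,
      fun x => by simp [h0 x]⟩
  push Not at h0
  obtain ⟨x, hx⟩ := h0
  obtain ⟨s, hs⟩ := hc.exists_smul_of_symm hR (x := T.st (f * x * c) * (f * x * c))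
    (by rw [T.st_mul, T.st_st])
    (by rw [T.st_mul (f * x) c, hc.st_eq]; simp only [← mul_assoc, hc.mul_self])
    (by rw [mul_assoc, mul_assoc _ c c, hc.mul_self])
  have hpos := T.tr_st_mul_self_pos hx
  rw [hs, map_smul, smul_eq_mul] at hpos
  have hs0 : 0 < s := pos_of_mul_pos_left hpos (hc.toIsProj.tr_pos hc.ne_zero).le
  obtain ⟨y, hy, hyy⟩ := hR.polynomialIVT.exists_sq hs0.le
  have hy0 : y ≠ 0 := by rintro rfl; simp at hyy; exact hs0.ne hyy
  obtain ⟨v, hv⟩ : ∃ v, v = y⁻¹ • (f * x * c) := ⟨_, rfl⟩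
  have hvv : T.st v * v = c := by
    rw [hv, map_smul, smul_mul_smul_comm, hs, ← mul_inv, hyy, smul_smul,
      inv_mul_cancel₀ hs0.ne', one_smul]
  have hfv : f * v = v := by
    rw [hv, mul_smul_comm, ← mul_assoc, ← mul_assoc, hf.mul_self]
  have hvc : v * c = v := by rw [hv, smul_mul_assoc, mul_assoc, hc.mul_self]
  have hvf : T.st v * f = T.st v := by
    have := congrArg T.st hfv
    rwa [T.st_mul, hf.st_eq] at this
  have hproj : T.IsProj (v * T.st v) := by
    refine ⟨by rw [T.st_mul, T.st_st], ?_⟩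
    rw [mul_assoc, ← mul_assoc (T.st v), hvv, ← mul_assoc, hvc]
  have hsub := hf.sub hproj (by rw [← mul_assoc, hfv])
  obtain ⟨M, hM⟩ := hsub.tr_eq_natCast
  have hlt : M < N := by
    have h1 := hc.toIsProj.tr_pos hc.ne_zero
    rw [map_sub, hN, T.tr_comm, hvv] at hM
    have : (M : R) < N := by rw [← hM]; linarith
    exact_mod_cast this
  obtain ⟨k, u, huu, hfu, huc, hsum⟩ := ih M hlt _ hsub hM
  have hvu : ∀ i, T.st v * u i = 0 := fun i => by
    rw [← hfu i, ← mul_assoc, mul_sub, hvf, ← mul_assoc, hvv, ← hvc, T.st_mul, hc.st_eq,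
      ← mul_assoc, hc.mul_self, sub_self, zero_mul]
  have huv : ∀ i, T.st (u i) * v = 0 := fun i => by
    have := congrArg T.st (hvu i)
    rwa [T.st_mul, T.st_st, map_zero] at this
  refine ⟨k + 1, Fin.cons v u, ?_, ?_, ?_, fun x => ?_⟩
  · intro i j
    refine Fin.cases ?_ (fun i => ?_) i <;> refine Fin.cases ?_ (fun j => ?_) j
    · simp [hvv]
    · simp [hvu, (Fin.succ_ne_zero j).symm]
    · simp [huv, Fin.succ_ne_zero i]
    · simp [huu]
  · intro i
    refine Fin.cases ?_ (fun i => ?_) i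
    · simpa using hfv
    · rw [Fin.cons_succ, ← hfu i, ← mul_assoc, mul_sub, hf.mul_self, ← mul_assoc, hfv]
  · intro i
    refine Fin.cases ?_ (fun i => ?_) i
    · simpa using hvc
    · simpa using huc i
  · rw [Fin.sum_univ_succ]
    simp only [Fin.cons_zero, Fin.cons_succ]
    rw [← hsum]
    simp only [sub_mul, mul_assoc]
    abel

/-- The representation on the left ideal `B c` given by an orthogonal basis `w`. -/
theorem exists_compressedRep_of_basis {c p : B} {α : Type} [Fintype α] [DecidableEq α]
    (w : α → B) {t : R} (ht : 0 < t)
    (hw : ∀ a b, T.tr (T.st (w a) * w b) = if a = b then t else 0) (hwc : ∀ a, w a * c = w a)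
    (hspan : ∀ x, x * c = x → x ∈ Submodule.span R (Set.range w)) {d m : ℕ}
    (hp : ∑ a, w a * T.st (w a) = (d : R) • p) (hdm : t = d * m) :
    Nonempty (T.CompressedRep p (α × Fin m)) := by
  have hexp : ∀ x, x * c = x → ∑ a, (t⁻¹ * T.tr (T.st (w a) * x)) • w a = x := by
    intro x hx
    obtain ⟨l, rfl⟩ := (Submodule.mem_span_range_iff_exists_fun R).mp (hspan x hx)
    refine Finset.sum_congr rfl fun a _ => ?_
    congr 1
    simp [Finset.mul_sum, hw, ht.ne', mul_comm]
  let ρ : B →ₗ[R] Matrix α α R :=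
    { toFun := fun x => Matrix.of fun a b => t⁻¹ * T.tr (T.st (w a) * x * w b)
      map_add' := fun x y => by ext a b; simp [mul_add, add_mul]
      map_smul' := fun r x => by ext a b; simp; ring }
  have hρ : ∀ x a b, ρ x a b = t⁻¹ * T.tr (T.st (w a) * x * w b) := fun _ _ _ => rfl
  have hone : ρ 1 = 1 := by
    ext a b
    rw [hρ, mul_one, hw, Matrix.one_apply, mul_ite, mul_zero, inv_mul_cancel₀ ht.ne']
  have hmul : ∀ x y, ρ (x * y) = ρ x * ρ y := fun x y => by
    ext a b
    have h := hexp (y * w b) (by rw [mul_assoc, hwc])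
    rw [Matrix.mul_apply, hρ]
    rw [show T.st (w a) * (x * y) * w b = T.st (w a) * x * (y * w b) by simp only [mul_assoc], ← h]
    simp only [Finset.mul_sum, map_sum, mul_smul_comm, map_smul, smul_eq_mul, hρ, mul_assoc]
    refine Finset.sum_congr rfl fun e _ => ?_
    ring
  have hst : ∀ x, ρ (T.st x) = (ρ x)ᵀ := fun x => by
    ext a b
    rw [transpose_apply, hρ, hρ, ← T.tr_st]
    simp only [T.st_mul, T.st_st, mul_assoc]
  have htr : ∀ x, (ρ x).trace * m = T.tr (p * x) := fun x => by
    have : ∀ a, T.tr (T.st (w a) * x * w a) = T.tr (w a * T.st (w a) * x) := fun a => by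
      rw [T.tr_comm, mul_assoc]
    simp only [Matrix.trace, Matrix.diag, hρ, ← Finset.mul_sum, this]
    rw [← map_sum, ← Finset.sum_mul, hp, smul_mul_assoc, map_smul, smul_eq_mul, hdm]
    have : (d : R) * m ≠ 0 := hdm ▸ ht.ne'
    have h1 := left_ne_zero_of_mul this
    have h2 := right_ne_zero_of_mul this
    field_simp
  refine ⟨⟨⟨⟨fun x => kronecker (ρ x) (1 : Matrix (Fin m) (Fin m) R), fun x y => ?_⟩,
    fun r x => ?_⟩, ?_, ?_, ?_, ?_⟩⟩
  · simp only [map_add, kronecker, kroneckerMap_add_left _ add_mul]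
  · simp only [map_smul, kronecker, RingHom.id_apply]
    exact smul_kronecker r (ρ x) 1
  · simp [hone]
  · intro x y
    simp [hmul, ← mul_kronecker_mul]
  · intro x
    ext ⟨a, i⟩ ⟨b, j⟩
    change ρ (T.st x) a b * (1 : Matrix (Fin m) (Fin m) R) i j =
      ρ x b a * (1 : Matrix (Fin m) (Fin m) R) j i
    rw [hst, transpose_apply, ← transpose_apply (1 : Matrix (Fin m) (Fin m) R) i j, transpose_one]
  · intro x
    simp [← htr, trace_kronecker]

theorem exists_compressedRep (hR : HasNoRealExtension R) (N : ℕ) : ∀ z, T.IsProj z →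
    (∀ x, z * x = x * z) → T.tr z = N → ∃ (ι : Type) (_ : Fintype ι) (_ : DecidableEq ι),
      Nonempty (T.CompressedRep z ι) := by
  induction N using Nat.strong_induction_on with
  | _ N ih =>
  intro z hz hcen hN
  by_cases h0 : z = 0
  · refine ⟨Empty, inferInstance, inferInstance, ⟨⟨0, ?_, ?_, ?_, ?_⟩⟩⟩
    · exact Subsingleton.elim _ _
    · exact fun x y => Subsingleton.elim _ _
    · exact fun x => Subsingleton.elim _ _
    · simp [h0]
  obtain ⟨c, hc, hzc⟩ := exists_isMinProj hz h0
  obtain ⟨k, u, huu, hzu, huc, hsum⟩ := exists_partial_isometries hR hc N z hz hN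
  obtain ⟨d, q, hq⟩ := hc.exists_isCornerBasis hR
  have hcu : ∀ i, c * T.st (u i) = T.st (u i) := fun i => by
    have := congrArg T.st (huc i)
    rwa [T.st_mul, hc.st_eq] at this
  obtain ⟨p, hpdef⟩ : ∃ p, p = ∑ i, u i * T.st (u i) := ⟨_, rfl⟩
  have hpst : T.st p = p := by
    rw [hpdef, map_sum]
    exact Finset.sum_congr rfl fun i _ => by rw [T.st_mul, T.st_st]
  have hpu : ∀ i, p * u i = u i := fun i => by
    rw [hpdef, Finset.sum_mul]
    simp [mul_assoc, huu, huc]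
  have hzp : z * p = p := by
    rw [hpdef, Finset.mul_sum]
    exact Finset.sum_congr rfl fun i _ => by rw [← mul_assoc, hzu]
  have hpp : T.IsProj p := by
    refine ⟨hpst, ?_⟩
    nth_rewrite 2 3 [hpdef]
    rw [Finset.mul_sum]
    exact Finset.sum_congr rfl fun i _ => by rw [← mul_assoc, hpu]
  have hzxc : ∀ x, z * x * c = p * (x * c) := fun x => by rw [hsum, hpdef, Finset.sum_mul]
  have hpxp : ∀ x, x * p = p * x * p := fun x => by
    nth_rewrite 1 [← hzp]
    rw [← mul_assoc, ← hcen, hpdef, Finset.mul_sum, Finset.mul_sum, ← hpdef]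
    refine Finset.sum_congr rfl fun i _ => ?_
    rw [← mul_assoc, ← mul_assoc]
    congr 1
    rw [← huc i, ← mul_assoc, mul_assoc z, hzxc]
    simp only [mul_assoc]
  have hpcen : ∀ x, p * x = x * p := fun x => by
    have := congrArg T.st (hpxp (T.st x))
    simp only [T.st_mul, T.st_st, hpst] at this
    rw [this, ← mul_assoc, ← hpxp]
  have hpc : p * c ≠ 0 := fun h => by
    have := hzxc 1
    rw [mul_one, one_mul, hzc, h] at this
    exact hc.ne_zero this
  have hp0 : p ≠ 0 := by rintro rfl; simp at hpc
  have hcc := hzxc 1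
  rw [mul_one, one_mul, hzc] at hcc
  obtain ⟨m, hm⟩ := hq.dvd
  have hbasis : Nonempty (T.CompressedRep p ((Fin k × Fin d) × Fin m)) := by
    refine exists_compressedRep_of_basis (c := c) (fun a => u a.1 * q a.2)
      (hc.toIsProj.tr_pos hc.ne_zero) ?_ ?_ ?_ ?_ hm
    · rintro ⟨i, a⟩ ⟨j, b⟩
      have : T.st (u i * q a) * (u j * q b) = T.st (q a) * (T.st (u i) * u j) * q b := by
        simp only [T.st_mul, mul_assoc]
      simp only [this, huu]
      by_cases hij : i = j
      · simp [hij, mul_assoc, hq.left, hq.tr_eq]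
      · simp [hij]
    · rintro ⟨i, a⟩
      rw [mul_assoc, hq.right]
    · intro x hx
      -- every element of `B c` lies in the image of `p`
      have hpx : p * x = x := by rw [hpcen, ← hx, mul_assoc, ← hpcen, ← hcc]
      rw [← hpx, hpdef, Finset.sum_mul]
      refine Submodule.sum_mem _ fun i _ => ?_
      have h := hq.span (T.st (u i) * x) (by rw [← mul_assoc, hcu]) (by rw [mul_assoc, hx])
      rw [mul_assoc]
      obtain ⟨l, hl⟩ := (Submodule.mem_span_range_iff_exists_fun R).mp h
      rw [← hl, Finset.mul_sum]
      refine Submodule.sum_mem _ fun a _ => ?_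
      rw [mul_smul_comm]
      exact Submodule.smul_mem _ _ (Submodule.subset_span ⟨(i, a), rfl⟩)
    · rw [Fintype.sum_prod_type, hpdef, Finset.smul_sum]
      refine Finset.sum_congr rfl fun i _ => ?_
      have : ∀ a, u i * q a * T.st (u i * q a) = u i * T.st (u i) := fun a => by
        rw [T.st_mul, mul_assoc, ← mul_assoc (q a), hq.mul_st, hcu]
      simp [this, ← Nat.cast_smul_eq_nsmul R]
  have hsub := hz.sub hpp hzp
  obtain ⟨M, hM⟩ := hsub.tr_eq_natCast
  have hlt : M < N := by
    have h1 := hpp.tr_pos hp0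
    rw [map_sub, hN] at hM
    have : (M : R) < N := by rw [← hM]; linarith
    exact_mod_cast this
  obtain ⟨ι, _, _, ⟨σ⟩⟩ := ih M hlt _ hsub (fun x => by rw [sub_mul, mul_sub, hcen, hpcen]) hM
  obtain ⟨ρ⟩ := hbasis
  obtain ⟨τ⟩ := ρ.add σ
  rw [add_sub_cancel] at τ
  exact ⟨_, inferInstance, inferInstance, ⟨τ⟩⟩

/-- A trace star algebra of integral dimension is represented by real matrices over a real
closed field, compatibly with involution and trace. -/
theorem exists_representation (T : TraceStarAlgebra R B) (hR : HasNoRealExtension R) {n : ℕ}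
    (hn : T.tr 1 = n) : ∃ ρ : B →ₐ[R] Matrix (Fin n) (Fin n) R,
      (∀ x, ρ (T.st x) = (ρ x)ᵀ) ∧ ∀ x, (ρ x).trace = T.tr x := by
  obtain ⟨ι, _, _, ⟨ρ⟩⟩ := exists_compressedRep hR n (T := T) 1 ⟨T.st_one, mul_one 1⟩
    (fun x => by rw [one_mul, mul_one]) hn
  have hcard : Fintype.card ι = n := by
    have h := ρ.trace 1
    rw [ρ.map_one, trace_one, mul_one, hn] at h
    exact_mod_cast h
  let e : ι ≃ Fin n := Fintype.equivFinOfCardEq hcard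
  let σ : B →ₐ[R] Matrix ι ι R := AlgHom.ofLinearMap ρ.toFun ρ.map_one ρ.map_mul
  refine ⟨(reindexAlgEquiv R R e).toAlgHom.comp σ, fun x => ?_, fun x => ?_⟩
  · change reindex e e (ρ.toFun (T.st x)) = (reindex e e (ρ.toFun x))ᵀ
    rw [ρ.map_st]
    rfl
  · change (reindex e e (ρ.toFun x)).trace = _
    rw [← one_mul x, ← ρ.trace, one_mul]
    exact e.symm.sum_comp fun i => ρ.toFun x i i

end TraceStarAlgebra

end TraceRepresentation

section Gram

/-- A quadratic form over a subring of an ordered field which is nonnegative on vectors over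
the subring is nonnegative on vectors over the field. -/
theorem sum_mul_mul_nonneg_of_subring {R : Type*} [Field R] [LinearOrder R]
    [IsStrictOrderedRing R] (A : Subring R) (m : ℕ) :
    ∀ G : Fin m → Fin m → R, (∀ i j, G i j ∈ A) → (∀ i j, G i j = G j i) →
      (∀ v : Fin m → R, (∀ i, v i ∈ A) → 0 ≤ ∑ i, ∑ j, v i * v j * G i j) →
      ∀ v : Fin m → R, 0 ≤ ∑ i, ∑ j, v i * v j * G i j := by
  induction m with
  | zero => simp
  | succ m ih =>
  intro G hA hsymm hG v
  have hexp : ∀ (G : Fin (m + 1) → Fin (m + 1) → R), (∀ i j, G i j = G j i) →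
      ∀ v : Fin (m + 1) → R, ∑ i, ∑ j, v i * v j * G i j = v 0 * v 0 * G 0 0 +
        2 * (v 0 * ∑ j : Fin m, v j.succ * G 0 j.succ) +
        ∑ i : Fin m, ∑ j : Fin m, v i.succ * v j.succ * G i.succ j.succ := by
    intro G hsymm v
    have h1 : ∑ j : Fin m, v 0 * v j.succ * G 0 j.succ =
        v 0 * ∑ j : Fin m, v j.succ * G 0 j.succ := by
      rw [Finset.mul_sum]
      exact Finset.sum_congr rfl fun j _ => mul_assoc _ _ _
    have h2 : ∑ i : Fin m, v i.succ * v 0 * G i.succ 0 =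
        v 0 * ∑ j : Fin m, v j.succ * G 0 j.succ := by
      rw [Finset.mul_sum]
      exact Finset.sum_congr rfl fun j _ => by rw [hsymm j.succ 0]; ring
    simp only [Fin.sum_univ_succ, Finset.sum_add_distrib, h1, h2]
    ring
  have hdiag : ∀ i, 0 ≤ G i i := fun i => by
    have := hG (Pi.single i 1) fun j => by
      by_cases h : j = i
      · subst h; simp
      · simp [h]
    simpa [Pi.single_apply] using this
  rcases (hdiag 0).eq_or_lt with h0 | h0
  · have hb : ∀ j : Fin m, G 0 j.succ = 0 := fun j => by
      have := hG (Fin.cons (-(G j.succ j.succ + 1)) (Pi.single j (G 0 j.succ))) fun i => by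
        refine Fin.cases ?_ (fun i => ?_) i
        · exact A.neg_mem (A.add_mem (hA _ _) A.one_mem)
        · by_cases h : i = j
          · subst h; simpa using hA _ _
          · simp [h]
      rw [hexp G hsymm, ← h0] at this
      simp only [Fin.cons_zero, Fin.cons_succ, Pi.single_apply, ite_mul, mul_ite, zero_mul,
        mul_zero, Finset.sum_ite_eq', Finset.mem_univ, if_true] at this
      by_contra hne
      have h1 : 0 < G 0 j.succ * G 0 j.succ := mul_self_pos.mpr hne
      nlinarith [hdiag j.succ]
    rw [hexp G hsymm, ← h0]
    simp only [hb, mul_zero, Finset.sum_const_zero, zero_add]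
    refine ih (fun i j => G i.succ j.succ) (fun i j => hA _ _) (fun i j => hsymm _ _)
      (fun w hw => ?_) (fun i => v i.succ)
    have := hG (Fin.cons 0 w) fun i => by
      refine Fin.cases ?_ (fun i => ?_) i
      · exact A.zero_mem
      · simpa using hw i
    rw [hexp G hsymm] at this
    simpa using this
  · have hH : ∀ w : Fin m → R, ∑ i, ∑ j, w i * w j *
        (G 0 0 * G i.succ j.succ - G 0 i.succ * G 0 j.succ) =
        G 0 0 * (∑ i, ∑ j, w i * w j * G i.succ j.succ) -
          (∑ j, w j * G 0 j.succ) * ∑ j, w j * G 0 j.succ := fun w => by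
      rw [Finset.sum_mul_sum, Finset.mul_sum, ← Finset.sum_sub_distrib]
      refine Finset.sum_congr rfl fun i _ => ?_
      rw [Finset.mul_sum, ← Finset.sum_sub_distrib]
      exact Finset.sum_congr rfl fun j _ => by ring
    have hpos := ih (fun i j => G 0 0 * G i.succ j.succ - G 0 i.succ * G 0 j.succ)
      (fun i j => A.sub_mem (A.mul_mem (hA _ _) (hA _ _)) (A.mul_mem (hA _ _) (hA _ _)))
      (fun i j => by rw [hsymm i.succ]; ring) (fun w hw => ?_) (fun i => v i.succ)
    · rw [hH] at hpos
      rw [hexp G hsymm]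
      refine nonneg_of_mul_nonneg_right (a := G 0 0) ?_ h0
      nlinarith [sq_nonneg (G 0 0 * v 0 + ∑ j : Fin m, v j.succ * G 0 j.succ)]
    · rw [hH]
      have := hG (Fin.cons (-∑ j, w j * G 0 j.succ) fun j => G 0 0 * w j) fun i => by
        refine Fin.cases ?_ (fun i => ?_) i
        · exact A.neg_mem (A.sum_mem fun j _ => A.mul_mem (hw j) (hA _ _))
        · exact A.mul_mem (hA _ _) (hw i)
      rw [hexp G hsymm] at this
      simp only [Fin.cons_zero, Fin.cons_succ] at this
      have e1 : ∑ j : Fin m, G 0 0 * w j * G 0 j.succ = G 0 0 * ∑ j, w j * G 0 j.succ := by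
        rw [Finset.mul_sum]
        exact Finset.sum_congr rfl fun j _ => mul_assoc _ _ _
      have e2 : ∑ i : Fin m, ∑ j : Fin m, G 0 0 * w i * (G 0 0 * w j) * G i.succ j.succ =
          G 0 0 * G 0 0 * ∑ i, ∑ j, w i * w j * G i.succ j.succ := by
        rw [Finset.mul_sum]
        refine Finset.sum_congr rfl fun i _ => ?_
        rw [Finset.mul_sum]
        exact Finset.sum_congr rfl fun j _ => by ring
      rw [e1, e2] at this
      refine nonneg_of_mul_nonneg_right (a := G 0 0) ?_ h0
      linarith

end Gram

section TraceSubalgebra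

open Polynomial

variable {R K : Type} [Field R] [CommRing K] [Algebra R K] {n : ℕ}

/-- The coefficients of the characteristic polynomial lie in any subalgebra containing the traces
of the powers. -/
theorem Matrix.charpoly_coeff_mem_of_trace_pow_mem [CharZero R] {C : Subalgebra R K}
    {M : Matrix (Fin n) (Fin n) K} (h : ∀ j : ℕ, (M ^ (j + 1)).trace ∈ C) (k : ℕ) :
    M.charpoly.coeff k ∈ C := by
  have h1 := IsNewtonPolynomial.coeff_mem (C := C) one_ne_zero
    (fun j => ⟨(M ^ (j + 1)).trace, h j⟩) (isNewtonPolynomial_charpolyRev M)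
    (Polynomial.revAt M.charpoly.natDegree k)
  rwa [← Matrix.reverse_charpoly, Polynomial.coeff_reverse, Polynomial.revAt_invol] at h1

/-- Representations of a real trace subalgebra attached to positive characters of scalars. -/
theorem exists_representation_of_character [LinearOrder R] [IsStrictOrderedRing R]
    (hR : HasNoRealExtension R) [IsDomain K] [IsIntegrallyClosed K[X]]
    (𝔄 : Subalgebra R (Matrix (Fin n) (Fin n) K)) (𝒞 : Subalgebra R K)
    (hT : ∀ h ∈ 𝔄, hᵀ ∈ 𝔄) (htr : ∀ h ∈ 𝔄, h.trace ∈ 𝒞)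
    (hscal : ∀ c ∈ 𝒞, c • (1 : Matrix (Fin n) (Fin n) K) ∈ 𝔄)
    (Φ : 𝒞 →ₐ[R] R)
    (hpos : ∀ (h : Matrix (Fin n) (Fin n) K) (hh : h ∈ 𝔄),
      0 ≤ Φ ⟨(h * hᵀ).trace, htr _ (𝔄.mul_mem hh (hT h hh))⟩) :
    ∃ ρ : 𝔄 →ₐ[R] Matrix (Fin n) (Fin n) R,
      (∀ x : 𝔄, ρ ⟨(x : Matrix (Fin n) (Fin n) K)ᵀ, hT _ x.2⟩ = (ρ x)ᵀ) ∧
      ∀ x : 𝔄, (ρ x).trace = Φ ⟨(x : Matrix (Fin n) (Fin n) K).trace, htr _ x.2⟩ := by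
  let t : 𝔄 →ₗ[R] 𝔄 :=
    { toFun := fun x => ⟨(x : Matrix (Fin n) (Fin n) K)ᵀ, hT _ x.2⟩
      map_add' := fun x y => Subtype.ext (by simp)
      map_smul' := fun r x => Subtype.ext (by simp) }
  let trc : 𝔄 →ₗ[R] 𝒞 :=
    { toFun := fun x => ⟨(x : Matrix (Fin n) (Fin n) K).trace, htr _ x.2⟩
      map_add' := fun x y => Subtype.ext (by simp)
      map_smul' := fun r x => Subtype.ext (by simp) }
  let τ : 𝔄 →ₗ[R] R := Φ.toLinearMap ∘ₗ trc
  have trc_comm : ∀ x y, trc (x * y) = trc (y * x) := fun x y =>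
    Subtype.ext (Matrix.trace_mul_comm (x : Matrix (Fin n) (Fin n) K) y)
  have τ_comm : ∀ x y, τ (x * y) = τ (y * x) := fun x y => congrArg Φ (trc_comm x y)
  have t_t : ∀ x, t (t x) = x := fun x => Subtype.ext (transpose_transpose (x : Matrix (Fin n) (Fin n) K))
  have t_mul : ∀ x y, t (x * y) = t y * t x := fun x y => Subtype.ext (transpose_mul _ _)
  have τ_t : ∀ x, τ (t x) = τ x := fun x =>
    congrArg Φ (Subtype.ext (trace_transpose (x : Matrix (Fin n) (Fin n) K)) : trc (t x) = trc x)
  have τ_pos : ∀ x, 0 ≤ τ (x * t x) := fun x => hpos x x.2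
  let N : Ideal 𝔄 :=
    { carrier := {x | ∀ y, τ (y * x) = 0}
      add_mem' := fun {x x'} hx hx' y => by rw [mul_add, map_add, hx, hx', add_zero]
      zero_mem' := fun y => by rw [mul_zero, map_zero]
      smul_mem' := fun z x hx y => by rw [smul_eq_mul, ← mul_assoc]; exact hx _ }
  have hN2 : N.IsTwoSided := ⟨fun {x} b hx y => by
    rw [← mul_assoc, τ_comm, ← mul_assoc]; exact hx _⟩
  obtain ⟨B, _, _, π, hπ, hker⟩ : ∃ (B : Type) (_ : Ring B) (_ : Algebra R B) (π : 𝔄 →ₐ[R] B),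
      Function.Surjective π ∧ ∀ x y, π x = π y ↔ x - y ∈ N :=
    ⟨𝔄 ⧸ N, inferInstance, inferInstance, Ideal.Quotient.mkₐ R N,
      Ideal.Quotient.mkₐ_surjective R N, fun x y => Ideal.Quotient.mk_eq_mk_iff_sub_mem x y⟩
  obtain ⟨s, hs⟩ := π.toLinearMap.exists_rightInverse_of_surjective (LinearMap.range_eq_top.mpr hπ)
  have hsN : ∀ x, s (π x) - x ∈ N := fun x => (hker _ _).mp (LinearMap.congr_fun hs (π x))
  have hNt : ∀ x ∈ N, t x ∈ N := fun x hx y => by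
    rw [← τ_t, t_mul, t_t, τ_comm]; exact hx _
  have hNτ : ∀ x ∈ N, τ x = 0 := fun x hx => by simpa using hx 1
  have hNpos : ∀ x, τ (x * t x) = 0 → x ∈ N := fun x hx y => by
    have h : ∀ r : R, 0 ≤ 2 * r * τ (y * x) + r * r * τ (t y * y) := fun r => by
      have h1 := τ_pos (x + r • t y)
      have e : (x + r • t y) * t (x + r • t y) =
          x * t x + r • (x * y) + r • (t (x * y)) + (r * r) • (t y * y) := by
        rw [map_add, map_smul, t_t, t_mul, add_mul, mul_add, mul_add, smul_mul_assoc,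
          smul_mul_assoc, mul_smul_comm, mul_smul_comm, smul_smul]
        abel
      rw [e, map_add, map_add, map_add, map_smul, map_smul, map_smul, τ_t, hx, τ_comm x y] at h1
      simp only [smul_eq_mul] at h1
      linarith
    have hy : 0 ≤ τ (t y * y) := by have := τ_pos (t y); rwa [t_t] at this
    by_contra hne
    have h1 := h (-(τ (y * x)) / (τ (t y * y) + 1))
    have hd : 0 < τ (t y * y) + 1 := by linarith
    have e : 2 * (-(τ (y * x)) / (τ (t y * y) + 1)) * τ (y * x) +
        -(τ (y * x)) / (τ (t y * y) + 1) * (-(τ (y * x)) / (τ (t y * y) + 1)) * τ (t y * y) =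
        -(τ (y * x) ^ 2 * (τ (t y * y) + 2)) / (τ (t y * y) + 1) ^ 2 := by
      field_simp
      ring
    rw [e] at h1
    have h2 : 0 < τ (y * x) ^ 2 := by positivity
    exact absurd h1 (not_le.mpr (div_neg_of_neg_of_pos (by nlinarith) (by positivity)))
  have hst : ∀ x, (π.toLinearMap ∘ₗ t ∘ₗ s) (π x) = π (t x) := fun x => by
    refine (hker _ _).mpr ?_
    rw [LinearMap.comp_apply, ← map_sub]
    exact hNt _ (hsN x)
  have htau : ∀ x, (τ ∘ₗ s) (π x) = τ x := fun x => by
    rw [LinearMap.comp_apply, ← sub_eq_zero, ← map_sub]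
    exact hNτ _ (hsN x)
  let T : TraceStarAlgebra R B :=
    { st := π.toLinearMap ∘ₗ t ∘ₗ s
      tr := τ ∘ₗ s
      st_st := fun x => by
        obtain ⟨x, rfl⟩ := hπ x
        rw [hst, hst, t_t]
      st_mul := fun x y => by
        obtain ⟨x, rfl⟩ := hπ x
        obtain ⟨y, rfl⟩ := hπ y
        rw [← map_mul, hst, hst, hst, ← map_mul, t_mul]
      tr_comm := fun x y => by
        obtain ⟨x, rfl⟩ := hπ x
        obtain ⟨y, rfl⟩ := hπ y
        rw [← map_mul, ← map_mul, htau, htau, τ_comm]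
      tr_st := fun x => by
        obtain ⟨x, rfl⟩ := hπ x
        rw [hst, htau, htau, τ_t]
      tr_pos := fun x hx => by
        obtain ⟨x, rfl⟩ := hπ x
        rw [hst, ← map_mul, htau]
        refine (τ_pos x).lt_of_ne fun h => hx ?_
        rw [← map_zero π]
        exact (hker _ _).mpr (by rw [sub_zero]; exact hNpos x h.symm)
      newton := fun x => by
        obtain ⟨x, rfl⟩ := hπ x
        obtain ⟨F, hF⟩ := (isNewtonPolynomial_charpolyRev
          (x : Matrix (Fin n) (Fin n) K)).exists_map Φ one_ne_zero (fun j => trc (x ^ (j + 1)))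
        refine ⟨F, ?_⟩
        simp only [← map_pow, htau]
        exact hF
      newton_skew := fun x y hx hy => by
        have hskew : ∀ z : B, (π.toLinearMap ∘ₗ t ∘ₗ s) z = -z →
            ∃ w : 𝔄, π w = z ∧ t w = -w := fun z hz => by
          obtain ⟨w, rfl⟩ := hπ z
          rw [hst] at hz
          refine ⟨(2 : R)⁻¹ • (w - t w), ?_, ?_⟩
          · rw [map_smul, map_sub, hz, sub_neg_eq_add, ← two_smul R (π w), smul_smul,
              inv_mul_cancel₀ two_ne_zero, one_smul]
          · rw [map_smul, map_sub, t_t, ← smul_neg, neg_sub]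
        obtain ⟨x, rfl, hxt⟩ := hskew x hx
        obtain ⟨y, rfl, hyt⟩ := hskew y hy
        have : CharZero K := charZero_of_injective_algebraMap (algebraMap R K).injective
        obtain ⟨E, hE, hE0⟩ := exists_charpolyRev_eq_sq
          (S := (x : Matrix (Fin n) (Fin n) K)) (T := (y : Matrix (Fin n) (Fin n) K))
          (show ((t x : 𝔄) : Matrix (Fin n) (Fin n) K) = _ by rw [hxt]; rfl)
          (show ((t y : 𝔄) : Matrix (Fin n) (Fin n) K) = _ by rw [hyt]; rfl)
        have h1 := isNewtonPolynomial_charpolyRev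
          ((x : Matrix (Fin n) (Fin n) K) * (y : Matrix (Fin n) (Fin n) K))
        rw [hE] at h1
        obtain ⟨F, hF⟩ := (h1.of_mul_self hE0).exists_map Φ two_ne_zero
          (fun j => trc ((x * y) ^ (j + 1)))
        refine ⟨F, ?_⟩
        simp only [← map_mul, ← map_pow, htau]
        exact hF
      integral := fun x => by
        obtain ⟨x, rfl⟩ := hπ x
        obtain ⟨q, hq⟩ := (lifts_iff_coeff_lifts (f := (𝒞.val : 𝒞 →+* K))
          (x : Matrix (Fin n) (Fin n) K).charpoly).mpr fun k =>
          ⟨⟨_, Matrix.charpoly_coeff_mem_of_trace_pow_mem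
            (fun j => htr _ (𝔄.pow_mem x.2 _)) k⟩, rfl⟩
        let j : 𝒞 →+* 𝔄 :=
          { toFun := fun c => ⟨(c : K) • 1, hscal c c.2⟩
            map_one' := Subtype.ext (by simp)
            map_zero' := Subtype.ext (by simp)
            map_add' := fun c d => Subtype.ext (by simp [add_smul])
            map_mul' := fun c d => Subtype.ext (by simp [smul_smul, mul_comm]) }
        have hj : (π : 𝔄 →+* B).comp j = (algebraMap R B).comp (Φ : 𝒞 →+* R) := by
          ext c
          simp only [RingHom.comp_apply, RingHom.coe_coe]
          rw [← AlgHom.commutes π]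
          refine (hker _ _).mpr fun y => ?_
          have : trc (y * (j c - algebraMap R 𝔄 (Φ c))) =
              (c - algebraMap R 𝒞 (Φ c)) * trc y := by
            apply Subtype.ext
            change ((y : Matrix (Fin n) (Fin n) K) * ((c : K) • 1 -
              algebraMap R (Matrix (Fin n) (Fin n) K) (Φ c))).trace =
              ((c : K) - algebraMap R K (Φ c)) * (y : Matrix (Fin n) (Fin n) K).trace
            rw [Algebra.algebraMap_eq_smul_one, mul_sub, mul_smul_comm, mul_smul_comm, mul_one,
              trace_sub, trace_smul, trace_smul, smul_eq_mul, sub_mul, Algebra.smul_def]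
          change Φ (trc _) = 0
          rw [this, map_mul, map_sub, AlgHom.commutes]
          simp
        have hmonic : q.Monic := by
          refine Polynomial.monic_of_injective (f := (𝒞.val : 𝒞 →+* K)) Subtype.val_injective ?_
          have : q.map (𝒞.val : 𝒞 →+* K) = (x : Matrix (Fin n) (Fin n) K).charpoly := hq
          rw [this]
          exact Matrix.charpoly_monic _
        refine ⟨q.map (Φ : 𝒞 →+* R), hmonic.map _, ?_⟩
        rw [eval₂_map, ← hj]
        have h0 : q.eval₂ j x = 0 := by
          apply Subtype.val_injective
          have h1 := Polynomial.hom_eval₂ q j (𝔄.val : 𝔄 →+* Matrix (Fin n) (Fin n) K) x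
          have h2 : (𝔄.val : 𝔄 →+* Matrix (Fin n) (Fin n) K).comp j =
              (algebraMap K (Matrix (Fin n) (Fin n) K)).comp (𝒞.val : 𝒞 →+* K) := by
            ext1 c
            exact (Algebra.algebraMap_eq_smul_one (c : K)).symm
          have h3 : q.map (𝒞.val : 𝒞 →+* K) = (x : Matrix (Fin n) (Fin n) K).charpoly := hq
          rw [h2, ← eval₂_map, h3] at h1
          exact h1.trans (Matrix.aeval_self_charpoly _)
        have h1 := Polynomial.hom_eval₂ q j (π : 𝔄 →+* B) x
        rw [h0, map_zero] at h1
        exact h1.symm }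
  have hn : T.tr 1 = n := by
    change (τ ∘ₗ s) 1 = n
    rw [← map_one π, htau]
    have : trc 1 = (n : 𝒞) := Subtype.ext (by
      change (1 : Matrix (Fin n) (Fin n) K).trace = ((n : 𝒞) : K)
      simp)
    change Φ (trc 1) = n
    rw [this, map_natCast]
  obtain ⟨ρ, h1, h2⟩ := T.exists_representation hR hn
  refine ⟨ρ.comp π, fun x => ?_, fun x => ?_⟩
  · have := h1 (π x)
    change ρ ((π.toLinearMap ∘ₗ t ∘ₗ s) (π x)) = _ at this
    rw [hst] at this
    exact this
  · exact (h2 (π x)).trans (htau x)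

end TraceSubalgebra

section BaseChange

open scoped TensorProduct

variable {R : Type} [Field R] [Algebra ℝ R] {σ : Type}

/-- The character of the scalar extension of a real algebra of polynomials induced by a
character with values in the extension field. -/
theorem exists_baseChange_character (C : Subalgebra ℝ (MvPolynomial σ ℝ)) (φ : C →ₐ[ℝ] R) :
    ∃ (D : Subalgebra R (MvPolynomial σ R)) (Φ : D →ₐ[R] R)
      (hD : ∀ c ∈ C, MvPolynomial.map (algebraMap ℝ R) c ∈ D),
      (∀ d ∈ D, d ∈ Submodule.span R (MvPolynomial.map (algebraMap ℝ R) '' (C : Set _))) ∧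
      ∀ c : C, Φ ⟨_, hD c c.2⟩ = φ c := by
  let f : R ⊗[ℝ] C →ₐ[R] MvPolynomial σ R :=
    (MvPolynomial.algebraTensorAlgEquiv ℝ R).toAlgHom.comp
      (Algebra.TensorProduct.map (AlgHom.id R R) C.val)
  have hf1 : ∀ (r : R) (c : C), f (r ⊗ₜ c) = r • MvPolynomial.map (algebraMap ℝ R) (c : _) :=
    fun r c => by simp [f]
  have hf : Function.Injective f := by
    refine (MvPolynomial.algebraTensorAlgEquiv ℝ R).injective.comp ?_
    exact Module.Flat.lTensor_preserves_injective_linearMap (M := R) C.val.toLinearMap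
      Subtype.val_injective
  let Φ₀ : R ⊗[ℝ] C →ₐ[R] R :=
    Algebra.TensorProduct.lift (AlgHom.id R R) φ fun _ _ => Commute.all _ _
  let e := AlgEquiv.ofInjective f hf
  have hfc : ∀ c : C, f (1 ⊗ₜ c) = MvPolynomial.map (algebraMap ℝ R) (c : _) := fun c => by
    rw [hf1, one_smul]
  refine ⟨f.range, Φ₀.comp e.symm.toAlgHom, fun c hc => ⟨1 ⊗ₜ ⟨c, hc⟩, hfc _⟩, ?_, fun c => ?_⟩
  · rintro _ ⟨x, rfl⟩
    induction x using TensorProduct.induction_on with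
    | zero => simp
    | tmul r c =>
      change f (r ⊗ₜ c) ∈ _
      rw [hf1]
      exact Submodule.smul_mem _ _ (Submodule.subset_span ⟨c, c.2, rfl⟩)
    | add x y hx hy =>
      change f (x + y) ∈ _
      rw [map_add]
      exact Submodule.add_mem _ hx hy
  · have : e.symm ⟨_, ⟨1 ⊗ₜ c, hfc c⟩⟩ = 1 ⊗ₜ c := by
      rw [AlgEquiv.symm_apply_eq]
      exact Subtype.ext (hfc c).symm
    change Φ₀ (e.symm _) = _
    rw [this]
    simp [Φ₀]

/-- A trace algebra of polynomial matrices has a compatible matrix representation over a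
field without proper real extensions for each positive character of its scalars. -/
theorem exists_trace_representation [LinearOrder R] [IsStrictOrderedRing R]
    (hR : HasNoRealExtension R) {n : ℕ}
    (A : Subalgebra ℝ (Matrix (Fin n) (Fin n) (MvPolynomial σ ℝ)))
    (C : Subalgebra ℝ (MvPolynomial σ ℝ))
    (hT : ∀ h ∈ A, hᵀ ∈ A) (htr : ∀ h ∈ A, h.trace ∈ C)
    (hscal : ∀ c ∈ C, c • (1 : Matrix (Fin n) (Fin n) (MvPolynomial σ ℝ)) ∈ A)
    (φ : C →ₐ[ℝ] R)
    (hpos : ∀ (h : Matrix (Fin n) (Fin n) (MvPolynomial σ ℝ)) (hh : h ∈ A),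
      0 ≤ φ ⟨(h * hᵀ).trace, htr _ (A.mul_mem hh (hT h hh))⟩) :
    ∃ θ : A →ₐ[ℝ] Matrix (Fin n) (Fin n) R,
      (∀ (h : Matrix (Fin n) (Fin n) (MvPolynomial σ ℝ)) (hh : h ∈ A),
        θ ⟨hᵀ, hT h hh⟩ = (θ ⟨h, hh⟩)ᵀ) ∧
      ∀ (h : Matrix (Fin n) (Fin n) (MvPolynomial σ ℝ)) (hh : h ∈ A),
        (θ ⟨h, hh⟩).trace = φ ⟨h.trace, htr h hh⟩ := by
  obtain ⟨D, Φ, hD, hDspan, hΦ⟩ := exists_baseChange_character C φ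
  let m : MvPolynomial σ ℝ →ₐ[ℝ] MvPolynomial σ R :=
    MvPolynomial.mapAlgHom (Algebra.ofId ℝ R)
  have hm : ∀ p, m p = MvPolynomial.map (algebraMap ℝ R) p := fun p => rfl
  let M : Matrix (Fin n) (Fin n) (MvPolynomial σ ℝ) →ₐ[ℝ]
      Matrix (Fin n) (Fin n) (MvPolynomial σ R) := m.mapMatrix
  have hMT : ∀ h, (M h)ᵀ = M hᵀ := fun h => rfl
  have hMtr : ∀ h, (M h).trace = m h.trace := fun h => (AddMonoidHom.map_trace m h).symm
  have hMs : ∀ p : MvPolynomial σ ℝ, M (p • 1) = m p • 1 := fun p => by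
    ext1 i j
    simp [M, Matrix.one_apply, apply_ite m]
  let E : Subalgebra R (Matrix (Fin n) (Fin n) (MvPolynomial σ R)) := Algebra.adjoin R (M '' A)
  have hE : ∀ x ∈ E, x ∈ Submodule.span R (M '' (A : Set _)) := by
    have h1 : ((Submonoid.closure (M '' (A : Set _)) : Submonoid _) : Set _) ⊆
        SetLike.coe (Submodule.span R (M '' (A : Set _))) := by
      have : Submonoid.closure (M '' (A : Set _)) ≤ (A.map M).toSubmonoid :=
        Submonoid.closure_le.mpr fun x hx => hx
      exact fun x hx => Submodule.subset_span (this hx)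
    intro x hx
    rw [← Algebra.adjoin_eq_span_of_subset _ h1]
    exact hx
  have hME : ∀ h ∈ A, M h ∈ E := fun h hh => Algebra.subset_adjoin ⟨h, hh, rfl⟩
  have hET : ∀ x ∈ E, xᵀ ∈ E := fun x hx => by
    have hx' := hE x hx
    clear hx
    induction hx' using Submodule.span_induction with
    | mem x h => obtain ⟨h, hh, rfl⟩ := h; exact hME _ (hT h hh)
    | zero => rw [transpose_zero]; exact E.zero_mem
    | add x y _ _ hx hy => rw [transpose_add]; exact E.add_mem hx hy
    | smul r x _ hx => rw [transpose_smul]; exact E.smul_mem hx r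
  have hEtr : ∀ x ∈ E, x.trace ∈ D := fun x hx => by
    have hx' := hE x hx
    clear hx
    induction hx' using Submodule.span_induction with
    | mem x h => obtain ⟨h, hh, rfl⟩ := h; rw [hMtr]; exact hD _ (htr h hh)
    | zero => rw [trace_zero]; exact D.zero_mem
    | add x y _ _ hx hy => rw [trace_add]; exact D.add_mem hx hy
    | smul r x _ hx => rw [trace_smul]; exact D.smul_mem hx r
  have hEs : ∀ d ∈ D, d • (1 : Matrix (Fin n) (Fin n) (MvPolynomial σ R)) ∈ E := fun d hd => by
    have hd' := hDspan d hd
    clear hd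
    induction hd' using Submodule.span_induction with
    | mem d h => obtain ⟨c, hc, rfl⟩ := h; rw [← hm, ← hMs]; exact hME _ (hscal c hc)
    | zero => rw [zero_smul]; exact E.zero_mem
    | add x y _ _ hx hy => rw [add_smul]; exact E.add_mem hx hy
    | smul r x _ hx => rw [smul_assoc]; exact E.smul_mem hx r
  have hEpos : ∀ (x : Matrix (Fin n) (Fin n) (MvPolynomial σ R)) (hx : x ∈ E),
      0 ≤ Φ ⟨(x * xᵀ).trace, hEtr _ (E.mul_mem hx (hET x hx))⟩ := by
    intro x hx
    obtain ⟨k, r, h, rfl⟩ := Submodule.mem_span_set'.mp (hE x hx)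
    choose w hwA hw using fun i => (h i).2
    have hwij : ∀ i j, (w i * (w j)ᵀ).trace ∈ C := fun i j =>
      htr _ (A.mul_mem (hwA i) (hT _ (hwA j)))
    let G : Fin k → Fin k → R := fun i j => φ ⟨(w i * (w j)ᵀ).trace, hwij i j⟩
    have hcw : ∀ c : Fin k → C, ∑ i, (c i : MvPolynomial σ ℝ) • w i ∈ A := fun c =>
      A.sum_mem fun i _ => by
        rw [← one_mul (w i), ← smul_mul_assoc]
        exact A.mul_mem (hscal _ (c i).2) (hwA i)
    have htrace : ∀ c : Fin k → MvPolynomial σ ℝ,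
        ((∑ i, c i • w i) * (∑ i, c i • w i)ᵀ).trace =
          ∑ i, ∑ j, c i * c j * (w i * (w j)ᵀ).trace := fun c => by
      simp only [transpose_sum, Finset.sum_mul_sum, trace_sum, transpose_smul,
        smul_mul_smul_comm, trace_smul, smul_eq_mul]
    have h1 := sum_mul_mul_nonneg_of_subring (φ : C →+* R).range k G (fun i j => ⟨_, rfl⟩)
      (fun i j => by
        refine congrArg φ (Subtype.ext ?_)
        change (w i * (w j)ᵀ).trace = (w j * (w i)ᵀ).trace
        rw [← trace_transpose, transpose_mul, transpose_transpose]) (fun v hv => by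
        choose c hc using hv
        have h2 := hpos (∑ i, (c i : MvPolynomial σ ℝ) • w i) (hcw c)
        convert h2
        simp only [← hc]
        have e : (⟨((∑ i, (c i : MvPolynomial σ ℝ) • w i) *
            (∑ i, (c i : MvPolynomial σ ℝ) • w i)ᵀ).trace, htr _ (A.mul_mem (hcw c)
              (hT _ (hcw c)))⟩ : C) =
            ∑ i, ∑ j, c i * c j * ⟨(w i * (w j)ᵀ).trace, hwij i j⟩ := by
          refine Subtype.ext ((htrace fun i => c i).trans ?_)
          simp
        rw [e]
        simp [G]) r
    have e : (⟨((∑ i, r i • (h i : Matrix (Fin n) (Fin n) (MvPolynomial σ R))) *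
        (∑ i, r i • (h i : Matrix (Fin n) (Fin n) (MvPolynomial σ R)))ᵀ).trace,
          hEtr _ (E.mul_mem hx (hET _ hx))⟩ : D) =
        ∑ i, ∑ j, (r i * r j) • ⟨_, hD _ (hwij i j)⟩ := by
      apply Subtype.ext
      have (i : Fin k) : (h i : Matrix (Fin n) (Fin n) (MvPolynomial σ R)) = M (w i) := (hw i).symm
      simp only [transpose_sum, Finset.sum_mul_sum, trace_sum, transpose_smul,
        smul_mul_smul_comm, trace_smul, this, hMT, ← map_mul, hMtr]
      simp [hm]
    rw [e]
    convert h1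
    rw [map_sum]
    refine Finset.sum_congr rfl fun i _ => ?_
    rw [map_sum]
    refine Finset.sum_congr rfl fun j _ => ?_
    rw [map_smul, hΦ ⟨_, hwij i j⟩, smul_eq_mul]
  obtain ⟨ρ, hρ1, hρ2⟩ := exists_representation_of_character hR E D hET hEtr hEs Φ hEpos
  let θ : A →ₐ[ℝ] Matrix (Fin n) (Fin n) R :=
    (ρ.restrictScalars ℝ).comp
      ((M.comp A.val).codRestrict (E.restrictScalars ℝ) fun h => hME h h.2)
  refine ⟨θ, fun h hh => hρ1 ⟨M h, hME h hh⟩, fun h hh => ?_⟩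
  rw [← hΦ ⟨_, htr h hh⟩]
  refine (hρ2 ⟨M h, hME h hh⟩).trans (congrArg Φ (Subtype.ext ?_))
  exact hMtr h

end BaseChange

section TraceRing

variable {n g : ℕ}

theorem transpose_mem_genSet {m : MatP n g} (h : m ∈ genSet n g) : mᵀ ∈ genSet n g := by
  rcases h with ⟨j, rfl⟩ | ⟨j, rfl⟩
  · exact Or.inr ⟨j, rfl⟩
  · exact Or.inl ⟨j, (transpose_transpose _).symm⟩

theorem transpose_mem_traceRing {m : MatP n g} (h : m ∈ traceRing n g) : mᵀ ∈ traceRing n g := by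
  induction h using Algebra.adjoin_induction with
  | mem m h =>
    rcases h with h | ⟨w, hw, rfl⟩
    · exact Algebra.subset_adjoin (Or.inl (transpose_mem_genSet h))
    · refine Algebra.subset_adjoin (Or.inr ⟨w, hw, ?_⟩)
      rw [transpose_smul, transpose_one]
  | algebraMap r =>
    rw [Algebra.algebraMap_eq_smul_one, transpose_smul, transpose_one]
    exact Subalgebra.smul_mem _ (Subalgebra.one_mem _) r
  | add x y _ _ hx hy => rw [transpose_add]; exact Subalgebra.add_mem _ hx hy
  | mul x y _ _ hx hy => rw [transpose_mul]; exact Subalgebra.mul_mem _ hy hx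

/-- The polynomials whose scalar matrices lie in the trace ring. -/
def traceScalars (n g : ℕ) : Subalgebra ℝ (PolyRing n g) :=
  (traceRing n g).comap (IsScalarTower.toAlgHom ℝ (PolyRing n g) (MatP n g))

theorem mem_traceScalars {p : PolyRing n g} :
    p ∈ traceScalars n g ↔ p • (1 : MatP n g) ∈ traceRing n g := by
  rw [← Algebra.algebraMap_eq_smul_one]
  exact Iff.rfl

theorem trace_mem_traceScalars {m : MatP n g} (h : m ∈ traceRing n g) :
    m.trace ∈ traceScalars n g := by
  have h1 : ∀ x ∈ traceRing n g, x ∈ Algebra.adjoin (traceScalars n g) (genSet n g) := by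
    intro x hx
    induction hx using Algebra.adjoin_induction with
    | mem x h =>
      rcases h with h | ⟨w, hw, rfl⟩
      · exact Algebra.subset_adjoin h
      · have hwC : w.trace ∈ traceScalars n g :=
          mem_traceScalars.mpr (Algebra.subset_adjoin (Or.inr ⟨w, hw, rfl⟩))
        exact Subalgebra.smul_mem (Algebra.adjoin (traceScalars n g) (genSet n g))
          (Subalgebra.one_mem _) (⟨w.trace, hwC⟩ : traceScalars n g)
    | algebraMap r =>
      exact Subalgebra.algebraMap_mem _ (algebraMap ℝ (traceScalars n g) r)
    | add x y _ _ hx hy => exact Subalgebra.add_mem _ hx hy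
    | mul x y _ _ hx hy => exact Subalgebra.mul_mem _ hx hy
  have h2 : m ∈ Submodule.span (traceScalars n g)
      (SetLike.coe (Submonoid.closure (genSet n g))) := by
    rw [← Algebra.adjoin_eq_span]
    exact h1 m h
  clear h h1
  induction h2 using Submodule.span_induction with
  | mem w hw => exact mem_traceScalars.mpr (Algebra.subset_adjoin (Or.inr ⟨w, hw, rfl⟩))
  | zero => rw [trace_zero]; exact Subalgebra.zero_mem _
  | add x y _ _ hx hy => rw [trace_add]; exact Subalgebra.add_mem _ hx hy
  | smul c x _ hx =>
    have : (c • x).trace = (c : PolyRing n g) * x.trace := trace_smul (c : PolyRing n g) x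
    rw [this]
    exact Subalgebra.mul_mem _ c.2 hx

/-- Evaluation of polynomial matrices at a tuple of matrices over a field extension. -/
def evalMatHom {F : Type} [Field F] [Algebra ℝ F] (X : Fin g → Matrix (Fin n) (Fin n) F) :
    MatP n g →+* Matrix (Fin n) (Fin n) F :=
  (evalHom fun v => X v.1 v.2.1 v.2.2).mapMatrix

theorem evalMatHom_smul_one {F : Type} [Field F] [Algebra ℝ F]
    (X : Fin g → Matrix (Fin n) (Fin n) F) (p : PolyRing n g) :
    evalMatHom X (p • 1) = evalHom (fun v => X v.1 v.2.1 v.2.2) p • 1 := by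
  ext i j
  simp [evalMatHom, Matrix.one_apply, apply_ite (evalHom _)]

theorem trace_evalMatHom {F : Type} [Field F] [Algebra ℝ F]
    (X : Fin g → Matrix (Fin n) (Fin n) F) (h : MatP n g) :
    (evalMatHom X h).trace = evalHom (fun v => X v.1 v.2.1 v.2.2) h.trace := by
  simp [evalMatHom, Matrix.trace]

/-- Trace preserving involutive representations of the trace ring are evaluations. -/
theorem exists_eq_evalMatHom {F : Type} [Field F] [LinearOrder F] [IsStrictOrderedRing F]
    [Algebra ℝ F] (φ : traceScalars n g →ₐ[ℝ] F)
    (θ : traceRing n g →ₐ[ℝ] Matrix (Fin n) (Fin n) F)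
    (hT : ∀ (h : MatP n g) (hh : h ∈ traceRing n g),
      θ ⟨hᵀ, transpose_mem_traceRing hh⟩ = (θ ⟨h, hh⟩)ᵀ)
    (htr : ∀ (h : MatP n g) (hh : h ∈ traceRing n g),
      (θ ⟨h, hh⟩).trace = φ ⟨h.trace, trace_mem_traceScalars hh⟩) :
    ∃ X : Fin g → Matrix (Fin n) (Fin n) F,
      (∀ (h : MatP n g) (hh : h ∈ traceRing n g), θ ⟨h, hh⟩ = evalMatHom X h) ∧
      ∀ (p : PolyRing n g) (hp : p ∈ traceScalars n g),
        φ ⟨p, hp⟩ • (1 : Matrix (Fin n) (Fin n) F) = evalMatHom X (p • 1) := by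
  have hmul : ∀ (x y : MatP n g) (hx : x ∈ traceRing n g) (hy : y ∈ traceRing n g),
      θ ⟨x * y, Subalgebra.mul_mem _ hx hy⟩ = θ ⟨x, hx⟩ * θ ⟨y, hy⟩ := fun x y hx hy =>
    map_mul θ (⟨x, hx⟩ : traceRing n g) ⟨y, hy⟩
  have hconst : ∀ (r : ℝ) (hr : algebraMap ℝ (MatP n g) r ∈ traceRing n g),
      θ ⟨algebraMap ℝ (MatP n g) r, hr⟩ = algebraMap ℝ _ r := fun r hr => by
    rw [← θ.commutes r]
    exact congrArg θ (Subtype.ext (Subalgebra.coe_algebraMap (traceRing n g) r).symm)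
  have hscal : ∀ (p : PolyRing n g) (hp : p ∈ traceScalars n g),
      θ ⟨p • 1, mem_traceScalars.mp hp⟩ = φ ⟨p, hp⟩ • 1 := fun p hp => by
    set B := θ ⟨p • 1, mem_traceScalars.mp hp⟩ with hB
    set r := φ ⟨p, hp⟩ with hr
    have h1 : Bᵀ = B := by
      rw [hB, ← hT]
      exact congrArg θ (Subtype.ext (by simp))
    have h2 : B.trace = r * n := by
      rw [hB, htr, hr, ← map_natCast φ, ← map_mul]
      exact congrArg φ (Subtype.ext (by simp))
    have h3 : (B * B).trace = r * r * n := by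
      rw [hB, ← map_mul, hr, ← map_natCast φ, ← map_mul, ← map_mul]
      refine (htr _ (Subalgebra.mul_mem _ (mem_traceScalars.mp hp)
        (mem_traceScalars.mp hp))).trans (congrArg φ (Subtype.ext ?_))
      simp [mul_assoc]
    have h4 : ((B - r • 1) * (B - r • 1)ᵀ).trace = 0 := by
      rw [transpose_sub, h1, transpose_smul, transpose_one]
      simp only [sub_mul, mul_sub, trace_sub, smul_mul_assoc, mul_smul_comm, one_mul, mul_one,
        trace_smul, smul_eq_mul, h2, h3, trace_one, Fintype.card_fin]
      ring
    rw [← sub_eq_zero]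
    ext i j
    have h5 : ∀ i ∈ Finset.univ, ∀ j ∈ Finset.univ, (B - r • 1) i j * (B - r • 1) i j = 0 := by
      have hnn : ∀ i, 0 ≤ ∑ j, (B - r • 1) i j * (B - r • 1) i j := fun i =>
        Finset.sum_nonneg fun j _ => mul_self_nonneg _
      intro i hi
      refine (Finset.sum_eq_zero_iff_of_nonneg fun j _ => mul_self_nonneg _).mp ?_
      exact (Finset.sum_eq_zero_iff_of_nonneg fun i _ => hnn i).mp h4 i hi
    exact mul_self_eq_zero.mp (h5 i (Finset.mem_univ _) j (Finset.mem_univ _))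
  let X : Fin g → Matrix (Fin n) (Fin n) F := fun j =>
    θ ⟨genMat n g j, Algebra.subset_adjoin (Or.inl (Or.inl ⟨j, rfl⟩))⟩
  have hgen : ∀ (h : MatP n g) (hh : h ∈ traceRing n g), h ∈ genSet n g →
      θ ⟨h, hh⟩ = evalMatHom X h := by
    have h1 : ∀ j, X j = evalMatHom X (genMat n g j) := fun j => by
      ext a b
      simp [evalMatHom, genMat]
    rintro h hh (⟨j, rfl⟩ | ⟨j, rfl⟩)
    · exact h1 j
    · rw [hT _ (Algebra.subset_adjoin (Or.inl (Or.inl ⟨j, rfl⟩)))]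
      exact congrArg transpose (h1 j)
  have hsub : ∀ w ∈ Submonoid.closure (genSet n g), w ∈ traceRing n g := fun w hw =>
    (Submonoid.closure_le (S := (traceRing n g).toSubmonoid)).mpr
      (fun x hx => Algebra.subset_adjoin (Or.inl hx)) hw
  have hword : ∀ (w : MatP n g) (hw : w ∈ Submonoid.closure (genSet n g)),
      θ ⟨w, hsub w hw⟩ = evalMatHom X w := fun w hw => by
    induction hw using Submonoid.closure_induction with
    | mem w h => exact hgen w _ h
    | one => rw [map_one]; exact map_one θ
    | mul x y hx hy hx' hy' =>
      rw [map_mul, ← hx', ← hy']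
      exact hmul _ _ _ _
  have hall : ∀ (h : MatP n g) (hh : h ∈ traceRing n g), θ ⟨h, hh⟩ = evalMatHom X h :=
    fun h hh => by
    induction hh using Algebra.adjoin_induction with
    | mem m h =>
      rcases h with h | ⟨w, hw, rfl⟩
      · exact hgen m _ h
      · rw [hscal _ (trace_mem_traceScalars (hsub w hw)), ← htr _ (hsub w hw), hword w hw,
          evalMatHom_smul_one, trace_evalMatHom]
    | algebraMap r =>
      have h1 : evalMatHom X (algebraMap ℝ (MatP n g) r) = algebraMap ℝ _ r := by
        rw [IsScalarTower.algebraMap_apply ℝ (PolyRing n g), Algebra.algebraMap_eq_smul_one,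
          evalMatHom_smul_one, MvPolynomial.algebraMap_eq, evalHom_C, algebraMap_smul,
          ← Algebra.algebraMap_eq_smul_one]
      rw [h1]
      exact hconst _ _
    | add x y hx hy hx' hy' =>
      rw [map_add, ← hx', ← hy']
      exact map_add θ ⟨x, hx⟩ ⟨y, hy⟩
    | mul x y hx hy hx' hy' =>
      rw [map_mul, ← hx', ← hy']
      exact hmul _ _ _ _
  exact ⟨X, hall, fun p hp => by rw [← hscal p hp, hall]⟩

end TraceRing

section Orderings

variable {n g : ℕ}

/-- The scalars of the trace ring inside a ring of matrices containing its center. -/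
def traceScalarsHom (Λ : Subring (MatP n g)) (h : centerSet n g ⊆ Λ) :
    traceScalars n g →+* Λ :=
  ((algebraMap (PolyRing n g) (MatP n g)).comp (traceScalars n g).subtype).codRestrict Λ
    fun c => h ⟨c.2, c, Algebra.algebraMap_eq_smul_one _⟩

theorem coe_traceScalarsHom (Λ : Subring (MatP n g)) (h : centerSet n g ⊆ Λ)
    (c : traceScalars n g) :
    (traceScalarsHom Λ h c : MatP n g) = (c : PolyRing n g) • 1 :=
  Algebra.algebraMap_eq_smul_one _

/-- Orderings of rings generated by the center and one element of the trace ring are pulled back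
from orderings of fields without proper real extensions. -/
theorem IsOrderingOf.exists_real_field {a : MatP n g} {P : Set (MatP n g)}
    (hP : IsOrderingOf n g (Subring.closure (centerSet n g ∪ {a})) P) :
    ∃ (R : Type) (_ : Field R) (_ : LinearOrder R) (_ : IsStrictOrderedRing R)
      (f : Subring.closure (centerSet n g ∪ {a}) →+* R),
      HasNoRealExtension R ∧
        ∀ x : Subring.closure (centerSet n g ∪ {a}), (x : MatP n g) ∈ P ↔ 0 ≤ f x := by
  have hcomm : ∀ x ∈ centerSet n g ∪ {a}, ∀ y ∈ centerSet n g ∪ {a}, x * y = y * x := by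
    have h1 : ∀ x ∈ centerSet n g, ∀ y : MatP n g, x * y = y * x := by
      rintro _ ⟨-, p, rfl⟩ y
      simp
    rintro x (hx | rfl) y (hy | rfl)
    · exact h1 x hx y
    · exact h1 x hx _
    · exact (h1 y hy _).symm
    · rfl
  let Λ := Subring.closure (centerSet n g ∪ {a})
  let _ : CommRing Λ :=
    { (inferInstance : Ring Λ) with
      mul_comm := (Subring.isMulCommutative_closure hcomm).is_comm.comm }
  obtain ⟨-, hadd, hmul, htot, hideal, hone, hprime⟩ := hP
  exact exists_real_field_of_ordering (Λ := Λ) {x | (x : MatP n g) ∈ P}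
    (fun x hx y hy => hadd x hx y hy) (fun x hx y hy => hmul x hx y hy)
    (fun x => htot x x.2) (fun x y h1 h2 => (hideal x x.2 y h1 h2).1) hone
    (fun x y h => hprime x x.2 y y.2 h)

/-- The values of a trace ring element under positive homomorphisms are eigenvalues of its
evaluations. -/
theorem exists_eigenvector_of_ringHom {R : Type} [Field R] [LinearOrder R] [IsStrictOrderedRing R]
    (hn : 0 < n) (hR : HasNoRealExtension R) {a : MatP n g} (ha : a ∈ traceRing n g)
    (Λ : Subring (MatP n g)) (hC : centerSet n g ⊆ Λ) (haΛ : a ∈ Λ) (ψ : Λ →+* R)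
    (hψ : ∀ x : Λ, (x : MatP n g) ∈ OmegaSet n g → 0 ≤ ψ x) :
    ∃ (_ : Algebra ℝ R) (X : Fin g → Matrix (Fin n) (Fin n) R),
      (∀ c : traceScalars n g, evalHom (fun v => X v.1 v.2.1 v.2.2) (c : PolyRing n g) =
        ψ (traceScalarsHom Λ hC c)) ∧
      ∃ v : Fin n → R, v ≠ 0 ∧ evalMatHom X a *ᵥ v = ψ ⟨a, haΛ⟩ • v := by
  let φ₀ : traceScalars n g →+* R := ψ.comp (traceScalarsHom Λ hC)
  let _ : Algebra ℝ R := (φ₀.comp (algebraMap ℝ (traceScalars n g))).toAlgebra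
  let φ : traceScalars n g →ₐ[ℝ] R := { φ₀ with commutes' := fun r => rfl }
  obtain ⟨θ, hθT, hθtr⟩ := exists_trace_representation hR (traceRing n g) (traceScalars n g)
    (fun h hh => transpose_mem_traceRing hh) (fun h hh => trace_mem_traceScalars hh)
    (fun c hc => mem_traceScalars.mp hc) φ (fun h hh => by
      refine hψ _ ?_
      rw [coe_traceScalarsHom]
      exact AddSubmonoid.subset_closure (Submonoid.subset_closure ⟨h, hh, rfl⟩))
  obtain ⟨X, -, hX⟩ := exists_eq_evalMatHom φ θ hθT hθtr
  have hφ : ∀ c : traceScalars n g,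
      evalHom (fun v => X v.1 v.2.1 v.2.2) (c : PolyRing n g) = φ c := fun c => by
    have h1 := congrFun (congrFun (hX c c.2) ⟨0, hn⟩) ⟨0, hn⟩
    rw [evalMatHom_smul_one] at h1
    simpa using h1.symm
  refine ⟨inferInstance, X, hφ, ?_⟩
  obtain ⟨q, hq⟩ := (Polynomial.lifts_iff_coeff_lifts
    (f := ((traceScalars n g).val : traceScalars n g →+* PolyRing n g)) a.charpoly).mpr fun k =>
    ⟨⟨_, Matrix.charpoly_coeff_mem_of_trace_pow_mem
      (fun j => trace_mem_traceScalars (Subalgebra.pow_mem _ ha _)) k⟩, rfl⟩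
  have hq' : q.map ((traceScalars n g).val : traceScalars n g →+* PolyRing n g) = a.charpoly := hq
  have h0 : q.eval₂ (traceScalarsHom Λ hC) ⟨a, haΛ⟩ = 0 := by
    apply Subtype.val_injective
    have h1 := Polynomial.hom_eval₂ q (traceScalarsHom Λ hC) Λ.subtype ⟨a, haΛ⟩
    have h2 : Λ.subtype.comp (traceScalarsHom Λ hC) = (algebraMap (PolyRing n g) (MatP n g)).comp
        ((traceScalars n g).val : traceScalars n g →+* PolyRing n g) := rfl
    rw [h2, ← Polynomial.eval₂_map, hq'] at h1
    exact h1.trans (Matrix.aeval_self_charpoly a)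
  have hroot : (evalMatHom X a).charpoly.eval (ψ ⟨a, haΛ⟩) = 0 := by
    have h1 := Polynomial.hom_eval₂ q (traceScalarsHom Λ hC) ψ ⟨a, haΛ⟩
    rw [h0, map_zero] at h1
    have h2 : ψ.comp (traceScalarsHom Λ hC) = (evalHom fun v => X v.1 v.2.1 v.2.2).comp
        ((traceScalars n g).val : traceScalars n g →+* PolyRing n g) :=
      RingHom.ext fun c => (hφ c).symm
    rw [h2, ← Polynomial.eval₂_map, hq', ← Polynomial.eval_map, ← Matrix.charpoly_map] at h1
    exact h1.symm
  rw [Matrix.eval_charpoly] at hroot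
  obtain ⟨v, hv0, hv⟩ := Matrix.exists_mulVec_eq_zero_iff.mpr hroot
  refine ⟨v, hv0, ?_⟩
  rw [sub_mulVec, sub_eq_zero] at hv
  rw [← hv]
  ext i
  simp

/-- Orderings positive on sums of traces of squares are witnessed by real points. -/
theorem exists_mem_KSet_sign_eq (hn : 0 < n) {S : Set (MatP n g)} (hSfin : S.Finite)
    (hS : S ⊆ centerSet n g) {a : MatP n g} (haT : a ∈ traceRing n g) {P : Set (MatP n g)}
    (hP : IsOrderingOf n g (Subring.closure (centerSet n g ∪ {a})) P)
    (hSP : S ∪ OmegaSet n g ⊆ P) :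
    ∃ X ∈ KSet n g S, ∃ v : Fin n → ℝ, v ≠ 0 ∧
      (a ∈ P ↔ 0 ≤ v ⬝ᵥ (evalMat n g X a *ᵥ v)) ∧
      (-a ∈ P ↔ v ⬝ᵥ (evalMat n g X a *ᵥ v) ≤ 0) := by
  obtain ⟨R, _, _, _, ψ, hR, hψ⟩ := hP.exists_real_field
  have hC : centerSet n g ⊆ Subring.closure (centerSet n g ∪ {a}) :=
    Set.subset_union_left.trans Subring.subset_closure
  have haΛ : a ∈ Subring.closure (centerSet n g ∪ {a}) := Subring.subset_closure (Or.inr rfl)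
  obtain ⟨_, X, hX, v, hv0, hv⟩ := exists_eigenvector_of_ringHom hn hR haT _ hC haΛ ψ
    fun x hx => (hψ x).mp (hSP (Or.inr hx))
  let k : Fin g × Fin n × Fin n → (Fin g × Fin n × Fin n) ⊕ Fin n := Sum.inl
  let l : (Fin g × Fin n × Fin n) ⊕ Fin n → R := Sum.elim (fun v => X v.1 v.2.1 v.2.2) v
  choose! p hpS using fun s (hs : s ∈ S) => (hS hs).2
  let N : MvPolynomial ((Fin g × Fin n × Fin n) ⊕ Fin n) ℝ :=
    ∑ i, MvPolynomial.X (Sum.inr i) * MvPolynomial.X (Sum.inr i)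
  let Q : MvPolynomial ((Fin g × Fin n × Fin n) ⊕ Fin n) ℝ :=
    ∑ i, MvPolynomial.X (Sum.inr i) *
      ∑ j, MvPolynomial.rename k (a i j) * MvPolynomial.X (Sum.inr j)
  classical
  obtain ⟨c, hc⟩ := hR.polynomialIVT.realSpecializable _ l
    (insert N (insert Q (hSfin.toFinset.image fun s => MvPolynomial.rename k (p s))))
  have hNF : ∀ {F : Type} [Field F] [Algebra ℝ F] (l : (Fin g × Fin n × Fin n) ⊕ Fin n → F),
      evalHom l N = (l ∘ Sum.inr) ⬝ᵥ (l ∘ Sum.inr) := fun l => by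
    simp [N, dotProduct]
  have hQF : ∀ {F : Type} [Field F] [Algebra ℝ F] (l : (Fin g × Fin n × Fin n) ⊕ Fin n → F),
      evalHom l Q = (l ∘ Sum.inr) ⬝ᵥ
        (evalMatHom (fun j => Matrix.of fun a b => l (k (j, a, b))) a *ᵥ (l ∘ Sum.inr)) :=
    fun l => by
    simp [Q, dotProduct, mulVec, evalHom_rename, evalMatHom]
    rfl
  have hl : ∀ q : PolyRing n g, evalHom l (MvPolynomial.rename k q) =
      evalHom (fun v => X v.1 v.2.1 v.2.2) q := fun q => evalHom_rename k l q
  let Y : Fin g → Matrix (Fin n) (Fin n) ℝ := fun j => Matrix.of fun a b => c (k (j, a, b))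
  have hY : ∀ h : MatP n g, evalMat n g Y h = evalMatHom Y h := fun h => rfl
  have hvv : 0 < v ⬝ᵥ v := by
    refine lt_of_le_of_ne (Finset.sum_nonneg fun i _ => mul_self_nonneg _) fun h => hv0 ?_
    exact dotProduct_self_eq_zero.mp h.symm
  have hlQ : evalHom l Q = ψ ⟨a, haΛ⟩ * (v ⬝ᵥ v) := by
    rw [hQF, ← smul_eq_mul, ← dotProduct_smul, ← hv]
    rfl
  have hcQ : SignType.sign ((c ∘ Sum.inr) ⬝ᵥ (evalMat n g Y a *ᵥ (c ∘ Sum.inr))) =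
      SignType.sign (ψ ⟨a, haΛ⟩) := by
    have h1 := hc Q (by simp)
    rw [hlQ, sign_mul, sign_pos hvv, mul_one, hQF] at h1
    exact h1
  refine ⟨Y, fun s hs => ?_, c ∘ Sum.inr, fun h => ?_, ?_, ?_⟩
  · have hpC : p s ∈ traceScalars n g := mem_traceScalars.mpr (hpS s hs ▸ (hS hs).1)
    have h1 := hc (MvPolynomial.rename k (p s)) (by simpa using Or.inr (Or.inr ⟨s, hs, rfl⟩))
    rw [hl, hX ⟨p s, hpC⟩] at h1
    have h2 : 0 ≤ ψ (traceScalarsHom _ hC ⟨p s, hpC⟩) := by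
      rw [← hψ, coe_traceScalarsHom, ← hpS s hs]
      exact hSP (Or.inl hs)
    rw [← sign_nonneg_iff, ← h1, sign_nonneg_iff, evalHom_rename] at h2
    rw [hY, hpS s hs, evalMatHom_smul_one]
    exact Matrix.PosSemidef.one.smul h2
  · have h1 := hc N (by simp)
    rw [hNF, hNF, h, dotProduct_zero, sign_zero] at h1
    exact hvv.ne (sign_eq_zero_iff.mp h1.symm).symm
  · rw [← sign_nonneg_iff, hcQ, sign_nonneg_iff]
    exact hψ ⟨a, haΛ⟩
  · rw [← sign_nonpos_iff, hcQ, sign_nonpos_iff, ← neg_nonneg, ← map_neg]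
    exact hψ (-⟨a, haΛ⟩)

end Orderings

/-- Orderings of C_n[a] containing S ∪ Ω_n reflect positivity on K_S. -/
theorem stmt8 (n g : ℕ) (hn : 0 < n) (hg : 0 < g)
    (S : Set (MatP n g)) (hSfin : S.Finite) (hS : S ⊆ centerSet n g)
    (a : MatP n g) (haT : a ∈ traceRing n g) (haSym : aᵀ = a)
    (P : Set (MatP n g))
    (hP : IsOrderingOf n g (Subring.closure (centerSet n g ∪ {a})) P)
    (hSP : S ∪ OmegaSet n g ⊆ P) :
    ((∀ X ∈ KSet n g S, (evalMat n g X a).PosSemidef) → a ∈ P) ∧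
    ((∀ X ∈ KSet n g S, (evalMat n g X a).PosDef) → a ∈ P ∧ -a ∉ P) ∧
    ((∀ X ∈ KSet n g S, evalMat n g X a = 0) → a ∈ P ∧ -a ∈ P) := by
  obtain ⟨X, hX, v, hv0, h1, h2⟩ := exists_mem_KSet_sign_eq hn hSfin hS haT hP hSP
  refine ⟨fun h => h1.mpr ?_, fun h => ⟨h1.mpr ?_, fun h3 => ?_⟩, fun h => ⟨h1.mpr ?_, h2.mpr ?_⟩⟩
  · simpa using (h X hX).dotProduct_mulVec_nonneg v
  · simpa using (h X hX).posSemidef.dotProduct_mulVec_nonneg v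
  · have := (h X hX).dotProduct_mulVec_pos hv0
    rw [star_trivial] at this
    exact absurd (h2.mp h3) (not_le.mpr this)
  · rw [h X hX, zero_mulVec, dotProduct_zero]
  · rw [h X hX, zero_mulVec, dotProduct_zero]
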